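/- Every Borel subset X of the Cantor space can be partitioned into countably many pairwise disjoint subspaces X_i such that each X_i is closed in X and each X_i, with the subspace topology, is h-homogeneous. -/

import Mathlib

/-- A topological space is *h-homogeneous* if every nonempty clopen subset,
with the subspace topology, is homeomorphic to the whole space. -/
def HHomogeneous (Y : Type*) [TopologicalSpace Y] : Prop :=
  ∀ U : Set Y, IsClopen U → U.Nonempty → Nonempty (U ≃ₜ Y)

set_option autoImplicit false

namespace BD

/-- Game trees: nodes with levels, parents, every node has a child. -/
structure GT where
  V : Type
  lev : V → ℕ
  par : V → V
  lev_par : ∀ v, lev (par v) = lev v - 1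
  child : ∀ v, ∃ w, par w = v ∧ lev w = lev v + 1

namespace GT

def IsRun (T : GT) (x : ℕ → T.V) : Prop :=
  ∀ n, T.lev (x n) = n ∧ T.par (x (n+1)) = x n

def IsStrat (T : GT) (s : T.V → T.V) : Prop :=
  ∀ v, T.par (s v) = v ∧ T.lev (s v) = T.lev v + 1

def Follows (T : GT) (b : ℕ) (s : T.V → T.V) (x : ℕ → T.V) : Prop :=
  ∀ n, n % 2 = b → x (n+1) = s (x n)

def anc (T : GT) (v : T.V) (k : ℕ) : T.V := T.par^[T.lev v - k] v

noncomputable def dflt (T : GT) (v : T.V) : T.V := (T.child v).choose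

lemma dflt_strat (T : GT) : T.IsStrat T.dflt := fun v => (T.child v).choose_spec

lemma lev_iter (T : GT) (v : T.V) (k : ℕ) : T.lev (T.par^[k] v) = T.lev v - k := by
  induction k with
  | zero => rfl
  | succ k ih => rw [Function.iterate_succ_apply', T.lev_par, ih]; omega

lemma lev_anc (T : GT) (v : T.V) (k : ℕ) : T.lev (T.anc v k) = min k (T.lev v) := by
  rw [anc, lev_iter]; omega

lemma anc_ge (T : GT) {v : T.V} {k : ℕ} (h : T.lev v ≤ k) : T.anc v k = v := by
  rw [anc, Nat.sub_eq_zero_of_le h]; rfl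

lemma anc_anc (T : GT) (v : T.V) (k l : ℕ) : T.anc (T.anc v k) l = T.anc v (min k l) := by
  unfold anc
  rw [lev_iter, ← Function.iterate_add_apply]
  congr 1; omega

lemma anc_par (T : GT) (v : T.V) (k : ℕ) (h : 1 ≤ T.lev v) : T.anc (T.par v) k = T.anc v (min k (T.lev v - 1)) := by
  unfold anc
  rw [lev_par, ← Function.iterate_succ_apply]
  congr 1; omega

lemma anc_child (T : GT) {v w : T.V} (h1 : T.par w = v) (h2 : T.lev w = T.lev v + 1) {k : ℕ}
    (hk : k ≤ T.lev v) : T.anc w k = T.anc v k := by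
  rw [← h1, anc_par _ _ _ (by omega)]; congr 1; omega

lemma par_anc (T : GT) (v : T.V) (k : ℕ) (h : k + 1 ≤ T.lev v) : T.par (T.anc v (k+1)) = T.anc v k := by
  unfold anc
  rw [← Function.iterate_succ_apply' (f := T.par)]
  congr 1; omega

lemma IsRun.anc {T : GT} {x : ℕ → T.V} (hx : T.IsRun x) (n k : ℕ) : T.anc (x n) k = x (min k n) := by
  induction n with
  | zero => rw [T.anc_ge (by rw [(hx 0).1]; omega)]; congr 1; omega
  | succ n ih =>
    by_cases h : n + 1 ≤ k
    · rw [T.anc_ge (by rw [(hx _).1]; omega)]; congr 1; omega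
    · rw [T.anc_child (hx n).2 (by rw [(hx _).1, (hx _).1]) (by rw [(hx _).1]; omega), ih]
      congr 1; omega

lemma IsRun.eq_of_eq {T : GT} {x y : ℕ → T.V} (hx : T.IsRun x) (hy : T.IsRun y) {n : ℕ} (h : x n = y n)
   {k : ℕ} (hk : k ≤ n) : x k = y k := by
  have h1 := hx.anc n k
  have h2 := hy.anc n k
  rw [min_eq_left hk] at h1 h2
  rw [← h1, ← h2, h]

/-- Forcing predicate: player `b` can force reaching `U`. -/
inductive Win (T : GT) (b : ℕ) (U : Set T.V) : T.V → Prop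
  | base (p : T.V) : p ∈ U → Win T b U p
  | mine (p q : T.V) : T.lev p % 2 = b → T.par q = p → T.lev q = T.lev p + 1 → Win T b U q → Win T b U p
  | theirs (p : T.V) : T.lev p % 2 ≠ b → (∀ q, T.par q = p → T.lev q = T.lev p + 1 → Win T b U q) →
      Win T b U p

def WinStrat (T : GT) (b : ℕ) (U : Set T.V) (p : T.V) (s : T.V → T.V) : Prop :=
  T.IsStrat s ∧ ∀ x, T.IsRun x → x (T.lev p) = p → (∀ n, T.lev p ≤ n → n % 2 = b → x (n+1) = s (x n)) →
    ∃ n, T.lev p ≤ n ∧ x n ∈ U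

lemma Win.strat {T : GT} {b : ℕ} {U : Set T.V} {p : T.V} (h : T.Win b U p) : ∃ s, T.WinStrat b U p s := by
  induction h with
  | base p hp => exact ⟨T.dflt, T.dflt_strat, fun x hx hp' _ => ⟨_, le_rfl, by rw [hp']; exact hp⟩⟩
  | mine p q hb h1 h2 _ ih =>
    classical
    obtain ⟨s, hs, hw⟩ := ih
    refine ⟨fun v => if v = p then q else s v, ?_, ?_⟩
    · intro v
      by_cases hv : v = p
      · simp [hv, h1, h2]
      · simp only [hv, if_false]; exact hs v
    · intro x hx hp hf
      have e : x (T.lev p + 1) = q := by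
        have := hf _ le_rfl hb
        simpa [hp] using this
      obtain ⟨n, hn, hU⟩ := hw x hx (by rw [h2, e]) (by
        intro n hn hnb
        have := hf n (by omega) hnb
        beta_reduce at this
        rw [if_neg] at this
        · exact this
        · intro hh
          have := (hx n).1
          rw [hh] at this; omega)
      exact ⟨n, by omega, hU⟩
  | theirs p hb _ ih =>
    classical
    choose! s hs hw using ih
    refine ⟨fun v => if T.par (T.anc v (T.lev p + 1)) = p ∧ T.lev p + 1 ≤ T.lev v then s (T.anc v (T.lev p + 1)) v else T.dflt v, ?_, ?_⟩
    · intro v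
      dsimp only
      split_ifs with hv
      · exact hs _ hv.1 (by rw [lev_anc]; omega) v
      · exact T.dflt_strat v
    · intro x hx hp hf
      have h1 : T.par (x (T.lev p + 1)) = p := by rw [(hx _).2, hp]
      have h2 := (hx (T.lev p + 1)).1
      obtain ⟨n, hn, hU⟩ := hw _ h1 h2 x hx (by rw [h2]) (by
        intro n hn hnb
        rw [h2] at hn
        rw [hf n (by omega) hnb]
        beta_reduce
        rw [if_pos]
        · rw [hx.anc, min_eq_left hn]
        · rw [hx.anc, min_eq_left hn, (hx n).1]; exact ⟨h1, hn⟩)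
      exact ⟨n, by omega, hU⟩

/-- Runs-level clopen sets. -/
def Clop (T : GT) (Y : Set (ℕ → T.V)) : Prop :=
  ∀ x, T.IsRun x → ∃ n, ∀ y, T.IsRun y → y n = x n → (y ∈ Y ↔ x ∈ Y)

def Opn (T : GT) (Y : Set (ℕ → T.V)) : Prop :=
  ∀ x, T.IsRun x → x ∈ Y → ∃ n, ∀ y, T.IsRun y → y n = x n → y ∈ Y

structure Hom (T' T : GT) where
  π : T'.V → T.V
  lev_π : ∀ v, T.lev (π v) = T'.lev v
  par_π : ∀ v, T.par (π v) = π (T'.par v)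

lemma Hom.run {T' T : GT} (f : Hom T' T) {x : ℕ → T'.V} (hx : T'.IsRun x) : T.IsRun (fun n => f.π (x n)) :=
  fun n => ⟨by rw [f.lev_π, (hx n).1], by dsimp only; rw [f.par_π, (hx n).2]⟩

structure Cov (T' T : GT) (N : ℕ) extends Hom T' T where
  inj : ∀ v w, T'.lev v ≤ N → π v = π w → v = w
  surj : ∀ v, T.lev v ≤ N → ∃ w, π w = v
  φ : ℕ → (T'.V → T'.V) → T.V → T.V
  strat : ∀ b s, T'.IsStrat s → T.IsStrat (φ b s)
  loc : ∀ b s s' n, T'.IsStrat s → T'.IsStrat s' → (∀ v, T'.lev v < n → s v = s' v) → ∀ v, T.lev v < n → φ b s v = φ b s' v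
  ident : ∀ b s v, T'.IsStrat s → T'.lev v < N → φ b s (π v) = π (s v)
  lift : ∀ b, b < 2 → ∀ s x, T'.IsStrat s → T.IsRun x → T.Follows b (φ b s) x →
    ∃ x', T'.IsRun x' ∧ T'.Follows b s x' ∧ ∀ n, π (x' n) = x n

def Hom.comp {A B C : GT} (f : Hom B C) (g : Hom A B) : Hom A C where
  π := f.π ∘ g.π
  lev_π v := by simp [f.lev_π, g.lev_π]
  par_π v := by simp [f.par_π, g.par_π]

def Cov.comp {A B C : GT} {N : ℕ} (f : Cov B C N) (g : Cov A B N) : Cov A C N where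
  toHom := f.toHom.comp g.toHom
  inj v w hv h := g.inj v w hv (f.inj _ _ (by rw [g.lev_π]; exact hv) h)
  surj v hv := by
    obtain ⟨w, rfl⟩ := f.surj v hv
    obtain ⟨u, rfl⟩ := g.surj w (by rw [f.lev_π] at hv; exact hv)
    exact ⟨u, rfl⟩
  φ b s := f.φ b (g.φ b s)
  strat b s hs := f.strat b _ (g.strat b s hs)
  loc b s s' n hs hs' h := f.loc b _ _ n (g.strat b s hs) (g.strat b s' hs') (g.loc b s s' n hs hs' h)
  ident b s v hs hv := by
    show f.φ b (g.φ b s) (f.π (g.π v)) = f.π (g.π (s v))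
    rw [f.ident b _ _ (g.strat b s hs) (by rw [g.lev_π]; exact hv), g.ident b s v hs hv]
  lift b hb s x hs hx hf := by
    obtain ⟨x', h1, h2, h3⟩ := f.lift b hb _ x (g.strat b s hs) hx hf
    obtain ⟨x'', k1, k2, k3⟩ := g.lift b hb _ x' hs h1 h2
    exact ⟨x'', k1, k2, fun n => by
      show f.π (g.π _) = _
      rw [k3, h3]⟩

def Cov.mono {A B : GT} {N N' : ℕ} (h : N' ≤ N) (f : Cov A B N) : Cov A B N' :=
  { f with
    inj := fun v w hv => f.inj v w (hv.trans h)
    surj := fun v hv => f.surj v (hv.trans h)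
    ident := fun b s v hs hv => f.ident b s v hs (lt_of_lt_of_le hv h) }

/-- Hereditarily unravelable. -/
def HU (T₀ : GT) (X : Set (ℕ → T₀.V)) : Prop :=
  ∀ (T : GT) (f : Hom T T₀) (N : ℕ), ∃ (T' : GT) (c : Cov T' T N),
    T'.Clop {x | (fun n => f.π (c.π (x n))) ∈ X}

lemma HU.compl {T₀ : GT} {X : Set (ℕ → T₀.V)} (h : T₀.HU X) : T₀.HU Xᶜ := by
  intro T f N
  obtain ⟨T', c, hc⟩ := h T f N
  refine ⟨T', c, fun x hx => ?_⟩
  obtain ⟨n, hn⟩ := hc x hx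
  exact ⟨n, fun y hy hyx => not_congr (hn y hy hyx)⟩

/-- Clopen determinacy. -/
lemma clop_det (T : GT) (r : T.V) (hr : ∀ v, T.lev v = 0 ↔ v = r) (Y : Set (ℕ → T.V)) (hY : T.Clop Y) :
    (∃ s, T.IsStrat s ∧ ∀ x, T.IsRun x → T.Follows 0 s x → x ∈ Y) ∨
    (∃ s, T.IsStrat s ∧ ∀ x, T.IsRun x → T.Follows 1 s x → x ∉ Y) := by
  classical
  set U : Set T.V := {v | ∀ x, T.IsRun x → x (T.lev v) = v → x ∈ Y} with hU
  have hr0 : T.lev r = 0 := (hr r).2 rfl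
  by_cases hw : T.Win 0 U r
  · left
    obtain ⟨s, hs, hw⟩ := hw.strat
    refine ⟨s, hs, fun x hx hf => ?_⟩
    obtain ⟨n, _, hn⟩ := hw x hx (by rw [hr0]; exact (hr _).1 (hx 0).1) (fun n _ => hf n)
    exact hn x hx (by rw [(hx n).1])
  · right
    refine ⟨fun v => if h : ∃ w, T.par w = v ∧ T.lev w = T.lev v + 1 ∧ ¬ T.Win 0 U w then h.choose else T.dflt v, ?_, ?_⟩
    · intro v
      dsimp only
      split_ifs with h
      · exact ⟨h.choose_spec.1, h.choose_spec.2.1⟩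
      · exact T.dflt_strat v
    · intro x hx hf hxY
      have key : ∀ n, ¬ T.Win 0 U (x n) := by
        intro n
        induction n with
        | zero => rw [(hr _).1 (hx 0).1]; exact hw
        | succ n ih =>
          by_cases hn : n % 2 = 0
          · intro hh
            exact ih (Win.mine _ _ (by rw [(hx n).1, hn]) (hx n).2 (by rw [(hx n).1, (hx _).1]) hh)
          · have h : ∃ w, T.par w = x n ∧ T.lev w = T.lev (x n) + 1 ∧ ¬ T.Win 0 U w := by
              by_contra hcon
              push Not at hcon
              exact ih (Win.theirs _ (by rw [(hx n).1]; exact hn) hcon)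
            rw [hf n (by omega)]
            beta_reduce
            rw [dif_pos h]
            exact h.choose_spec.2.2
      obtain ⟨n, hn⟩ := hY x hx
      exact key n (Win.base _ fun y hy hyx => (hn y hy (by rw [(hx n).1] at hyx; exact hyx)).2 hxY)

lemma HU.det {T : GT} (r : T.V) (hr : ∀ v, T.lev v = 0 ↔ v = r) {Y : Set (ℕ → T.V)} (hY : T.HU Y) :
    (∃ s, T.IsStrat s ∧ ∀ x, T.IsRun x → T.Follows 0 s x → x ∈ Y) ∨
    (∃ s, T.IsStrat s ∧ ∀ x, T.IsRun x → T.Follows 1 s x → x ∉ Y) := by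
  obtain ⟨T', c, hc⟩ := hY T ⟨id, fun _ => rfl, fun _ => rfl⟩ 0
  obtain ⟨r', rfl⟩ := c.surj r (by rw [(hr r).2 rfl])
  have hr' : ∀ v, T'.lev v = 0 ↔ v = r' := by
    intro v
    constructor
    · intro h
      exact c.inj _ _ h.le ((hr _).1 (by rw [c.lev_π, h]))
    · rintro rfl
      rw [← c.lev_π]; exact (hr _).2 rfl
  rcases clop_det T' r' hr' _ hc with ⟨s, hs, hw⟩ | ⟨s, hs, hw⟩
  · left
    refine ⟨c.φ 0 s, c.strat 0 s hs, fun x hx hf => ?_⟩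
    obtain ⟨x', h1, h2, h3⟩ := c.lift 0 (by norm_num) s x hs hx hf
    have := hw x' h1 h2
    simpa [h3] using this
  · right
    refine ⟨c.φ 1 s, c.strat 1 s hs, fun x hx hf => ?_⟩
    obtain ⟨x', h1, h2, h3⟩ := c.lift 1 (by norm_num) s x hs hx hf
    have := hw x' h1 h2
    simpa [h3] using this

end GT
end BD

namespace BD
namespace GT

def Chd (T : GT) (w v : T.V) : Prop := T.par w = v ∧ T.lev w = T.lev v + 1

lemma IsRun.chd {T : GT} {x : ℕ → T.V} (hx : T.IsRun x) (n : ℕ) : T.Chd (x (n+1)) (x n) :=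
  ⟨(hx n).2, by rw [(hx _).1, (hx _).1]⟩

def hit (T : GT) (E : Set T.V) (lo : ℕ) (v : T.V) : Prop := ∃ k, lo ≤ k ∧ k ≤ T.lev v ∧ T.anc v k ∈ E

open Classical in
noncomputable def fst (T : GT) (E : Set T.V) (lo : ℕ) (v : T.V) : T.V :=
  if h : T.hit E lo v then T.anc v (Nat.find h) else v

lemma hit_run {T : GT} {x : ℕ → T.V} (hx : T.IsRun x) (E : Set T.V) (lo n : ℕ) :
    T.hit E lo (x n) ↔ ∃ k, lo ≤ k ∧ k ≤ n ∧ x k ∈ E := by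
  unfold hit
  refine exists_congr fun k => ?_
  rw [(hx n).1]
  refine and_congr_right fun _ => and_congr_right fun h => ?_
  rw [hx.anc, min_eq_left h]

lemma fst_run {T : GT} {x : ℕ → T.V} (hx : T.IsRun x) (E : Set T.V) (lo n m : ℕ) (hm : lo ≤ m) (hmn : m ≤ n)
   (h1 : x m ∈ E) (h2 : ∀ k, lo ≤ k → k < m → x k ∉ E) : T.fst E lo (x n) = x m := by
  classical
  have h : T.hit E lo (x n) := (hit_run hx E lo n).2 ⟨m, hm, hmn, h1⟩
  rw [fst, dif_pos h]
  have : Nat.find h = m := by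
    refine (Nat.find_eq_iff (h := h)).2 ?_
    refine ⟨⟨hm, by rw [(hx n).1]; exact hmn, by rw [hx.anc, min_eq_left hmn]; exact h1⟩, ?_⟩
    rintro k hk ⟨a, b, c⟩
    rw [hx.anc, min_eq_left (by omega)] at c
    exact h2 k a hk c
  rw [this, hx.anc, min_eq_left hmn]

open Classical in
noncomputable def wst (T : GT) (b : ℕ) (U : Set T.V) (q : T.V) : T.V → T.V :=
  if h : T.Win b U q then h.strat.choose else T.dflt

lemma wst_strat (T : GT) (b : ℕ) (U : Set T.V) (q : T.V) : T.IsStrat (T.wst b U q) := by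
  unfold wst
  split_ifs with h
  · exact h.strat.choose_spec.1
  · exact T.dflt_strat

lemma wst_win (T : GT) (b : ℕ) (U : Set T.V) (q : T.V) (h : T.Win b U q) : T.WinStrat b U q (T.wst b U q) := by
  unfold wst
  rw [dif_pos h]
  exact h.strat.choose_spec

open Classical in
noncomputable def pl (T : GT) (N : ℕ) (b : ℕ) (E : Set T.V) (A : T.V → T.V → T.V) (B : T.V → T.V) (v : T.V) : T.V :=
  if T.hit E (N+1) v then A (T.fst E (N+1) v) v else
  if T.hit {q | T.Win b E q} (N+1) v then T.wst b E (T.fst {q | T.Win b E q} (N+1) v) v else B v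

lemma pl_congr (T : GT) (N : ℕ) (b : ℕ) {E E' : Set T.V} {A A' : T.V → T.V → T.V} {B B' : T.V → T.V} {v : T.V}
   (h1 : E = E') (h2 : ∀ u, A u v = A' u v) (h3 : B v = B' v) : T.pl N b E A B v = T.pl N b E' A' B' v := by
  subst h1
  unfold pl
  rw [h2, h3]

lemma pl_chd (T : GT) (N : ℕ) (b : ℕ) {E : Set T.V} {A : T.V → T.V → T.V} {B : T.V → T.V} {v : T.V}
   (h2 : ∀ u, T.Chd (A u v) v) (h3 : T.Chd (B v) v) : T.Chd (T.pl N b E A B v) v := by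
  unfold pl
  split_ifs
  · exact h2 _
  · exact T.wst_strat _ _ _ v
  · exact h3

lemma exists_first {P : ℕ → Prop} {lo : ℕ} (h : ∃ k, lo ≤ k ∧ P k) :
    ∃ m, lo ≤ m ∧ P m ∧ ∀ k, lo ≤ k → k < m → ¬ P k := by
  classical
  exact ⟨Nat.find h, (Nat.find_spec h).1, (Nat.find_spec h).2, fun k h1 h2 h3 => Nat.find_min h h2 ⟨h1, h3⟩⟩

lemma pl_run {T : GT} {N b : ℕ} {E : Set T.V} {A : T.V → T.V → T.V} {B : T.V → T.V} {x : ℕ → T.V}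
   (hx : T.IsRun x) (hf : ∀ n, N + 1 ≤ n → n % 2 = b → x (n+1) = T.pl N b E A B (x n)) :
   (∃ m, N + 1 ≤ m ∧ x m ∈ E ∧ ∀ n, m ≤ n → n % 2 = b → x (n+1) = A (x m) (x n)) ∨
   (∀ n, N + 1 ≤ n → ¬ T.Win b E (x n) ∧ (n % 2 = b → x (n+1) = B (x n))) := by
  by_cases hE : ∃ k, N + 1 ≤ k ∧ x k ∈ E
  · left
    obtain ⟨m, h1, h2, h3⟩ := exists_first hE
    refine ⟨m, h1, h2, fun n hn hb => ?_⟩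
    rw [hf n (by omega) hb, pl, if_pos ((hit_run hx _ _ _).2 ⟨m, h1, hn, h2⟩), fst_run hx E (N+1) n m h1 hn h2 h3]
  · right
    have hE' : ∀ n, ¬ T.hit E (N+1) (x n) := by
      intro n hh
      obtain ⟨k, h1, _, h3⟩ := (hit_run hx _ _ _).1 hh
      exact hE ⟨k, h1, h3⟩
    have hW : ¬ ∃ k, N + 1 ≤ k ∧ T.Win b E (x k) := by
      intro hW
      obtain ⟨m, h1, h2, h3⟩ := exists_first hW
      obtain ⟨_, hw⟩ := T.wst_win b E (x m) h2
      obtain ⟨n, h4, h5⟩ := hw x hx (by rw [(hx m).1]) (by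
        intro n hn hb
        rw [(hx m).1] at hn
        rw [hf n (by omega) hb, pl, if_neg (hE' n), if_pos ((hit_run hx {q | T.Win b E q} _ _).2 ⟨m, h1, hn, h2⟩),
          fst_run hx {q | T.Win b E q} (N+1) n m h1 hn h2 h3])
      rw [(hx m).1] at h4
      exact hE ⟨n, by omega, h5⟩
    refine fun n hn => ⟨fun h => hW ⟨n, hn, h⟩, fun hb => ?_⟩
    rw [hf n hn hb, pl, if_neg (hE' n), if_neg]
    intro hh
    obtain ⟨k, h1, _, h3⟩ := (hit_run hx _ _ _).1 hh
    exact hW ⟨k, h1, h3⟩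

section unravel
variable (T : GT) (N : ℕ) (X : Set (ℕ → T.V))

def TX : Set T.V := {q | ∃ x, T.IsRun x ∧ x ∈ X ∧ x (T.lev q) = q}

def QS (S : Set T.V) : Prop := ∀ q ∈ S, N + 1 ≤ T.lev q ∧ (T.lev q % 2 = 1 → ∀ w, T.Chd w q → w ∈ S) ∧
  (T.lev q % 2 = 0 → ∃ w, T.Chd w q ∧ w ∈ S)

abbrev Tag := Set T.V × (T.V ⊕ Set T.V)

def CV (p : T.V) (S : Set T.V) : T.V ⊕ Set T.V → Prop
  | Sum.inl u => N + 2 ≤ T.lev u ∧ u ∈ S ∧ u ∉ T.TX X ∧ T.anc u (T.lev p) = T.anc p (T.lev u)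
  | Sum.inr R => R ⊆ S ∧ R ⊆ T.TX X ∧ (∀ k, N + 2 ≤ k → T.anc p k ∈ R) ∧
      ∀ q ∈ R, (T.lev q % 2 = 1 → ∃ w, T.Chd w q ∧ w ∈ R) ∧ (T.lev q % 2 = 0 → ∀ w, T.Chd w q → w ∈ S → w ∈ R)

def Vld (t : T.V × Set T.V × (T.V ⊕ Set T.V)) : Prop :=
  (T.lev t.1 ≤ N ∧ t.2.1 = ∅ ∧ t.2.2 = Sum.inr ∅) ∨
  (T.lev t.1 = N + 1 ∧ T.QS N t.2.1 ∧ t.1 ∈ t.2.1 ∧ t.2.2 = Sum.inr ∅) ∨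
  (N + 2 ≤ T.lev t.1 ∧ T.QS N t.2.1 ∧ T.anc t.1 (N+1) ∈ t.2.1 ∧ T.CV N X t.1 t.2.1 t.2.2)

lemma Vld.low {T : GT} {N : ℕ} {X : Set (ℕ → T.V)} {t : T.V × Set T.V × (T.V ⊕ Set T.V)} (h : T.Vld N X t)
  (hl : T.lev t.1 ≤ N) : t.2.1 = ∅ ∧ t.2.2 = Sum.inr ∅ := by
  rcases h with h | h | h
  · exact h.2
  · omega
  · omega

lemma Vld.mid {T : GT} {N : ℕ} {X : Set (ℕ → T.V)} {t : T.V × Set T.V × (T.V ⊕ Set T.V)} (h : T.Vld N X t)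
  (hl : T.lev t.1 = N + 1) : T.QS N t.2.1 ∧ t.1 ∈ t.2.1 ∧ t.2.2 = Sum.inr ∅ := by
  rcases h with h | h | h
  · omega
  · exact h.2
  · omega

lemma Vld.high {T : GT} {N : ℕ} {X : Set (ℕ → T.V)} {t : T.V × Set T.V × (T.V ⊕ Set T.V)} (h : T.Vld N X t)
  (hl : N + 2 ≤ T.lev t.1) : T.QS N t.2.1 ∧ T.anc t.1 (N+1) ∈ t.2.1 ∧ T.CV N X t.1 t.2.1 t.2.2 := by
  rcases h with h | h | h
  · omega
  · omega
  · exact h.2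

open Classical in
noncomputable def parT (t : T.V × Set T.V × (T.V ⊕ Set T.V)) : T.V × Set T.V × (T.V ⊕ Set T.V) :=
  (T.par t.1, if T.lev t.1 ≤ N + 1 then ∅ else t.2.1, if T.lev t.1 ≤ N + 2 then Sum.inr ∅ else t.2.2)

lemma CV.par {T : GT} {N : ℕ} {X : Set (ℕ → T.V)} {p : T.V} {S : Set T.V} {c : T.V ⊕ Set T.V}
    (h : T.CV N X p S c) (hl : N + 3 ≤ T.lev p) : T.CV N X (T.par p) S c := by
  cases c with
  | inl u =>
    obtain ⟨h1, h2, h3, h4⟩ := h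
    refine ⟨h1, h2, h3, ?_⟩
    rw [T.lev_par, T.anc_par _ _ (by omega)]
    have := congrArg (fun z => T.anc z (T.lev p - 1)) h4
    rw [anc_anc, anc_anc] at this
    rw [← this]
    congr 1
    omega
  | inr R =>
    obtain ⟨h1, h2, h3, h4⟩ := h
    refine ⟨h1, h2, fun k hk => ?_, h4⟩
    rw [T.anc_par _ _ (by omega)]
    exact h3 _ (by omega)

lemma parT_vld {t : T.V × Set T.V × (T.V ⊕ Set T.V)} (h : T.Vld N X t) : T.Vld N X (T.parT N t) := by
  have hp := T.lev_par t.1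
  by_cases h1 : T.lev t.1 ≤ N + 1
  · left
    refine ⟨?_, ?_, ?_⟩
    · show T.lev (T.par t.1) ≤ N
      omega
    · simp [parT, h1]
    · simp [parT]; omega
  · obtain ⟨a, b, c⟩ := h.high (by omega)
    by_cases h2 : T.lev t.1 = N + 2
    · right; left
      simp only [parT, h1, if_false]
      rw [if_pos (by omega)]
      refine ⟨by omega, a, ?_, rfl⟩
      have := T.anc_par t.1 (N+1) (by omega)
      rw [T.anc_ge (by omega)] at this
      rw [this]
      convert b using 2
      omega
    · right; right
      simp only [parT, h1, if_false]
      rw [if_neg (by omega)]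
      refine ⟨by omega, a, ?_, c.par (by omega)⟩
      rw [T.anc_par _ _ (by omega)]
      convert b using 2
      omega

lemma vld_child (hN : N % 2 = 0) {t : T.V × Set T.V × (T.V ⊕ Set T.V)} (h : T.Vld N X t) :
    ∃ t', T.Vld N X t' ∧ T.parT N t' = t ∧ T.lev t'.1 = T.lev t.1 + 1 := by
  obtain ⟨p, S, c⟩ := t
  rcases lt_trichotomy (T.lev p) (N + 1) with h1 | h1 | h1
  · obtain ⟨h2, h3⟩ := h.low (by dsimp only; omega)
    dsimp only at h2 h3
    subst h2 h3
    obtain ⟨w, h4, h5⟩ := T.child p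
    by_cases hl : T.lev p = N
    · refine ⟨(w, {q | N + 1 ≤ T.lev q}, Sum.inr ∅), ?_, ?_, h5⟩
      · right; left
        refine ⟨by dsimp only; omega, ?_, by simp; omega, rfl⟩
        intro q hq
        refine ⟨hq, fun _ w hw => ?_, fun _ => ?_⟩
        · have := hw.2
          have hq' : N + 1 ≤ T.lev q := hq
          show N + 1 ≤ T.lev w
          omega
        · obtain ⟨w, hw⟩ := T.child q
          have hq' : N + 1 ≤ T.lev q := hq
          exact ⟨w, hw, by show N + 1 ≤ T.lev w; omega⟩
      · simp [parT, h4, h5, hl]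
    · refine ⟨(w, ∅, Sum.inr ∅), Or.inl ⟨by dsimp only; omega, rfl, rfl⟩, ?_, h5⟩
      simp [parT, h4]
  · obtain ⟨h2, h3, h4⟩ := h.mid h1
    dsimp only at h2 h3 h4
    subst h4
    obtain ⟨w, h4, h5⟩ := T.child p
    have hw : w ∈ S := (h2 p h3).2.1 (by omega) w ⟨h4, h5⟩
    have hanc : T.anc w (N+1) ∈ S := by
      rw [T.anc_child h4 h5 (by omega), T.anc_ge (by omega)]; exact h3
    have hpar : ∀ c, T.parT N (w, S, c) = (p, S, Sum.inr ∅) := by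
      intro c
      simp [parT, h4, h5, h1]
    by_cases hu : ∃ u, N + 2 ≤ T.lev u ∧ u ∈ S ∧ u ∉ T.TX X ∧ T.anc u (T.lev w) = T.anc w (T.lev u)
    · obtain ⟨u, hu⟩ := hu
      exact ⟨(w, S, Sum.inl u), Or.inr (Or.inr ⟨by dsimp only; omega, h2, hanc, hu⟩), hpar _, h5⟩
    · refine ⟨(w, S, Sum.inr {q | q ∈ S ∧ N + 2 ≤ T.lev q ∧ T.anc q (N+2) = w}), Or.inr (Or.inr ⟨by dsimp only; omega, h2, hanc, ?_⟩), hpar _, h5⟩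
      refine ⟨fun q hq => hq.1, fun q hq => ?_, fun k hk => ?_, fun q hq => ⟨fun ho => ?_, fun he w' hw' hS => ?_⟩⟩
      · by_contra hcon
        refine hu ⟨q, hq.2.1, hq.1, hcon, ?_⟩
        have : T.lev w = N + 2 := by omega
        rw [this, hq.2.2, T.anc_ge (by have := hq.2.1; omega)]
      · show T.anc w k ∈ _
        rw [T.anc_ge (by omega)]
        exact ⟨hw, by omega, T.anc_ge (by omega)⟩
      · obtain ⟨z, hz⟩ := T.child q
        refine ⟨z, hz, (h2 q hq.1).2.1 ho z hz, ?_, ?_⟩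
        · have := hq.2.1; omega
        · rw [T.anc_child hz.1 hz.2 hq.2.1]; exact hq.2.2
      · refine ⟨hS, ?_, ?_⟩
        · have := hq.2.1; have := hw'.2; omega
        · rw [T.anc_child hw'.1 hw'.2 hq.2.1]; exact hq.2.2
  · obtain ⟨h2, h3, h4⟩ := h.high (by dsimp only; omega)
    dsimp only at h2 h3 h4
    suffices hs : ∃ w, T.Chd w p ∧ T.CV N X w S c by
      obtain ⟨w, hw, hc⟩ := hs
      refine ⟨(w, S, c), Or.inr (Or.inr ⟨?_, h2, ?_, hc⟩), ?_, hw.2⟩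
      · have := hw.2; dsimp only; omega
      · show T.anc w (N+1) ∈ S
        rw [T.anc_child hw.1 hw.2 (by omega)]; exact h3
      · have := hw.2
        simp only [parT, hw.1]
        rw [if_neg (by omega), if_neg (by omega)]
    cases c with
    | inl u =>
      obtain ⟨k1, k2, k3, k4⟩ := h4
      by_cases hlu : T.lev p < T.lev u
      · refine ⟨T.anc u (T.lev p + 1), ⟨?_, ?_⟩, k1, k2, k3, ?_⟩
        · rw [T.par_anc _ _ (by omega), k4, T.anc_ge (by omega)]
        · rw [T.lev_anc]; omega
        · rw [T.lev_anc, T.anc_anc]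
      · obtain ⟨w, hw⟩ := T.child p
        refine ⟨w, hw, k1, k2, k3, ?_⟩
        rw [T.anc_child hw.1 hw.2 (by omega), ← k4, T.anc_ge (by omega), T.anc_ge (by omega)]
    | inr R =>
      obtain ⟨k1, k2, k3, k4⟩ := h4
      have hpR : p ∈ R := by
        have := k3 (T.lev p) (by omega)
        rwa [T.anc_ge le_rfl] at this
      have : ∃ w, T.Chd w p ∧ w ∈ R := by
        rcases Nat.mod_two_eq_zero_or_one (T.lev p) with h | h
        · obtain ⟨w, hw, hS⟩ := (h2 p (k1 hpR)).2.2 h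
          exact ⟨w, hw, (k4 p hpR).2 h w hw hS⟩
        · exact (k4 p hpR).1 h
      obtain ⟨w, hw, hR⟩ := this
      refine ⟨w, hw, k1, k2, fun k hk => ?_, k4⟩
      by_cases hk2 : k ≤ T.lev p
      · rw [T.anc_child hw.1 hw.2 hk2]; exact k3 k hk
      · rw [T.anc_ge (by have := hw.2; omega)]; exact hR

/-- The unraveling tree. -/
noncomputable def UT (hN : N % 2 = 0) : GT where
  V := {t // T.Vld N X t}
  lev t := T.lev t.1.1
  par t := ⟨T.parT N t.1, T.parT_vld N X t.2⟩
  lev_par t := T.lev_par _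
  child t := by
    obtain ⟨t', h1, h2, h3⟩ := T.vld_child N X hN t.2
    exact ⟨⟨t', h1⟩, Subtype.ext h2, h3⟩

variable (hN : N % 2 = 0)

open Classical in
noncomputable def go (s : (T.UT N X hN).V → (T.UT N X hN).V) (t : T.V × Set T.V × (T.V ⊕ Set T.V)) : T.V :=
  if h : T.Vld N X t then (s ⟨t, h⟩).1.1 else T.dflt t.1

lemma go_vld {s : (T.UT N X hN).V → (T.UT N X hN).V} {t : T.V × Set T.V × (T.V ⊕ Set T.V)} (h : T.Vld N X t) :
    T.go N X hN s t = (s ⟨t, h⟩).1.1 := dif_pos h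

lemma go_chd {s : (T.UT N X hN).V → (T.UT N X hN).V} (hs : (T.UT N X hN).IsStrat s)
    (t : T.V × Set T.V × (T.V ⊕ Set T.V)) : T.Chd (T.go N X hN s t) t.1 := by
  unfold go
  split_ifs with h
  · have := hs ⟨t, h⟩
    refine ⟨?_, this.2⟩
    have h1 := congrArg (fun z => z.1.1) this.1
    exact h1
  · exact T.dflt_strat _

lemma go_loc {s s' : (T.UT N X hN).V → (T.UT N X hN).V} {n : ℕ}
   (h : ∀ v, (T.UT N X hN).lev v < n → s v = s' v) (t : T.V × Set T.V × (T.V ⊕ Set T.V)) (ht : T.lev t.1 < n) :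
   T.go N X hN s t = T.go N X hN s' t := by
  unfold go
  split_ifs with hv
  · rw [h ⟨t, hv⟩ ht]
  · rfl

open Classical in
noncomputable def tg (s : (T.UT N X hN).V → (T.UT N X hN).V) (t : T.V × Set T.V × (T.V ⊕ Set T.V)) : T.Tag :=
  if h : T.Vld N X t then (s ⟨t, h⟩).1.2 else (∅, Sum.inr ∅)

lemma tg_vld {s : (T.UT N X hN).V → (T.UT N X hN).V} {t : T.V × Set T.V × (T.V ⊕ Set T.V)} (h : T.Vld N X t) :
    T.tg N X hN s t = (s ⟨t, h⟩).1.2 := dif_pos h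

lemma tg_loc {s s' : (T.UT N X hN).V → (T.UT N X hN).V} {n : ℕ}
   (h : ∀ v, (T.UT N X hN).lev v < n → s v = s' v) (t : T.V × Set T.V × (T.V ⊕ Set T.V)) (ht : T.lev t.1 < n) :
   T.tg N X hN s t = T.tg N X hN s' t := by
  unfold tg
  split_ifs with hv
  · rw [h ⟨t, hv⟩ ht]
  · rfl

def EE (S : Set T.V) : Set T.V := {u | u ∈ S ∧ u ∉ T.TX X ∧ N + 2 ≤ T.lev u}

noncomputable def S0 (s : (T.UT N X hN).V → (T.UT N X hN).V) (v : T.V) : Set T.V :=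
  (T.tg N X hN s (T.anc v N, ∅, Sum.inr ∅)).1

open Classical in
noncomputable def φ0 (s : (T.UT N X hN).V → (T.UT N X hN).V) (v : T.V) : T.V :=
  if T.lev v ≤ N then T.go N X hN s (v, ∅, Sum.inr ∅) else
  T.pl N 0 (T.EE N X (T.S0 N X hN s v)) (fun u p => T.go N X hN s (p, T.S0 N X hN s v, Sum.inl u))
    (fun p => T.go N X hN s (p, T.S0 N X hN s v, Sum.inr {q | q ∈ T.S0 N X hN s v ∧ ¬ T.Win 0 (T.EE N X (T.S0 N X hN s v)) q})) v

def UU (s : (T.UT N X hN).V → (T.UT N X hN).V) (r : T.V) : Set T.V :=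
  {u | ∃ S, T.Vld N X (r, S, Sum.inr ∅) ∧ (T.tg N X hN s (r, S, Sum.inr ∅)).2 = Sum.inl u}

open Classical in
noncomputable def SU (s : (T.UT N X hN).V → (T.UT N X hN).V) (r u : T.V) : Set T.V :=
  if h : u ∈ T.UU N X hN s r then h.choose else ∅

def SS (s : (T.UT N X hN).V → (T.UT N X hN).V) (r : T.V) : Set T.V :=
  {q | N + 1 ≤ T.lev q ∧ ¬ T.Win 1 (T.UU N X hN s r) q}

open Classical in
noncomputable def φ1 (s : (T.UT N X hN).V → (T.UT N X hN).V) (v : T.V) : T.V :=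
  if T.lev v ≤ N then T.go N X hN s (v, ∅, Sum.inr ∅) else
  T.pl N 1 (T.UU N X hN s (T.anc v (N+1))) (fun u p => T.go N X hN s (p, T.SU N X hN s (T.anc v (N+1)) u, Sum.inl u))
    (fun p => T.go N X hN s (p, T.SS N X hN s (T.anc v (N+1)), if T.lev p = N + 1 then Sum.inr ∅ else
      (T.tg N X hN s (T.anc v (N+1), T.SS N X hN s (T.anc v (N+1)), Sum.inr ∅)).2)) v

lemma φ0_strat {s : (T.UT N X hN).V → (T.UT N X hN).V} (hs : (T.UT N X hN).IsStrat s) : T.IsStrat (T.φ0 N X hN s) := by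
  intro v
  unfold φ0
  split_ifs
  · exact T.go_chd N X hN hs _
  · exact T.pl_chd N 0 (fun u => T.go_chd N X hN hs _) (T.go_chd N X hN hs _)

lemma φ1_strat {s : (T.UT N X hN).V → (T.UT N X hN).V} (hs : (T.UT N X hN).IsStrat s) : T.IsStrat (T.φ1 N X hN s) := by
  intro v
  unfold φ1
  split_ifs
  · exact T.go_chd N X hN hs _
  · exact T.pl_chd N 1 (fun u => T.go_chd N X hN hs _) (T.go_chd N X hN hs _)

lemma φ0_loc {s s' : (T.UT N X hN).V → (T.UT N X hN).V} {n : ℕ}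
   (h : ∀ v, (T.UT N X hN).lev v < n → s v = s' v) (v : T.V) (hv : T.lev v < n) :
   T.φ0 N X hN s v = T.φ0 N X hN s' v := by
  have hg : ∀ t, t.1 = v → T.go N X hN s t = T.go N X hN s' t := fun t ht => T.go_loc N X hN h t (by rw [ht]; exact hv)
  by_cases h1 : T.lev v ≤ N
  · simp only [φ0, h1, if_true]
    exact hg _ rfl
  · have hS : T.S0 N X hN s v = T.S0 N X hN s' v := by
      unfold S0
      rw [T.tg_loc N X hN h]
      rw [T.lev_anc]; omega
    simp only [φ0, h1, if_false, hS]
    exact T.pl_congr N 0 rfl (fun u => hg _ rfl) (hg _ rfl)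

lemma UU_loc {s s' : (T.UT N X hN).V → (T.UT N X hN).V} {n : ℕ}
   (h : ∀ v, (T.UT N X hN).lev v < n → s v = s' v) (r : T.V) (hv : T.lev r < n) :
   T.UU N X hN s r = T.UU N X hN s' r := by
  ext u
  unfold UU
  refine exists_congr fun S => ?_
  rw [T.tg_loc N X hN h _ hv]

lemma SU_loc {s s' : (T.UT N X hN).V → (T.UT N X hN).V} {n : ℕ}
   (h : ∀ v, (T.UT N X hN).lev v < n → s v = s' v) (r u : T.V) (hv : T.lev r < n) :
   T.SU N X hN s r u = T.SU N X hN s' r u := by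
  have : ∀ S, (T.Vld N X (r, S, Sum.inr ∅) ∧ (T.tg N X hN s (r, S, Sum.inr ∅)).2 = Sum.inl u) =
     (T.Vld N X (r, S, Sum.inr ∅) ∧ (T.tg N X hN s' (r, S, Sum.inr ∅)).2 = Sum.inl u) := by
    intro S
    rw [T.tg_loc N X hN h _ hv]
  have hE := fun P Q : Set T.V → Prop => fun (e : ∀ S, P S = Q S) => show
      (open Classical in (if h : ∃ S, P S then h.choose else ∅)) =
      (open Classical in (if h : ∃ S, Q S then h.choose else ∅)) from by
    have : P = Q := funext e
    subst this
    rfl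
  exact hE _ _ this

lemma φ1_loc {s s' : (T.UT N X hN).V → (T.UT N X hN).V} {n : ℕ}
   (h : ∀ v, (T.UT N X hN).lev v < n → s v = s' v) (v : T.V) (hv : T.lev v < n) :
   T.φ1 N X hN s v = T.φ1 N X hN s' v := by
  have hg : ∀ t, t.1 = v → T.go N X hN s t = T.go N X hN s' t := fun t ht => T.go_loc N X hN h t (by rw [ht]; exact hv)
  by_cases h1 : T.lev v ≤ N
  · simp only [φ1, h1, if_true]
    exact hg _ rfl
  · have hr : T.lev (T.anc v (N+1)) < n := by rw [T.lev_anc]; omega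
    have hU := T.UU_loc N X hN h _ hr
    have hS : T.SS N X hN s (T.anc v (N+1)) = T.SS N X hN s' (T.anc v (N+1)) := by
      unfold SS; rw [hU]
    simp only [φ1, h1, if_false]
    refine T.pl_congr N 1 hU (fun u => ?_) ?_
    · rw [T.SU_loc N X hN h _ _ hr]
      exact hg _ rfl
    · rw [hS, T.tg_loc N X hN h _ hr]
      exact hg _ rfl

end unravel
end GT
end BD

namespace BD
namespace GT
section unravel
variable {T : GT} {N : ℕ} {X : Set (ℕ → T.V)} {hN : N % 2 = 0}

open Classical in
/-- The raw lifted run. -/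
noncomputable def raw (N : ℕ) (x : ℕ → T.V) (S : Set T.V) (c : T.V ⊕ Set T.V) (n : ℕ) : T.V × Set T.V × (T.V ⊕ Set T.V) :=
  (x n, if n ≤ N then ∅ else S, if n ≤ N + 1 then Sum.inr ∅ else c)

lemma raw_low {x : ℕ → T.V} {S : Set T.V} {c : T.V ⊕ Set T.V} {n : ℕ} (h : n ≤ N) :
    raw N x S c n = (x n, ∅, Sum.inr ∅) := by
  simp [raw, h]; omega

lemma raw_mid {x : ℕ → T.V} {S : Set T.V} {c : T.V ⊕ Set T.V} :
    raw N x S c (N+1) = (x (N+1), S, Sum.inr ∅) := by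
  simp [raw]

lemma raw_high {x : ℕ → T.V} {S : Set T.V} {c : T.V ⊕ Set T.V} {n : ℕ} (h : N + 2 ≤ n) :
    raw N x S c n = (x n, S, c) := by
  simp only [raw]
  rw [if_neg (by omega), if_neg (by omega)]

lemma raw_vld {x : ℕ → T.V} (hx : T.IsRun x) {S : Set T.V} {c : T.V ⊕ Set T.V} (hS : T.QS N S) (hr : x (N+1) ∈ S)
   (hc : ∀ n, N + 2 ≤ n → T.CV N X (x n) S c) (n : ℕ) : T.Vld N X (raw N x S c n) := by
  have hl := (hx n).1
  rcases lt_trichotomy n (N+1) with h | h | h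
  · rw [raw_low (by omega)]
    exact Or.inl ⟨by dsimp only; omega, rfl, rfl⟩
  · subst h
    rw [raw_mid]
    exact Or.inr (Or.inl ⟨hl, hS, hr, rfl⟩)
  · rw [raw_high (by omega)]
    refine Or.inr (Or.inr ⟨by dsimp only; omega, hS, ?_, hc n (by omega)⟩)
    show T.anc (x n) (N+1) ∈ S
    rw [hx.anc, min_eq_left (by omega)]; exact hr

lemma raw_par {x : ℕ → T.V} (hx : T.IsRun x) {S : Set T.V} {c : T.V ⊕ Set T.V} (n : ℕ) :
    T.parT N (raw N x S c (n+1)) = raw N x S c n := by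
  have hl := (hx (n+1)).1
  rcases lt_trichotomy n (N+1) with h | h | h
  · rw [raw_low (n := n) (by omega)]
    by_cases h2 : n = N
    · subst h2
      rw [raw_mid]
      simp [parT, (hx n).2, hl]
    · rw [raw_low (by omega)]
      simp [parT, (hx n).2]
  · subst h
    rw [raw_mid, raw_high (by omega)]
    simp [parT, (hx _).2, hl]
  · rw [raw_high (by omega), raw_high (by omega)]
    simp only [parT, (hx _).2, hl]
    rw [if_neg (by omega), if_neg (by omega)]

lemma ut_tags {s : (T.UT N X hN).V → (T.UT N X hN).V} (hs : (T.UT N X hN).IsStrat s)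
   {p : T.V} {S : Set T.V} {c : T.V ⊕ Set T.V} (h : T.Vld N X (p, S, c)) :
   T.par (s ⟨(p, S, c), h⟩).1.1 = p ∧ T.lev (s ⟨(p, S, c), h⟩).1.1 = T.lev p + 1 ∧
   (N + 1 ≤ T.lev p → (s ⟨(p, S, c), h⟩).1.2.1 = S) ∧ (N + 2 ≤ T.lev p → (s ⟨(p, S, c), h⟩).1.2.2 = c) := by
  obtain ⟨h1, h2⟩ := hs ⟨(p, S, c), h⟩
  have h1' : T.parT N (s ⟨(p, S, c), h⟩).1 = (p, S, c) := congrArg Subtype.val h1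
  have h2' : T.lev (s ⟨(p, S, c), h⟩).1.1 = T.lev p + 1 := h2
  unfold parT at h1'
  rw [h2'] at h1'
  rw [Prod.mk.injEq, Prod.mk.injEq] at h1'
  refine ⟨h1'.1, h2', fun hp => ?_, fun hp => ?_⟩
  · have := h1'.2.1; rwa [if_neg (by omega)] at this
  · have := h1'.2.2; rwa [if_neg (by omega)] at this

lemma raw_lift {b : ℕ} {s : (T.UT N X hN).V → (T.UT N X hN).V} (hs : (T.UT N X hN).IsStrat s)
   {x : ℕ → T.V} (hx : T.IsRun x) {S : Set T.V} {c : T.V ⊕ Set T.V} (hS : T.QS N S) (hr : x (N+1) ∈ S)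
   (hc : ∀ n, N + 2 ≤ n → T.CV N X (x n) S c)
   (h1 : ∀ n, n % 2 = b → T.go N X hN s (raw N x S c n) = x (n+1))
   (h2 : N % 2 = b → (T.tg N X hN s (raw N x S c N)).1 = S)
   (h3 : (N+1) % 2 = b → (T.tg N X hN s (raw N x S c (N+1))).2 = c) :
   ∃ x', (T.UT N X hN).IsRun x' ∧ (T.UT N X hN).Follows b s x' ∧ ∀ n, (x' n).1.1 = x n := by
  have hv := raw_vld hx hS hr hc
  refine ⟨fun n => ⟨raw N x S c n, hv n⟩, fun n => ⟨(hx n).1, Subtype.ext (raw_par hx n)⟩, ?_, fun n => rfl⟩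
  intro n hn
  have g := h1 n hn
  rw [T.go_vld N X hN (hv n)] at g
  have ht := ut_tags (hN := hN) hs (hv n)
  apply Subtype.ext
  show raw N x S c (n+1) = (s ⟨raw N x S c n, hv n⟩).1
  have hl : T.lev (raw N x S c n).1 = n := (hx n).1
  have hl' : T.lev (s ⟨raw N x S c n, hv n⟩).1.1 = n + 1 := by
    rw [g]; exact (hx _).1
  refine Prod.ext g.symm ?_
  have vv := (s ⟨raw N x S c n, hv n⟩).2
  have hx1 := (hx n).1
  rcases lt_trichotomy n N with h | h | h
  · obtain ⟨e1, e2⟩ := vv.low (by omega)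
    rw [raw_low (by omega)]
    exact Prod.ext e1.symm e2.symm
  · subst h
    rw [raw_mid]
    obtain ⟨_, _, e2⟩ := vv.mid hl'
    have := h2 hn
    rw [T.tg_vld n X hN (hv n)] at this
    exact Prod.ext this.symm e2.symm
  · rw [raw_high (by omega)]
    by_cases h4 : n = N + 1
    · subst h4
      have := h3 hn
      rw [T.tg_vld N X hN (hv _)] at this
      have e := ht.2.2.1 (by omega)
      exact Prod.ext ((if_neg (by omega)).symm.trans e.symm) this.symm
    · have e1 := ht.2.2.1 (by omega)
      have e2 := ht.2.2.2 (by omega)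
      exact Prod.ext ((if_neg (by omega)).symm.trans e1.symm) ((if_neg (by omega)).symm.trans e2.symm)

/-- The move toward `u` is forced. -/
lemma forced {s : (T.UT N X hN).V → (T.UT N X hN).V} (hs : (T.UT N X hN).IsStrat s)
   {x : ℕ → T.V} (hx : T.IsRun x) {S : Set T.V} {m n : ℕ} (hm : N + 2 ≤ n) (hnm : n < m)
   (hv : T.Vld N X (x n, S, Sum.inl (x m))) : T.go N X hN s (x n, S, Sum.inl (x m)) = x (n+1) := by
  rw [T.go_vld N X hN hv]
  obtain ⟨_, h2, h3, h4⟩ := ut_tags (hN := hN) hs hv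
  have vv := (s ⟨_, hv⟩).2
  have hl := (hx n).1
  obtain ⟨_, _, hc⟩ := vv.high (by omega)
  rw [h4 (by omega)] at hc
  obtain ⟨_, _, _, hc⟩ := hc
  rw [h2, hl, (hx m).1, hx.anc, min_eq_left (by omega), T.anc_ge (by omega)] at hc
  exact hc.symm

lemma cv_inl {x : ℕ → T.V} (hx : T.IsRun x) {S : Set T.V} {m n : ℕ} (h : N + 2 ≤ m) (h1 : x m ∈ S) (h2 : x m ∉ T.TX X) :
    T.CV N X (x n) S (Sum.inl (x m)) := by
  refine ⟨by rw [(hx m).1]; exact h, h1, h2, ?_⟩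
  rw [hx.anc, hx.anc, (hx m).1, (hx n).1, min_comm]

lemma raw_lift_inl {b : ℕ} {s : (T.UT N X hN).V → (T.UT N X hN).V} (hs : (T.UT N X hN).IsStrat s)
   {x : ℕ → T.V} (hx : T.IsRun x) {S : Set T.V} {m : ℕ} (hS : T.QS N S) (hr : x (N+1) ∈ S)
   (hm : N + 2 ≤ m) (hmS : x m ∈ S) (hmX : x m ∉ T.TX X)
   (h1 : ∀ n, n % 2 = b → n ≤ N → T.go N X hN s (x n, ∅, Sum.inr ∅) = x (n+1))
   (h2 : N % 2 = b → (T.tg N X hN s (x N, ∅, Sum.inr ∅)).1 = S)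
   (h3 : (N+1) % 2 = b → (T.tg N X hN s (x (N+1), S, Sum.inr ∅)).2 = Sum.inl (x m))
   (h4 : ∀ n, n % 2 = b → m ≤ n → T.go N X hN s (x n, S, Sum.inl (x m)) = x (n+1)) :
   ∃ x', (T.UT N X hN).IsRun x' ∧ (T.UT N X hN).Follows b s x' ∧ ∀ n, (x' n).1.1 = x n := by
  have hc : ∀ n, N + 2 ≤ n → T.CV N X (x n) S (Sum.inl (x m)) := fun n _ => cv_inl hx hm hmS hmX
  have hv := raw_vld hx hS hr hc
  refine raw_lift hs hx hS hr hc ?_ ?_ ?_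
  · intro n hn
    rcases lt_trichotomy n (N+1) with h | h | h
    · rw [raw_low (by omega)]; exact h1 n hn (by omega)
    · subst h
      have vm := hv (N+1)
      rw [raw_mid] at vm
      rw [raw_mid, T.go_vld N X hN vm]
      have e := h3 hn
      rw [T.tg_vld N X hN vm] at e
      obtain ⟨_, k2, _, _⟩ := ut_tags (hN := hN) hs vm
      have vv := (s ⟨_, vm⟩).2
      have hl := (hx (N+1)).1
      obtain ⟨_, _, hc⟩ := vv.high (by omega)
      rw [e] at hc
      obtain ⟨_, _, _, hc⟩ := hc
      rw [k2, hl, (hx m).1, hx.anc, min_eq_left (by omega), T.anc_ge (by omega)] at hc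
      exact hc.symm
    · rw [raw_high (by omega)]
      by_cases hnm : n < m
      · refine forced hs hx (by omega) hnm ?_
        have := hv n
        rwa [raw_high (by omega)] at this
      · exact h4 n hn (by omega)
  · intro h; rw [raw_low le_rfl]; exact h2 h
  · intro h; rw [raw_mid]; exact h3 h

lemma low_vld {p : T.V} (h : T.lev p ≤ N) : T.Vld N X (p, ∅, Sum.inr ∅) := Or.inl ⟨h, rfl, rfl⟩

lemma TX_mem {q : T.V} {S : Set T.V} (hS : T.QS N S) (hq : q ∈ S) (h : ¬ T.Win 0 (T.EE N X S) q)
    (hN : N % 2 = 0) : q ∈ T.TX X := by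
  by_contra hc
  have hl := (hS q hq).1
  by_cases h2 : N + 2 ≤ T.lev q
  · exact h (Win.base _ ⟨hq, hc, h2⟩)
  · refine h (Win.theirs _ (by omega) fun w hw1 hw2 => Win.base _ ⟨(hS q hq).2.1 (by omega) w ⟨hw1, hw2⟩, ?_, by omega⟩)
    rintro ⟨y, hy1, hy2, hy3⟩
    refine hc ⟨y, hy1, hy2, ?_⟩
    rw [hw2] at hy3
    rw [← (hy1 _).2, hy3, hw1]

lemma lift0 {s : (T.UT N X hN).V → (T.UT N X hN).V} (hs : (T.UT N X hN).IsStrat s) {x : ℕ → T.V} (hx : T.IsRun x)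
   (hf : T.Follows 0 (T.φ0 N X hN s) x) :
   ∃ x', (T.UT N X hN).IsRun x' ∧ (T.UT N X hN).Follows 0 s x' ∧ ∀ n, (x' n).1.1 = x n := by
  have h1 : ∀ n, n % 2 = 0 → n ≤ N → T.go N X hN s (x n, ∅, Sum.inr ∅) = x (n+1) := by
    intro n hn hnN
    rw [hf n hn, φ0, if_pos (by rw [(hx n).1]; exact hnN)]
  have vN : T.Vld N X (x N, ∅, Sum.inr ∅) := low_vld (by rw [(hx N).1])
  obtain ⟨S, hSdef⟩ : ∃ S, S = (T.tg N X hN s (x N, ∅, Sum.inr ∅)).1 := ⟨_, rfl⟩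
  have hS0 : ∀ n, N + 1 ≤ n → T.S0 N X hN s (x n) = S := by
    intro n hn
    rw [S0, hx.anc, min_eq_left (by omega), hSdef]
  have hSv : T.QS N S ∧ x (N+1) ∈ S := by
    have g := h1 N hN le_rfl
    rw [T.go_vld N X hN vN] at g
    rw [T.tg_vld N X hN vN] at hSdef
    obtain ⟨a, b, _⟩ := (s ⟨_, vN⟩).2.mid (by rw [g, (hx _).1])
    rw [hSdef, ← g]
    exact ⟨a, b⟩
  have hpl : ∀ n, N + 1 ≤ n → n % 2 = 0 → x (n+1) = T.pl N 0 (T.EE N X S) (fun u p => T.go N X hN s (p, S, Sum.inl u))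
    (fun p => T.go N X hN s (p, S, Sum.inr {q | q ∈ S ∧ ¬ T.Win 0 (T.EE N X S) q})) (x n) := by
    intro n hn hb
    rw [hf n hb, φ0, if_neg (by rw [(hx n).1]; omega), hS0 n hn]
  rcases pl_run hx hpl with ⟨m, hm, hmE, hA⟩ | hB
  · have hm2 : N + 2 ≤ m := by have := hmE.2.2; rw [(hx m).1] at this; exact this
    exact raw_lift_inl hs hx hSv.1 hSv.2 hm2 hmE.1 hmE.2.1 h1 (fun _ => hSdef.symm) (fun h => by omega)
      (fun n hn hmn => (hA n hmn hn).symm)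
  · set R := {q | q ∈ S ∧ ¬ T.Win 0 (T.EE N X S) q} with hR
    have cvR : ∀ n, N + 2 ≤ n → (∀ k, N + 1 ≤ k → k ≤ n → x k ∈ S) → T.CV N X (x n) S (Sum.inr R) := by
      intro n hn hk
      refine ⟨fun q hq => hq.1, fun q hq => TX_mem hSv.1 hq.1 hq.2 hN, fun k hk2 => ?_, fun q hq => ⟨fun ho => ?_, fun he w hw hwS => ?_⟩⟩
      · rw [hx.anc]
        exact ⟨hk _ (by omega) (by omega), (hB _ (by omega)).1⟩
      · by_contra hc
        push Not at hc
        refine hq.2 (Win.theirs _ (by omega) fun w hw1 hw2 => ?_)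
        by_contra hw
        exact hc w ⟨hw1, hw2⟩ ⟨(hSv.1 q hq.1).2.1 ho w ⟨hw1, hw2⟩, hw⟩
      · exact ⟨hwS, fun hW => hq.2 (Win.mine _ w he hw.1 hw.2 hW)⟩
    have vR : ∀ n, N + 2 ≤ n → (∀ k, N + 1 ≤ k → k ≤ n → x k ∈ S) → T.Vld N X (x n, S, Sum.inr R) := by
      intro n hn hk
      refine Or.inr (Or.inr ⟨by rw [(hx n).1]; exact hn, hSv.1, ?_, cvR n hn hk⟩)
      show T.anc (x n) (N+1) ∈ S
      rw [hx.anc, min_eq_left (by omega)]; exact hSv.2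
    have hin : ∀ j, ∀ k, N + 1 ≤ k → k ≤ j → x k ∈ S := by
      intro j
      induction j with
      | zero => intro k h1 h2; omega
      | succ j ih =>
        intro k h1 h2
        by_cases hkj : k ≤ j
        · exact ih k h1 hkj
        · have hkj : k = j + 1 := by omega
          subst hkj
          by_cases hj : j = N
          · subst hj; exact hSv.2
          · rcases Nat.mod_two_eq_zero_or_one j with hb | hb
            · have v := vR j (by omega) ih
              have e : x (j+1) = T.go N X hN s (x j, S, Sum.inr R) := (hB j (by omega)).2 hb
              rw [T.go_vld N X hN v] at e
              obtain ⟨_, k2, k3, k4⟩ := ut_tags (hN := hN) hs v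
              have hl := (hx j).1
              obtain ⟨_, _, hc⟩ := (s ⟨_, v⟩).2.high (by omega)
              rw [k4 (by omega)] at hc
              have := hc.2.2.1 (j+1) (by omega)
              rw [T.anc_ge (by omega), ← e] at this
              exact this.1
            · exact (hSv.1 (x j) (ih j (by omega) le_rfl)).2.1 (by rw [(hx j).1]; exact hb) _ (hx.chd j)
    refine raw_lift (c := Sum.inr R) hs hx hSv.1 hSv.2 (fun n hn => cvR n hn (hin n)) ?_ ?_ ?_
    · intro n hn
      rcases lt_trichotomy n (N+1) with h | h | h
      · rw [raw_low (by omega)]; exact h1 n hn (by omega)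
      · omega
      · rw [raw_high (by omega)]; exact ((hB n (by omega)).2 hn).symm
    · intro _; rw [raw_low le_rfl]; exact hSdef.symm
    · intro h; omega

lemma lift1 {s : (T.UT N X hN).V → (T.UT N X hN).V} (hs : (T.UT N X hN).IsStrat s) {x : ℕ → T.V} (hx : T.IsRun x)
   (hf : T.Follows 1 (T.φ1 N X hN s) x) :
   ∃ x', (T.UT N X hN).IsRun x' ∧ (T.UT N X hN).Follows 1 s x' ∧ ∀ n, (x' n).1.1 = x n := by
  have h1 : ∀ n, n % 2 = 1 → n ≤ N → T.go N X hN s (x n, ∅, Sum.inr ∅) = x (n+1) := by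
    intro n hn hnN
    rw [hf n hn, φ1, if_pos (by rw [(hx n).1]; exact hnN)]
  set r := x (N+1) with hr
  set U := T.UU N X hN s r with hU
  set S' := T.SS N X hN s r with hS'
  have hpl : ∀ n, N + 1 ≤ n → n % 2 = 1 → x (n+1) = T.pl N 1 U (fun u p => T.go N X hN s (p, T.SU N X hN s r u, Sum.inl u))
    (fun p => T.go N X hN s (p, S', open Classical in if T.lev p = N + 1 then Sum.inr ∅ else
      (T.tg N X hN s (r, S', Sum.inr ∅)).2)) (x n) := by
    intro n hn hb
    have e : T.anc (x n) (N+1) = r := by rw [hx.anc, min_eq_left hn]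
    rw [hf n hb, φ1, if_neg (by rw [(hx n).1]; omega), e]
  have hrl : T.lev r = N + 1 := (hx _).1
  have hUv : ∀ u S, T.Vld N X (r, S, Sum.inr ∅) → (T.tg N X hN s (r, S, Sum.inr ∅)).2 = Sum.inl u →
     N + 2 ≤ T.lev u ∧ u ∈ S ∧ u ∉ T.TX X := by
    intro u S v h
    rw [T.tg_vld N X hN v] at h
    obtain ⟨_, k2, k3, _⟩ := ut_tags (hN := hN) hs v
    obtain ⟨_, _, hc⟩ := (s ⟨_, v⟩).2.high (by omega)
    rw [h, k3 (by omega)] at hc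
    exact ⟨hc.1, hc.2.1, hc.2.2.1⟩
  rcases pl_run hx hpl with ⟨m, hm, hmE, hA⟩ | hB
  · have hsu : T.SU N X hN s r (x m) = hmE.choose := dif_pos hmE
    obtain ⟨k1, k2⟩ := hmE.choose_spec
    rw [← hsu] at k1 k2
    obtain ⟨a, b, _⟩ := k1.mid hrl
    obtain ⟨l1, l2, l3⟩ := hUv _ _ k1 k2
    rw [(hx m).1] at l1
    exact raw_lift_inl hs hx a b l1 l2 l3 h1 (fun h => by omega) (fun _ => k2)
      (fun n hn hmn => (hA n hmn hn).symm)
  · have qS' : T.QS N S' := by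
      intro q hq
      refine ⟨hq.1, fun ho w hw => ⟨?_, fun hW => ?_⟩, fun he => ?_⟩
      · have := hw.2; have := hq.1; omega
      · exact hq.2 (Win.mine _ w ho hw.1 hw.2 hW)
      · by_contra hc
        push Not at hc
        refine hq.2 (Win.theirs _ (by omega) fun w hw1 hw2 => ?_)
        by_contra hw
        exact hc w ⟨hw1, hw2⟩ ⟨by have := hq.1; omega, hw⟩
    have hxS : ∀ n, N + 1 ≤ n → x n ∈ S' := fun n hn => ⟨by rw [(hx n).1]; exact hn, (hB n hn).1⟩
    have v : T.Vld N X (r, S', Sum.inr ∅) := Or.inr (Or.inl ⟨hrl, qS', hxS _ le_rfl, rfl⟩)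
    obtain ⟨c, hc⟩ : ∃ c, c = (T.tg N X hN s (r, S', Sum.inr ∅)).2 := ⟨_, rfl⟩
    rw [← hc] at hB
    have hx2 : x (N+1+1) = T.go N X hN s (r, S', Sum.inr ∅) := by
      have e := (hB (N+1) le_rfl).2 (by omega)
      rw [if_pos hrl] at e
      exact e
    have hcv : T.CV N X (x (N+2)) S' c := by
      rw [T.tg_vld N X hN v] at hc
      rw [T.go_vld N X hN v] at hx2
      obtain ⟨_, k2, k3, _⟩ := ut_tags (hN := hN) hs v
      obtain ⟨_, _, h⟩ := (s ⟨_, v⟩).2.high (by omega)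
      rw [← hc, k3 (by omega), ← hx2] at h
      exact h
    cases c with
    | inl u =>
      exfalso
      obtain ⟨_, l2, _⟩ := hUv u S' v hc.symm
      exact l2.2 (Win.base _ ⟨S', v, hc.symm⟩)
    | inr R =>
      obtain ⟨r1, r2, r3, r4⟩ := hcv
      have cvR : ∀ n, N + 2 ≤ n → (∀ k, N + 2 ≤ k → k ≤ n → x k ∈ R) → T.CV N X (x n) S' (Sum.inr R) := by
        intro n hn hk
        refine ⟨r1, r2, fun k hk2 => ?_, r4⟩
        rw [hx.anc]
        exact hk _ (by omega) (by omega)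
      have vR : ∀ n, N + 2 ≤ n → (∀ k, N + 2 ≤ k → k ≤ n → x k ∈ R) → T.Vld N X (x n, S', Sum.inr R) := by
        intro n hn hk
        refine Or.inr (Or.inr ⟨by rw [(hx n).1]; exact hn, qS', ?_, cvR n hn hk⟩)
        show T.anc (x n) (N+1) ∈ S'
        rw [hx.anc, min_eq_left (by omega)]; exact hxS _ le_rfl
      have hgo : ∀ n, N + 2 ≤ n → n % 2 = 1 → x (n+1) = T.go N X hN s (x n, S', Sum.inr R) := by
        intro n hn hb
        have := (hB n (by omega)).2 hb
        rwa [if_neg (by rw [(hx n).1]; omega)] at this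
      have hin : ∀ j, ∀ k, N + 2 ≤ k → k ≤ j → x k ∈ R := by
        intro j
        induction j with
        | zero => intro k h1 h2; omega
        | succ j ih =>
          intro k h1 h2
          by_cases hkj : k ≤ j
          · exact ih k h1 hkj
          · have hkj : k = j + 1 := by omega
            subst hkj
            by_cases hj : j = N + 1
            · subst hj
              have := r3 (N+2) le_rfl
              rwa [hx.anc, min_self] at this
            · rcases Nat.mod_two_eq_zero_or_one j with hb | hb
              · exact (r4 (x j) (ih j (by omega) le_rfl)).2 (by rw [(hx j).1]; exact hb) _ (hx.chd j) (hxS _ (by omega))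
              · have v := vR j (by omega) ih
                have e := hgo j (by omega) hb
                rw [T.go_vld N X hN v] at e
                obtain ⟨_, k2, k3, k4⟩ := ut_tags (hN := hN) hs v
                have hl := (hx j).1
                obtain ⟨_, _, hc⟩ := (s ⟨_, v⟩).2.high (by omega)
                rw [k4 (by omega)] at hc
                have := hc.2.2.1 (j+1) (by omega)
                rwa [T.anc_ge (by omega), ← e] at this
      refine raw_lift (c := Sum.inr R) hs hx qS' (hxS _ le_rfl) (fun n hn => cvR n hn (hin n)) ?_ ?_ ?_
      · intro n hn
        rcases lt_trichotomy n (N+1) with h | h | h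
        · rw [raw_low (by omega)]; exact h1 n hn (by omega)
        · subst h
          rw [raw_mid]; exact hx2.symm
        · rw [raw_high (by omega)]; exact (hgo n (by omega) hn).symm
      · intro h; omega
      · intro _; rw [raw_mid]; exact hc.symm

open Classical in
noncomputable def ucov (T : GT) (N : ℕ) (X : Set (ℕ → T.V)) (hN : N % 2 = 0) : Cov (T.UT N X hN) T N where
  π t := t.1.1
  lev_π _ := rfl
  par_π _ := rfl
  inj v w hv h := by
    have hv' : T.lev v.1.1 ≤ N := hv
    have h' : v.1.1 = w.1.1 := h
    obtain ⟨a1, a2⟩ := v.2.low hv'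
    obtain ⟨b1, b2⟩ := w.2.low (by rw [← h']; exact hv')
    exact Subtype.ext (Prod.ext h (Prod.ext (a1.trans b1.symm) (a2.trans b2.symm)))
  surj v hv := ⟨⟨(v, ∅, Sum.inr ∅), low_vld hv⟩, rfl⟩
  φ b s := if b = 0 then T.φ0 N X hN s else T.φ1 N X hN s
  strat b s hs := by
    split_ifs
    · exact T.φ0_strat N X hN hs
    · exact T.φ1_strat N X hN hs
  loc b s s' n hs hs' h v hv := by
    split_ifs
    · exact T.φ0_loc N X hN h v hv
    · exact T.φ1_loc N X hN h v hv
  ident b s v hs hv := by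
    have hv' : T.lev v.1.1 ≤ N := le_of_lt hv
    obtain ⟨a1, a2⟩ := v.2.low hv'
    have e : (v.1.1, (∅ : Set T.V), (Sum.inr ∅ : T.V ⊕ Set T.V)) = v.1 := Prod.ext rfl (Prod.ext a1.symm a2.symm)
    have : T.go N X hN s (v.1.1, ∅, Sum.inr ∅) = (s v).1.1 := by
      rw [e, T.go_vld N X hN v.2]
      rfl
    split_ifs
    · rw [φ0, if_pos hv', this]
    · rw [φ1, if_pos hv', this]
  lift b hb s x hs hx hf := by
    interval_cases b
    · exact lift0 hs hx (by simpa using hf)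
    · exact lift1 hs hx (by simpa using hf)

lemma ucov_clop (T : GT) (N : ℕ) (X : Set (ℕ → T.V)) (hN : N % 2 = 0) (hX : T.Opn Xᶜ) :
    (T.UT N X hN).Clop {x | (fun n => (T.ucov N X hN).π (x n)) ∈ X} := by
  have key : ∀ y, (T.UT N X hN).IsRun y → ((fun n => (T.ucov N X hN).π (y n)) ∈ X ↔ (y (N+2)).1.2.2.isRight) := by
    intro y hy
    have hx := (T.ucov N X hN).toHom.run hy
    set x : ℕ → T.V := fun n => (T.ucov N X hN).π (y n) with hxdef
    have htag : ∀ n, (y (N+2+n)).1.2.2 = (y (N+2)).1.2.2 := by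
      intro n
      induction n with
      | zero => rfl
      | succ n ih =>
        rw [← ih]
        have h2 := (hy (N+2+n)).2
        have h3 : T.parT N (y (N+2+n+1)).1 = (y (N+2+n)).1 := congrArg Subtype.val h2
        rw [← h3]
        have hl : T.lev (y (N+2+n+1)).1.1 = N + 2 + n + 1 := (hy _).1
        show _ = ite _ _ _
        rw [if_neg (by rw [hl]; omega)]
        rfl
    have hcv : ∀ n, T.CV N X (x (N+2+n)) (y (N+2+n)).1.2.1 (y (N+2)).1.2.2 := by
      intro n
      obtain ⟨_, _, h⟩ := (y (N+2+n)).2.high (by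
        have hl : T.lev (y (N+2+n)).1.1 = N + 2 + n := (hy _).1
        omega)
      rw [htag n] at h
      exact h
    cases hc : (y (N+2)).1.2.2 with
    | inl u =>
      simp only [Sum.isRight_inl, Bool.false_eq_true, iff_false]
      intro hxX
      rw [hc] at hcv
      obtain ⟨h1, h2, h3, h4⟩ := hcv (T.lev u - (N + 2))
      rw [Nat.add_sub_cancel' h1, (hx _).1, T.anc_ge le_rfl, hx.anc, min_self] at h4
      exact h3 ⟨x, hx, hxX, h4.symm⟩
    | inr R =>
      simp only [Sum.isRight_inr, iff_true]
      rw [hc] at hcv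
      by_contra hcon
      obtain ⟨n, hn⟩ := hX x hx hcon
      obtain ⟨h1, h2, h3, h4⟩ := hcv n
      obtain ⟨z, hz1, hz2, hz3⟩ := h2 (h3 (N+2+n) (by omega))
      rw [T.anc_ge (by rw [(hx _).1]), (hx _).1] at hz3
      exact hn z hz1 (hz1.eq_of_eq hx hz3 (by omega)) hz2
  intro x hx
  refine ⟨N+2, fun y hy hyx => ?_⟩
  show (fun n => (T.ucov N X hN).π (y n)) ∈ X ↔ (fun n => (T.ucov N X hN).π (x n)) ∈ X
  rw [key x hx, key y hy, hyx]

end unravel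

lemma closed_unravel (T : GT) (N : ℕ) (X : Set (ℕ → T.V)) (hX : T.Opn Xᶜ) :
   ∃ (T' : GT) (c : Cov T' T N), T'.Clop {x | (fun n => c.π (x n)) ∈ X} := by
  exact ⟨_, (T.ucov (2 * N) X (by omega)).mono (by omega), T.ucov_clop (2*N) X (by omega) hX⟩

lemma open_unravel (T : GT) (N : ℕ) (X : Set (ℕ → T.V)) (hX : T.Opn X) :
   ∃ (T' : GT) (c : Cov T' T N), T'.Clop {x | (fun n => c.π (x n)) ∈ X} := by
  obtain ⟨T', c, hc⟩ := T.closed_unravel N Xᶜ (by rwa [compl_compl])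
  refine ⟨T', c, fun x hx => ?_⟩
  obtain ⟨n, hn⟩ := hc x hx
  exact ⟨n, fun y hy hyx => not_iff_not.1 (hn y hy hyx)⟩

end GT
end BD

namespace BD
namespace GT
section limit

lemma thread_exists (i : ℕ) : ∀ (T : ℕ → GT) (Z : ℕ → ℕ) (_ : Monotone Z) (c : ∀ i, Cov (T (i+1)) (T i) (Z i)) (v : (T i).V),
    (T i).lev v ≤ Z i → ∃ p : ∀ j, (T j).V, (∀ j, (c j).π (p (j+1)) = p j) ∧ p i = v := by
  induction i with
  | zero =>
    intro T Z hZ c v hv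
    have step : ∀ j (w : {w : (T j).V // (T j).lev w = (T 0).lev v}), ∃ w' : {w' : (T (j+1)).V // (T (j+1)).lev w' = (T 0).lev v},
        (c j).π w'.1 = w.1 := by
      intro j w
      obtain ⟨w', hw'⟩ := (c j).surj w.1 (by rw [w.2]; exact hv.trans (hZ (Nat.zero_le j)))
      exact ⟨⟨w', by rw [← (c j).lev_π, hw', w.2]⟩, hw'⟩
    choose F hF using step
    let p : ∀ j, {w : (T j).V // (T j).lev w = (T 0).lev v} := fun j => Nat.rec ⟨v, rfl⟩ (fun j w => F j w) j
    exact ⟨fun j => (p j).1, fun j => hF j (p j), rfl⟩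
  | succ i ih =>
    intro T Z hZ c v hv
    obtain ⟨p, h1, h2⟩ := ih (fun j => T (j+1)) (fun j => Z (j+1)) (fun a b h => hZ (by omega)) (fun j => c (j+1)) v hv
    refine ⟨fun j => Nat.casesOn j ((c 0).π (p 0)) (fun j => p j), ?_, h2⟩
    intro j
    cases j with
    | zero => rfl
    | succ j => exact h1 j

variable (T : ℕ → GT) (N : ℕ) (c : ∀ i, Cov (T (i+1)) (T i) (N+i))

def Thr := {p : ∀ j, (T j).V // ∀ j, (c j).π (p (j+1)) = p j}

variable {T N c}

lemma Thr.lev_eq (p : Thr T N c) (j : ℕ) : (T j).lev (p.1 j) = (T 0).lev (p.1 0) := by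
  induction j with
  | zero => rfl
  | succ j ih => rw [← ih, ← p.2 j, (c j).lev_π]

lemma Thr.ext (p q : Thr T N c) (i : ℕ) (h : (T 0).lev (p.1 0) ≤ N + i) (e : p.1 i = q.1 i) : p = q := by
  have up : ∀ k, p.1 (i+k) = q.1 (i+k) := by
    intro k
    induction k with
    | zero => exact e
    | succ k ih =>
      show p.1 (i+k+1) = q.1 (i+k+1)
      refine (c (i+k)).inj _ _ ?_ ?_
      · have := p.lev_eq (i+k+1); omega
      · exact (p.2 _).trans (ih.trans (q.2 _).symm)
  have dn : ∀ k, p.1 (i - k) = q.1 (i - k) := by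
    intro k
    induction k with
    | zero => exact e
    | succ k ih =>
      by_cases h : k < i
      · obtain ⟨m, hm⟩ : ∃ m, i - k = m + 1 := ⟨i - k - 1, by omega⟩
        have : i - (k+1) = m := by omega
        rw [this, ← p.2, ← q.2]
        rw [hm] at ih; rw [ih]
      · have : i - (k+1) = i - k := by omega
        rw [this]; exact ih
  apply Subtype.ext
  funext j
  rcases le_total i j with h | h
  · have := up (j - i); rwa [Nat.add_sub_cancel' h] at this
  · have := dn (i - j); rwa [Nat.sub_sub_self h] at this

lemma thr_exists (i : ℕ) (v : (T i).V) (hv : (T i).lev v ≤ N + i) : ∃ p : Thr T N c, p.1 i = v := by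
  obtain ⟨p, h1, h2⟩ := thread_exists i T (fun i => N + i) (fun a b h => by dsimp only; omega) c v hv
  exact ⟨⟨p, h1⟩, h2⟩

variable (T N c)

def LT : GT where
  V := Thr T N c
  lev p := (T 0).lev (p.1 0)
  par p := ⟨fun j => (T j).par (p.1 j), fun j => by rw [← (c j).par_π, p.2]⟩
  lev_par p := (T 0).lev_par _
  child p := by
    set n := (T 0).lev (p.1 0) with hn
    obtain ⟨w, hw1, hw2⟩ := (T (n+1)).child (p.1 (n+1))
    have hl := p.lev_eq (n+1)
    obtain ⟨q, hq⟩ := thr_exists (N := N) (c := c) (n+1) w (by omega)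
    have hql := q.lev_eq (n+1)
    rw [hq] at hql
    have hqn : (T 0).lev (q.1 0) = n + 1 := by omega
    refine ⟨q, ?_, hqn⟩
    refine Thr.ext _ _ (n+1) ?_ ?_
    · show (T 0).lev ((T 0).par (q.1 0)) ≤ _
      rw [(T 0).lev_par]; omega
    · show (T (n+1)).par (q.1 (n+1)) = _
      rw [hq, hw1]

variable {T N c}

open Classical in
noncomputable def τ (s : Thr T N c → Thr T N c) (j : ℕ) (v : (T j).V) : (T j).V :=
  if h : (T j).lev v ≤ N + j then (s (thr_exists (c := c) j v h).choose).1 j else (T j).dflt v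

lemma τ_eq (s : Thr T N c → Thr T N c) (p : Thr T N c) (j : ℕ) (h : (T 0).lev (p.1 0) ≤ N + j) :
    τ s j (p.1 j) = (s p).1 j := by
  have h' : (T j).lev (p.1 j) ≤ N + j := by rw [p.lev_eq]; exact h
  rw [τ, dif_pos h']
  have hs := (thr_exists (c := c) j (p.1 j) h').choose_spec
  have e : (thr_exists (c := c) j (p.1 j) h').choose = p := by
    refine Thr.ext _ _ j ?_ hs
    rw [← Thr.lev_eq _ j, hs]; exact h'
  exact congrArg (fun z => (s z).1 j) e

lemma τ_strat {s : Thr T N c → Thr T N c} (hs : (LT T N c).IsStrat s) (j : ℕ) : (T j).IsStrat (τ s j) := by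
  intro v
  unfold τ
  split_ifs with h
  · have hc := (thr_exists (c := c) j v h).choose_spec
    set q := (thr_exists (c := c) j v h).choose
    obtain ⟨h1, h2⟩ := hs q
    have h1' := congrArg (fun z => z.1 j) h1
    refine ⟨?_, ?_⟩
    · exact h1'.trans hc
    · rw [Thr.lev_eq]
      have : (T 0).lev ((s q).1 0) = (T 0).lev (q.1 0) + 1 := h2
      rw [this, ← Thr.lev_eq q j, hc]
  · exact (T j).dflt_strat v

noncomputable def ρ (b : ℕ) (s : Thr T N c → Thr T N c) : ∀ (_ : ℕ) (i : ℕ), (T i).V → (T i).V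
  | 0, i => τ s i
  | k+1, i => (c i).φ b (ρ b s k (i+1))

lemma ρ_strat (b : ℕ) {s : Thr T N c → Thr T N c} (hs : (LT T N c).IsStrat s) (k : ℕ) : ∀ i, (T i).IsStrat (ρ b s k i) := by
  induction k with
  | zero => exact τ_strat hs
  | succ k ih => exact fun i => (c i).strat b _ (ih (i+1))

lemma ρ_stab (b : ℕ) {s : Thr T N c → Thr T N c} (hs : (LT T N c).IsStrat s) (k : ℕ) : ∀ i v, (T i).lev v < N + i + k →
    ρ b s (k+1) i v = ρ b s k i v := by
  induction k with
  | zero =>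
    intro i v hv
    show (c i).φ b (τ s (i+1)) v = τ s i v
    obtain ⟨p, rfl⟩ := thr_exists (c := c) i v (by omega)
    have hl := p.lev_eq i
    have hl' := p.lev_eq (i+1)
    rw [τ_eq _ _ _ (by omega), ← p.2 i, (c i).ident b _ _ (τ_strat hs _) (by omega), τ_eq _ _ _ (by omega), (s p).2]
  | succ k ih =>
    intro i v hv
    exact (c i).loc b _ _ (N + i + (k+1)) (ρ_strat b hs _ _) (ρ_strat b hs _ _) (fun w hw => ih (i+1) w (by omega)) v hv

lemma ρ_stab' (b : ℕ) {s : Thr T N c → Thr T N c} (hs : (LT T N c).IsStrat s) (k l i : ℕ) (v : (T i).V)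
    (h : (T i).lev v < N + i + k) : ρ b s (k+l) i v = ρ b s k i v := by
  induction l with
  | zero => rfl
  | succ l ih => rw [← ih]; exact ρ_stab b hs (k+l) i v (by omega)

noncomputable def σσ (b : ℕ) (s : Thr T N c → Thr T N c) (i : ℕ) (v : (T i).V) : (T i).V := ρ b s ((T i).lev v + 1) i v

lemma σσ_eq (b : ℕ) {s : Thr T N c → Thr T N c} (hs : (LT T N c).IsStrat s) (k i : ℕ) (v : (T i).V)
    (h : (T i).lev v < N + i + k) : σσ b s i v = ρ b s k i v := by
  unfold σσ
  rw [← ρ_stab' b hs _ k i v (by omega), ← ρ_stab' b hs k ((T i).lev v + 1) i v h, add_comm]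

lemma σσ_strat (b : ℕ) {s : Thr T N c → Thr T N c} (hs : (LT T N c).IsStrat s) (i : ℕ) : (T i).IsStrat (σσ b s i) :=
  fun v => ρ_strat b hs _ i v

lemma φ_σσ (b : ℕ) {s : Thr T N c → Thr T N c} (hs : (LT T N c).IsStrat s) (i : ℕ) :
    (c i).φ b (σσ b s (i+1)) = σσ b s i := by
  funext v
  rw [σσ_eq b hs ((T i).lev v + 1 + 1) i v (by omega)]
  exact (c i).loc b _ _ ((T i).lev v + 1) (σσ_strat b hs _) (ρ_strat b hs _ _) (fun w hw => σσ_eq b hs _ _ w (by omega)) v (by omega)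

lemma ρ_loc (b : ℕ) {s s' : Thr T N c → Thr T N c} (hs : (LT T N c).IsStrat s) (hs' : (LT T N c).IsStrat s') (n : ℕ)
   (h : ∀ v, (LT T N c).lev v < n → s v = s' v) (k : ℕ) : ∀ i v, (T i).lev v < n → ρ b s k i v = ρ b s' k i v := by
  induction k with
  | zero =>
    intro i v hv
    show τ s i v = τ s' i v
    unfold τ
    split_ifs with hh
    · refine congrArg (fun z => z.1 i) (h _ ?_)
      have hc := (thr_exists (c := c) i v hh).choose_spec
      show (T 0).lev _ < n
      rw [← Thr.lev_eq _ i, hc]; exact hv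
    · rfl
  | succ k ih =>
    intro i v hv
    exact (c i).loc b _ _ n (ρ_strat b hs _ _) (ρ_strat b hs' _ _) (ih (i+1)) v hv

noncomputable def lcov (T : ℕ → GT) (N : ℕ) (c : ∀ i, Cov (T (i+1)) (T i) (N+i)) : Cov (LT T N c) (T 0) N where
  π p := p.1 0
  lev_π _ := rfl
  par_π _ := rfl
  inj v w hv h := Thr.ext v w 0 hv h
  surj v hv := thr_exists 0 v hv
  φ b s := σσ b s 0
  strat b s hs := σσ_strat b hs 0
  loc b s s' n hs hs' h v hv := ρ_loc b hs hs' n h _ 0 v hv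
  ident b s v hs hv := by
    have hv' : (T 0).lev (v.1 0) < N := hv
    rw [σσ_eq b hs 0 0 _ (by omega)]
    exact τ_eq s v 0 (by omega)
  lift b hb s x hs hx hf := by
    have step : ∀ i (x : {x : ℕ → (T i).V // (T i).IsRun x ∧ (T i).Follows b (σσ b s i) x}),
      ∃ x' : {x : ℕ → (T (i+1)).V // (T (i+1)).IsRun x ∧ (T (i+1)).Follows b (σσ b s (i+1)) x},
        ∀ n, (c i).π (x'.1 n) = x.1 n := by
      intro i x
      obtain ⟨x', h1, h2, h3⟩ := (c i).lift b hb (σσ b s (i+1)) x.1 (σσ_strat b hs _) x.2.1 (by rw [φ_σσ b hs]; exact x.2.2)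
      exact ⟨⟨x', h1, h2⟩, h3⟩
    choose F hF using step
    let X : ∀ i, {x : ℕ → (T i).V // (T i).IsRun x ∧ (T i).Follows b (σσ b s i) x} :=
      fun i => Nat.rec ⟨x, hx, hf⟩ (fun i y => F i y) i
    have hX : ∀ i n, (c i).π ((X (i+1)).1 n) = (X i).1 n := fun i n => hF i (X i) n
    refine ⟨fun n => ⟨fun i => (X i).1 n, fun i => hX i n⟩, fun n => ⟨(hx n).1, ?_⟩, fun n hn => ?_, fun n => rfl⟩
    · apply Subtype.ext
      funext j
      exact ((X j).2.1 n).2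
    · refine Thr.ext _ _ (n+1) ?_ ?_
      · show (T 0).lev (x (n+1)) ≤ _
        rw [(hx _).1]; omega
      · show (X (n+1)).1 (n+1) = _
        rw [(X (n+1)).2.2 n hn, σσ_eq b hs 0 _ _ (by rw [((X (n+1)).2.1 n).1]; omega)]
        exact τ_eq s ⟨fun i => (X i).1 n, fun i => hX i n⟩ (n+1) (by
          show (T 0).lev (x n) ≤ _
          rw [(hx _).1]; omega)

def lproj (T : ℕ → GT) (N : ℕ) (c : ∀ i, Cov (T (i+1)) (T i) (N+i)) (i : ℕ) : Hom (LT T N c) (T i) where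
  π p := p.1 i
  lev_π p := p.lev_eq i
  par_π _ := rfl

end limit

lemma HU.union {T₀ : GT} {X : ℕ → Set (ℕ → T₀.V)} (h : ∀ i, T₀.HU (X i)) : T₀.HU (⋃ i, X i) := by
  intro T f N
  -- sequence of trees with homs to T₀
  have step : ∀ (i : ℕ) (A : Σ T : GT, Hom T T₀), ∃ (B : GT) (c : Cov B A.1 (N+i)),
    B.Clop {x | (fun n => A.2.π (c.π (x n))) ∈ X i} := fun i A => h i A.1 A.2 (N+i)
  choose B C hC using step
  let A : ℕ → Σ T : GT, Hom T T₀ := fun i => Nat.rec ⟨T, f⟩ (fun i A => ⟨B i A, A.2.comp (C i A).toHom⟩) i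
  let TT : ℕ → GT := fun i => (A i).1
  let cc : ∀ i, Cov (TT (i+1)) (TT i) (N+i) := fun i => C i (A i)
  have hclop : ∀ i, (TT (i+1)).Clop {x | (fun n => (A (i+1)).2.π (x n)) ∈ X i} := fun i => hC i (A i)
  let L := LT TT N cc
  have hAi : ∀ (i : ℕ) (p : Thr TT N cc), (A i).2.π (p.1 i) = f.π (p.1 0) := by
    intro i p
    induction i with
    | zero => rfl
    | succ i ih =>
      rw [← ih, ← p.2 i]; rfl
  have hopn : L.Opn {x | (fun n => f.π ((x n).1 0)) ∈ ⋃ i, X i} := by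
    intro x hx hxX
    obtain ⟨i, hi⟩ := Set.mem_iUnion.1 hxX
    obtain ⟨n, hn⟩ := hclop i _ ((lproj TT N cc (i+1)).run hx)
    refine ⟨n, fun y hy hyx => Set.mem_iUnion.2 ⟨i, ?_⟩⟩
    have := (hn _ ((lproj TT N cc (i+1)).run hy) (congrArg (fun z : Thr TT N cc => z.1 (i+1)) hyx)).2 (by
      show (fun n => (A (i+1)).2.π ((x n).1 (i+1))) ∈ X i
      have e : (fun n => (A (i+1)).2.π ((x n).1 (i+1))) = fun n => f.π ((x n).1 0) := funext fun n => hAi (i+1) (x n)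
      exact e ▸ hi)
    have h2 : (fun n => (A (i+1)).2.π ((y n).1 (i+1))) ∈ X i := this
    have e : (fun n => (A (i+1)).2.π ((y n).1 (i+1))) = fun n => f.π ((y n).1 0) := funext fun n => hAi (i+1) (y n)
    exact e ▸ h2
  obtain ⟨T', c, hc⟩ := L.open_unravel N _ hopn
  exact ⟨T', (lcov TT N cc).comp c, hc⟩

lemma HU.of_open {T₀ : GT} {X : Set (ℕ → T₀.V)} (h : T₀.Opn X) : T₀.HU X := by
  intro T f N
  refine T.open_unravel N {x | (fun n => f.π (x n)) ∈ X} ?_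
  intro x hx hxX
  obtain ⟨n, hn⟩ := h _ (f.run hx) hxX
  exact ⟨n, fun y hy hyx => hn _ (f.run hy) (congrArg f.π hyx)⟩

/-- The full tree over an alphabet. -/
def FT (M : Type) [Nonempty M] : GT where
  V := List M
  lev := List.length
  par := List.tail
  lev_par _ := List.length_tail
  child l := ⟨Classical.arbitrary M :: l, rfl, rfl⟩

end GT

open GT in
/-- Borel determinacy. Positions are `PiNat.res`-lists (newest move first). -/
theorem borel_determinacy {M : Type} [Nonempty M] (W : Set (ℕ → M))
    (hW : @MeasurableSet _ (@borel (ℕ → M) (@Pi.topologicalSpace ℕ (fun _ => M) (fun _ => ⊥))) W) :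
    (∃ σ : List M → M, ∀ f : ℕ → M, (∀ n, n % 2 = 0 → f n = σ (PiNat.res f n)) → f ∈ W) ∨
    (∃ σ : List M → M, ∀ f : ℕ → M, (∀ n, n % 2 = 1 → f n = σ (PiNat.res f n)) → f ∉ W) := by
  letI : TopologicalSpace M := ⊥
  haveI : DiscreteTopology M := ⟨rfl⟩
  let T := FT M
  let pl : (ℕ → T.V) → ℕ → M := fun x n => (x (n+1)).head?.getD (Classical.arbitrary M)
  have run_res : ∀ f : ℕ → M, T.IsRun (fun n => PiNat.res f n) := fun f n => ⟨PiNat.res_length f n, rfl⟩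
  have pl_res : ∀ f : ℕ → M, pl (fun n => PiNat.res f n) = f := fun f => by
    funext n; simp [pl, PiNat.res_succ]
  have hHU : T.HU {x | pl x ∈ W} := by
    have gen : @borel (ℕ → M) _ = MeasurableSpace.generateFrom {s | IsOpen s} := rfl
    rw [gen] at hW
    induction W, hW using MeasurableSpace.generateFrom_induction with
    | hC t ht _ =>
      refine HU.of_open ?_
      intro x hx hxt
      have ht' : IsOpen t := ht
      obtain ⟨n, hn⟩ : ∃ n, PiNat.cylinder (pl x) n ⊆ t := by
        obtain ⟨_, ⟨y, n, rfl⟩, h1, h2⟩ := (PiNat.isTopologicalBasis_cylinders (fun _ : ℕ => M)).exists_subset_of_mem_open hxt ht'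
        exact ⟨n, by rw [← PiNat.mem_cylinder_iff_eq.1 h1] at h2; exact h2⟩
      refine ⟨n, fun y hy hyx => hn ?_⟩
      intro i hi
      have := hy.eq_of_eq hx hyx (k := i+1) (by omega)
      show pl y i = pl x i
      simp only [pl, this]
    | empty =>
      refine HU.of_open ?_
      intro x hx hxt
      exact hxt.elim
    | compl t _ ih => exact ih.compl
    | iUnion s _ ih =>
      have := HU.union ih
      have e : {x | pl x ∈ ⋃ n, s n} = ⋃ n, {x | pl x ∈ s n} := by ext x; simp
      rw [e]; exact this
  have hr : ∀ v : T.V, T.lev v = 0 ↔ v = ([] : List M) := fun v => List.length_eq_zero_iff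
  have conv : ∀ (b : ℕ) (s : T.V → T.V) (_ : T.IsStrat s) (f : ℕ → M),
     (∀ n, n % 2 = b → f n = (s (PiNat.res f n)).head?.getD (Classical.arbitrary M)) → T.Follows b s (fun n => PiNat.res f n) := by
    intro b s hs f hf n hn
    have h1 := (hs (PiNat.res f n)).1
    have h2 := (hs (PiNat.res f n)).2
    have h3 := hf n hn
    show PiNat.res f (n+1) = s (PiNat.res f n)
    rw [PiNat.res_succ]
    have h1' : List.tail (s (PiNat.res f n)) = PiNat.res f n := h1
    have h2' : List.length (s (PiNat.res f n)) = List.length (PiNat.res f n) + 1 := h2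
    generalize hz : s (PiNat.res f n) = z at *
    have : ∃ a l, z = List.cons a l := List.exists_cons_of_length_eq_add_one h2'
    obtain ⟨a, l, rfl⟩ := this
    simp only [List.tail_cons] at h1'
    have : f n = a := h3
    rw [this, ← h1']
  rcases hHU.det _ hr with ⟨s, hs, hw⟩ | ⟨s, hs, hw⟩
  · left
    refine ⟨fun l => (s l).head?.getD (Classical.arbitrary M), fun f hf => ?_⟩
    have h2 : pl (fun n => PiNat.res f n) ∈ W := hw _ (run_res f) (conv 0 s hs f hf)
    rwa [pl_res] at h2
  · right
    refine ⟨fun l => (s l).head?.getD (Classical.arbitrary M), fun f hf => ?_⟩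
    have h2 : pl (fun n => PiNat.res f n) ∉ W := hw _ (run_res f) (conv 1 s hs f hf)
    rwa [pl_res] at h2

end BD

namespace GP

/-- Ramsey property -/
def R (X : Set (Set ℕ)) : Prop :=
  ∀ B : Set ℕ, B.Infinite → ∃ C, C ⊆ B ∧ C.Infinite ∧
    ((∀ H, H ⊆ C → H.Infinite → H ∈ X) ∨ (∀ H, H ⊆ C → H.Infinite → H ∉ X))

def CR (X : Set (Set ℕ)) : Prop := ∀ a : Finset ℕ, R {H | ↑a ∪ H ∈ X}

def Opn (X : Set (Set ℕ)) : Prop :=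
  ∀ H, H.Infinite → H ∈ X → ∃ m, ∀ H', H'.Infinite → (∀ i < m, i ∈ H' ↔ i ∈ H) → H' ∈ X

lemma fusion (Q : ℕ → Set ℕ → Prop) (B : Set ℕ) (hB : B.Infinite)
    (hered : ∀ n E E', Q n E → E' ⊆ E → E'.Infinite → Q n E')
    (dense : ∀ n E, E ⊆ B → E.Infinite → ∃ E' ⊆ E, E'.Infinite ∧ Q n E') :
    ∃ C ⊆ B, C.Infinite ∧ ∀ c ∈ C, Q c (C ∩ Set.Ioi c) := by
  classical
  let S := {E : Set ℕ // E ⊆ B ∧ E.Infinite}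
  have hmin : ∀ E : S, ∃ n, n ∈ E.1 := fun E => E.2.2.nonempty
  choose mn hmn using hmin
  have step : ∀ E : S, ∃ E' : S, E'.1 ⊆ E.1 ∩ Set.Ioi (mn E) ∧ Q (mn E) E'.1 := by
    intro E
    have h1 : (E.1 ∩ Set.Ioi (mn E)).Infinite := by
      have h2 := E.2.2.sdiff (Set.finite_Iic (mn E))
      refine h2.mono ?_
      intro x hx
      exact ⟨hx.1, by simpa using hx.2⟩
    obtain ⟨E', h3, h4, h5⟩ := dense (mn E) (E.1 ∩ Set.Ioi (mn E)) (fun x hx => E.2.1 hx.1) h1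
    exact ⟨⟨E', fun x hx => E.2.1 (h3 hx).1, h4⟩, h3, h5⟩
  choose F hF1 hF2 using step
  let Es : ℕ → S := fun n => Nat.rec ⟨B, subset_rfl, hB⟩ (fun _ E => F E) n
  have hEs : ∀ n, Es (n+1) = F (Es n) := fun n => rfl
  let c : ℕ → ℕ := fun n => mn (Es n)
  have hsub : ∀ n, (Es (n+1)).1 ⊆ (Es n).1 := fun n x hx => (hF1 (Es n) hx).1
  have anti : Antitone (fun n => (Es n).1) := antitone_nat_of_succ_le hsub
  have cmem : ∀ m n, m ≤ n → c n ∈ (Es m).1 := fun m n h => anti h (hmn (Es n))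
  have cm : StrictMono c := strictMono_nat_of_lt_succ fun n => (hF1 (Es n) (hmn (Es (n+1)))).2
  refine ⟨Set.range c, ?_, Set.infinite_range_of_injective cm.injective, ?_⟩
  · rintro _ ⟨n, rfl⟩
    exact (Es n).2.1 (hmn _)
  · rintro _ ⟨n, rfl⟩
    refine hered _ _ _ (hF2 (Es n)) ?_ ?_
    · rintro _ ⟨⟨m, rfl⟩, hm⟩
      exact cmem (n+1) m (cm.lt_iff_lt.1 hm)
    · have h2 := (Set.infinite_range_of_injective cm.injective).sdiff (Set.finite_Iic (c n))
      refine h2.mono ?_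
      intro x hx
      exact ⟨hx.1, by simpa using hx.2⟩

/-- Finitely many dense hereditary requirements at once. -/
lemma fin_dense {ι : Type} [DecidableEq ι] (P : ι → Set ℕ → Prop) (s : Finset ι) (B : Set ℕ)
    (hered : ∀ i E E', P i E → E' ⊆ E → E'.Infinite → P i E')
    (dense : ∀ i ∈ s, ∀ E ⊆ B, E.Infinite → ∃ E' ⊆ E, E'.Infinite ∧ P i E') :
    ∀ E ⊆ B, E.Infinite → ∃ E' ⊆ E, E'.Infinite ∧ ∀ i ∈ s, P i E' := by
  induction s using Finset.induction_on with
  | empty => intro E hE hi; exact ⟨E, subset_rfl, hi, by simp⟩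
  | insert a s ha ih =>
    intro E hE hi
    obtain ⟨E1, h1, h2, h3⟩ := ih (fun i hi => dense i (Finset.mem_insert_of_mem hi)) E hE hi
    obtain ⟨E2, h4, h5, h6⟩ := dense a (Finset.mem_insert_self _ _) E1 (h1.trans hE) h2
    refine ⟨E2, h4.trans h1, h5, ?_⟩
    intro i hi
    rcases Finset.mem_insert.1 hi with rfl | hi
    · exact h6
    · exact hered _ _ _ (h3 i hi) h4 h5

section open_case
variable (X : Set (Set ℕ))

def Acc (a : Finset ℕ) (E : Set ℕ) : Prop := ∀ H ⊆ E, H.Infinite → ↑a ∪ H ∈ X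
def Rej (a : Finset ℕ) (E : Set ℕ) : Prop := ∀ E' ⊆ E, E'.Infinite → ¬ Acc X a E'

variable {X}

lemma Acc.mono {a : Finset ℕ} {E E' : Set ℕ} (h : Acc X a E) (h' : E' ⊆ E) : Acc X a E' :=
  fun H hH => h H (hH.trans h')
lemma Rej.mono {a : Finset ℕ} {E E' : Set ℕ} (h : Rej X a E) (h' : E' ⊆ E) : Rej X a E' :=
  fun H hH => h H (hH.trans h')

lemma inf_Ioi {E : Set ℕ} (hE : E.Infinite) (n : ℕ) : (E ∩ Set.Ioi n).Infinite := by
  refine (hE.sdiff (Set.finite_Iic n)).mono ?_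
  intro x hx
  exact ⟨hx.1, by simpa using hx.2⟩

lemma decide_one (a : Finset ℕ) (E : Set ℕ) (hE : E.Infinite) :
    ∃ E' ⊆ E, E'.Infinite ∧ (Acc X a E' ∨ Rej X a E') := by
  by_cases h : Rej X a E
  · exact ⟨E, subset_rfl, hE, Or.inr h⟩
  · unfold Rej at h
    push Not at h
    obtain ⟨E', h1, h2, h3⟩ := h
    exact ⟨E', h1, h2, Or.inl h3⟩

/-- if `a` is rejected by `C`, only finitely many one-point extensions are accepted. -/
lemma finite_bad {a : Finset ℕ} {C : Set ℕ} (h : Rej X a C) :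
    {n ∈ C | Acc X (insert n a) (C ∩ Set.Ioi n)}.Finite := by
  by_contra hinf
  refine h {n ∈ C | Acc X (insert n a) (C ∩ Set.Ioi n)} (fun n hn => hn.1) hinf ?_
  intro H hH hHi
  classical
  have hne := hHi.nonempty
  have hm : sInf H ∈ H := Nat.sInf_mem hne
  have h1 := (hH hm).2 (H ∩ Set.Ioi (sInf H)) (fun x hx => ⟨(hH hx.1).1, hx.2⟩) (inf_Ioi hHi _)
  have e : (↑(insert (sInf H) a) : Set ℕ) ∪ H ∩ Set.Ioi (sInf H) = ↑a ∪ H := by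
    ext x
    simp only [Finset.coe_insert, Set.mem_union, Set.mem_insert_iff, Finset.mem_coe, Set.mem_inter_iff, Set.mem_Ioi]
    constructor
    · rintro ((rfl | h) | h)
      · exact Or.inr hm
      · exact Or.inl h
      · exact Or.inr h.1
    · rintro (h | h)
      · exact Or.inl (Or.inr h)
      · rcases (Nat.sInf_le h).eq_or_lt with e | e
        · exact Or.inl (Or.inl e.symm)
        · exact Or.inr ⟨h, e⟩
  rwa [e] at h1

lemma Opn.R (hX : Opn X) : R X := by
  classical
  intro B hB
  obtain ⟨B1, hB1, hB1i, hd⟩ := decide_one (X := X) ∅ B hB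
  rcases hd with hd | hr
  · exact ⟨B1, hB1, hB1i, Or.inl fun H hH hi => by simpa using hd H hH hi⟩
  -- first fusion
  obtain ⟨C, hC, hCi, hCd⟩ := fusion (fun c E => ∀ a ∈ (Finset.range (c+1)).powerset, Acc X a E ∨ Rej X a E) B1 hB1i
    (fun n E E' h h' _ a ha => (h a ha).imp (fun z => z.mono h') (fun z => z.mono h'))
    (fun n E hE hEi => fin_dense (fun (a : Finset ℕ) E => Acc X a E ∨ Rej X a E) _ B1
      (fun i E E' h h' _ => h.imp (fun z => z.mono h') (fun z => z.mono h'))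
      (fun a _ E _ hE => decide_one a E hE) E hE hEi)
  have hrC : Rej X ∅ C := hr.mono hC
  set C1 := C \ {n ∈ C | Acc X (insert n ∅) (C ∩ Set.Ioi n)} with hC1
  have hC1i : C1.Infinite := hCi.sdiff (finite_bad hrC)
  have dec : ∀ (a : Finset ℕ) (n : ℕ), n ∈ C → (∀ x ∈ a, x < n) → ¬ Acc X (insert n a) (C ∩ Set.Ioi n) →
      Rej X (insert n a) (C ∩ Set.Ioi n) := by
    intro a n hn ha hna
    refine (hCd n hn (insert n a) ?_).resolve_left hna
    rw [Finset.mem_powerset]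
    intro x hx
    rcases Finset.mem_insert.1 hx with rfl | hx
    · simp
    · have := ha x hx; simp; omega
  obtain ⟨D, hD, hDi, hDd⟩ := fusion (fun c E => ∀ a ∈ (Finset.range (c+1)).powerset, Rej X a (C ∩ Set.Ioi c) →
      ∀ n ∈ E, c < n → Rej X (insert n a) (C ∩ Set.Ioi n)) C1 hC1i
    (fun n E E' h h' _ a ha hr n hn => h a ha hr n (h' hn))
    (fun c E hE hEi => fin_dense (fun (a : Finset ℕ) E => Rej X a (C ∩ Set.Ioi c) →
      ∀ n ∈ E, c < n → Rej X (insert n a) (C ∩ Set.Ioi n)) _ C1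
      (fun i E E' h h' _ hr n hn => h hr n (h' hn))
      (fun a ha E hE hEi => by
        by_cases hr : Rej X a (C ∩ Set.Ioi c)
        · refine ⟨E \ {n ∈ C ∩ Set.Ioi c | Acc X (insert n a) (C ∩ Set.Ioi c ∩ Set.Ioi n)}, Set.sdiff_subset,
            hEi.sdiff (finite_bad hr), fun _ n hn hcn => ?_⟩
          have hnC : n ∈ C := (hE hn.1).1
          refine dec a n hnC ?_ ?_
          · intro x hx
            have := Finset.mem_powerset.1 ha hx
            simp at this; omega
          · intro hacc
            exact hn.2 ⟨⟨hnC, hcn⟩, hacc.mono fun x hx => ⟨hx.1.1, hx.2⟩⟩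
        · exact ⟨E, subset_rfl, hEi, fun h => absurd h hr⟩) E hE hEi)
  have key : ∀ a : Finset ℕ, ↑a ⊆ D → ∀ ne : a.Nonempty, Rej X a (C ∩ Set.Ioi (a.max' ne)) := by
    intro a
    induction a using Finset.induction_on_max with
    | empty => intro _ ne; simp at ne
    | insert n s hs ih =>
      intro hsub ne
      have hmax : (insert n s).max' ne = n := by
        apply le_antisymm
        · apply Finset.max'_le
          intro y hy
          rcases Finset.mem_insert.1 hy with rfl | hy
          · exact le_rfl
          · exact (hs y hy).le
        · exact Finset.le_max' _ _ (Finset.mem_insert_self _ _)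
      rw [hmax]
      have hnD : n ∈ D := hsub (by simp)
      rcases s.eq_empty_or_nonempty with rfl | hsne
      · have := hD hnD
        exact dec ∅ n this.1 (by simp) fun h => this.2 ⟨this.1, h⟩
      · have h1 := ih (fun x hx => hsub (by simp at hx ⊢; exact Or.inr hx)) hsne
        have hmD : s.max' hsne ∈ D := hsub (by simp; exact Or.inr (Finset.max'_mem _ _))
        refine hDd _ hmD s ?_ h1 n ⟨hnD, ?_⟩ ?_
        · rw [Finset.mem_powerset]; intro x hx
          have := Finset.le_max' s x hx
          simp; omega
        · exact hs _ (Finset.max'_mem _ _)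
        · exact hs _ (Finset.max'_mem _ _)
  refine ⟨D, hD.trans (Set.sdiff_subset.trans (hC.trans hB1)), hDi, Or.inr ?_⟩
  intro H hH hHi hHX
  obtain ⟨m, hm⟩ := hX H hHi hHX
  obtain ⟨h0, hh0⟩ := hHi.nonempty
  set m' := max m (h0+1) with hm'
  let a : Finset ℕ := (Finset.range m').filter (· ∈ H)
  have hane : a.Nonempty := ⟨h0, by simp [a, hh0, hm']⟩
  have haD : ↑a ⊆ D := fun x hx => hH (by simpa [a] using (Finset.mem_filter.1 hx).2)
  refine key a haD hane (C ∩ Set.Ioi m') ?_ (inf_Ioi hCi _) ?_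
  · rintro x ⟨hx1, hx2⟩
    refine ⟨hx1, Set.mem_Ioi.2 (lt_trans ?_ (Set.mem_Ioi.1 hx2))⟩
    have := Finset.max'_mem a hane
    exact Finset.mem_range.1 (Finset.mem_filter.1 this).1
  · intro H' hH' hH'i
    refine hm _ (hH'i.mono Set.subset_union_right) ?_
    intro i hi
    constructor
    · rintro (h | h)
      · exact (Finset.mem_filter.1 h).2
      · have := (hH' h).2; simp at this; omega
    · intro h
      left
      exact Finset.mem_filter.2 ⟨Finset.mem_range.2 (by omega), h⟩
end open_case

lemma CR.compl {X : Set (Set ℕ)} (h : CR X) : CR Xᶜ := by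
  intro a B hB
  obtain ⟨C, h1, h2, h3⟩ := h a B hB
  refine ⟨C, h1, h2, ?_⟩
  rcases h3 with h3 | h3
  · exact Or.inr fun H h4 h5 h6 => h6 (h3 H h4 h5)
  · exact Or.inl h3

lemma CR.of_open {X : Set (Set ℕ)} (h : Opn X) : CR X := by
  intro a
  apply Opn.R
  intro H hH hHX
  obtain ⟨m, hm⟩ := h _ (hH.mono Set.subset_union_right) hHX
  refine ⟨m, fun H' hH' e => hm _ (hH'.mono Set.subset_union_right) ?_⟩
  intro i hi
  simp only [Set.mem_union, e i hi]

lemma CR.trans {X : Set (Set ℕ)} (h : CR X) (a : Finset ℕ) : CR {H | ↑a ∪ H ∈ X} := by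
  classical
  intro b
  have := h (a ∪ b)
  simpa [Set.union_assoc] using this

lemma R.union {X : ℕ → Set (Set ℕ)} (h : ∀ i, CR (X i)) : R (⋃ i, X i) := by
  classical
  intro B hB
  let P : ℕ × Finset ℕ → Set ℕ → Prop := fun p E =>
    (∀ H ⊆ E, H.Infinite → ↑p.2 ∪ H ∈ X p.1) ∨ (∀ H ⊆ E, H.Infinite → ↑p.2 ∪ H ∉ X p.1)
  have hP : ∀ i E E', P i E → E' ⊆ E → E'.Infinite → P i E' := fun i E E' hp hE _ =>
    hp.imp (fun z H hH => z H (hH.trans hE)) (fun z H hH => z H (hH.trans hE))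
  obtain ⟨C, hC, hCi, hCd⟩ := fusion
    (fun c E => ∀ p ∈ (Finset.range (c+1)) ×ˢ (Finset.range (c+1)).powerset, P p E) B hB
    (fun n E E' hp h1 h2 p hpm => hP _ _ _ (hp p hpm) h1 h2)
    (fun n E hE hEi => fin_dense P _ B hP (fun p _ E _ hEi => by
      obtain ⟨C, h1, h2, h3⟩ := h p.1 p.2 E hEi
      exact ⟨C, h1, h2, h3⟩) E hE hEi)
  let Y : Set (Set ℕ) := {H | ∃ m, ∀ H'' ⊆ C, H''.Infinite → (∀ i < m, i ∈ H'' ↔ i ∈ H) → H'' ∈ ⋃ i, X i}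
  have hY : Opn Y := by
    rintro H hH ⟨m, hm⟩
    refine ⟨m, fun H' hH' e => ⟨m, fun H'' h1 h2 h3 => hm H'' h1 h2 fun i hi => (h3 i hi).trans (e i hi)⟩⟩
  have hYX : ∀ H ⊆ C, H.Infinite → (H ∈ Y ↔ H ∈ ⋃ i, X i) := by
    intro H hH hHi
    constructor
    · rintro ⟨m, hm⟩
      exact hm H hH hHi fun i _ => Iff.rfl
    · intro hx
      obtain ⟨i, hi⟩ := Set.mem_iUnion.1 hx
      obtain ⟨c, hcH, hci⟩ := hHi.exists_gt i
      let a : Finset ℕ := (Finset.range (c+1)).filter (· ∈ H)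
      have split : ∀ H' : Set ℕ, (∀ j < c+1, j ∈ H' ↔ j ∈ H) → ↑a ∪ (H' ∩ Set.Ioi c) = H' := by
        intro H' hH'
        ext j
        simp only [a, Set.mem_union, Finset.coe_filter, Finset.mem_range, Set.mem_inter_iff, Set.mem_Ioi, Set.mem_ofPred_eq]
        by_cases hj : j < c+1
        · rw [hH' j hj]
          constructor
          · rintro (h | h)
            · exact h.2
            · omega
          · exact fun h => Or.inl ⟨hj, h⟩
        · constructor
          · rintro (h | h)
            · omega
            · exact h.1
          · exact fun h => Or.inr ⟨h, by omega⟩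
      have hp : P (i, a) (C ∩ Set.Ioi c) := hCd c (hH hcH) (i, a) (by
        rw [Finset.mem_product, Finset.mem_powerset]
        exact ⟨Finset.mem_range.2 (by omega), Finset.filter_subset _ _⟩)
      have hp' := hp.resolve_right (fun hn => hn (H ∩ Set.Ioi c) (fun x hx => ⟨hH hx.1, hx.2⟩) (inf_Ioi hHi _) (by
        show _ ∪ _ ∈ X i
        rw [split H fun j _ => Iff.rfl]; exact hi))
      refine ⟨c+1, fun H'' h1 h2 h3 => Set.mem_iUnion.2 ⟨i, ?_⟩⟩
      have := hp' (H'' ∩ Set.Ioi c) (fun x hx => ⟨h1 hx.1, hx.2⟩) (inf_Ioi h2 _)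
      have h4 : (↑a ∪ H'' ∩ Set.Ioi c) ∈ X i := this
      rwa [split H'' h3] at h4
  obtain ⟨D, h1, h2, h3⟩ := hY.R C hCi
  refine ⟨D, h1.trans hC, h2, ?_⟩
  rcases h3 with h3 | h3
  · exact Or.inl fun H hH hi => (hYX H (hH.trans h1) hi).1 (h3 H hH hi)
  · exact Or.inr fun H hH hi h => h3 H hH hi ((hYX H (hH.trans h1) hi).2 h)

lemma CR.union {X : ℕ → Set (Set ℕ)} (h : ∀ i, CR (X i)) : CR (⋃ i, X i) := by
  intro a
  have := R.union (fun i => (h i).trans a)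
  have e : {H : Set ℕ | ↑a ∪ H ∈ ⋃ i, X i} = ⋃ i, {H | ↑a ∪ H ∈ X i} := by
    ext H; simp
  rw [e]; exact this

lemma CR.R {X : Set (Set ℕ)} (h : CR X) : R X := by
  have := h ∅
  simpa using this

/-- Preimages of Borel sets under maps continuous on infinite sets. -/
lemma CR.of_borel {A : Set (ℕ → Bool)} (hA : @MeasurableSet _ (borel (ℕ → Bool)) A) (f : Set ℕ → ℕ → Bool)
    (hf : ∀ H, H.Infinite → ∀ n, ∃ m, ∀ H', H'.Infinite → (∀ i < m, i ∈ H' ↔ i ∈ H) → ∀ k < n, f H' k = f H k) :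
    CR {H | f H ∈ A} := by
  have gen : borel (ℕ → Bool) = MeasurableSpace.generateFrom {s | IsOpen s} := rfl
  rw [gen] at hA
  induction A, hA using MeasurableSpace.generateFrom_induction with
  | hC t ht _ =>
    apply CR.of_open
    intro H hH hHt
    obtain ⟨_, ⟨y, n, rfl⟩, h1, h2⟩ :=
      (PiNat.isTopologicalBasis_cylinders (fun _ : ℕ => Bool)).exists_subset_of_mem_open hHt ht
    obtain ⟨m, hm⟩ := hf H hH n
    refine ⟨m, fun H' hH' e => h2 ?_⟩
    intro i hi
    rw [hm H' hH' e i hi]; exact h1 i hi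
  | empty => 
    apply CR.of_open
    intro H _ h
    exact h.elim
  | compl t _ ih => exact ih.compl
  | iUnion s _ ih =>
    have := CR.union ih
    have e : {x | f x ∈ ⋃ n, s n} = ⋃ n, {x | f x ∈ s n} := by ext x; simp
    rw [e]; exact this

/-- Galvin–Prikry for two sets. -/
theorem two {X Y : Set (Set ℕ)} (hX : CR X) (hY : CR Y) :
    ∃ C : Set ℕ, C.Infinite ∧ ∀ H ⊆ C, H.Infinite → ∀ H' ⊆ C, H'.Infinite → (H ∈ X ↔ H' ∈ X) ∧ (H ∈ Y ↔ H' ∈ Y) := by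
  obtain ⟨B, _, h2, h3⟩ := hX.R Set.univ Set.infinite_univ
  obtain ⟨C, h4, h5, h6⟩ := hY.R B h2
  refine ⟨C, h5, fun H hH hi H' hH' hi' => ⟨?_, ?_⟩⟩
  · rcases h3 with h | h
    · exact iff_of_true (h H (hH.trans h4) hi) (h H' (hH'.trans h4) hi')
    · exact iff_of_false (h H (hH.trans h4) hi) (h H' (hH'.trans h4) hi')
  · rcases h6 with h | h
    · exact iff_of_true (h H hH hi) (h H' hH' hi')
    · exact iff_of_false (h H hH hi) (h H' hH' hi')

end GP

namespace TG

abbrev C := ℕ → Bool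
abbrev cyl (z : C) (k : ℕ) : Set C := PiNat.cylinder (E := fun _ => Bool) z k

lemma mem_cyl {x z : C} {k : ℕ} : x ∈ cyl z k ↔ ∀ i < k, x i = z i := Iff.rfl
lemma self_mem_cyl (z : C) (k : ℕ) : z ∈ cyl z k := fun _ _ => rfl
lemma cyl_clopen (z : C) (k : ℕ) : IsClopen (cyl z k) :=
  by
  refine ⟨?_, PiNat.isOpen_cylinder (fun _ => Bool) _ _⟩
  have : cyl z k = ⋂ i ∈ Set.Iio k, {x : C | x i = z i} := by
    ext x; simp [mem_cyl]
  rw [this]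
  exact isClosed_biInter fun i _ => isClosed_eq (continuous_apply i) continuous_const
lemma cyl_anti (z : C) {k l : ℕ} (h : k ≤ l) : cyl z l ⊆ cyl z k := fun _ hx i hi => hx i (hi.trans_le h)
lemma cyl_eq {x z : C} {k : ℕ} (h : x ∈ cyl z k) : cyl x k = cyl z k := by
  ext y; exact ⟨fun hy i hi => (hy i hi).trans (h i hi), fun hy i hi => (hy i hi).trans (h i hi).symm⟩
lemma cyl_inter {x z : C} {k l : ℕ} (h : x ∈ cyl z k) : cyl z k ∩ cyl x l = cyl x (max k l) := by
  rw [← cyl_eq h]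
  ext y
  constructor
  · rintro ⟨h1, h2⟩ i hi
    rcases lt_max_iff.1 hi with h | h
    · exact h1 i h
    · exact h2 i h
  · intro h
    exact ⟨cyl_anti _ (le_max_left _ _) h, cyl_anti _ (le_max_right _ _) h⟩
lemma exists_cyl_subset {O : Set C} (hO : IsOpen O) {x : C} (hx : x ∈ O) : ∃ n, cyl x n ⊆ O := by
  obtain ⟨_, ⟨y, n, rfl⟩, h1, h2⟩ :=
      (PiNat.isTopologicalBasis_cylinders (fun _ : ℕ => Bool)).exists_subset_of_mem_open hx hO
  exact ⟨n, by rw [cyl_eq h1]; exact h2⟩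

/-- moves -/
abbrev M := Set C × (C × ℕ)

open Classical in
noncomputable def pick (S : Set C) (z : C) : C := if z ∈ S then z else if h : S.Nonempty then h.some else z

lemma pick_mem {S : Set C} (h : S.Nonempty) (z : C) : pick S z ∈ S := by
  unfold pick; split_ifs with h1
  · exact h1
  · exact h.some_mem

lemma pick_eq {S : Set C} {z : C} (h : z ∈ S) : pick S z = z := if_pos h

open Classical in
noncomputable def clm (S T : Set C) : Set C := if IsClosed T ∧ T.Nonempty ∧ T ⊆ S then T else S

lemma clm_sub (S T : Set C) : clm S T ⊆ S := by
  unfold clm; split_ifs with h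
  · exact h.2.2
  · exact subset_rfl
lemma clm_eq {S T : Set C} (h1 : IsClosed T) (h2 : T.Nonempty) (h3 : T ⊆ S) : clm S T = T := if_pos ⟨h1, h2, h3⟩

lemma clm_self (S : Set C) : clm S S = S := by unfold clm; split_ifs <;> rfl

noncomputable def rel (S : Set C) (n : ℕ) (t : C × ℕ) : Set C := S ∩ cyl (pick S t.1) (max t.2 n)

lemma rel_sub (S : Set C) (n : ℕ) (t : C × ℕ) : rel S n t ⊆ S := Set.inter_subset_left

noncomputable def stepM (n : ℕ) (m : M) (st : Set C × Set C) : Set C × Set C :=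
  if n % 4 = 0 then (clm st.1 m.1, st.2)
  else if n % 4 = 1 then (rel st.1 n m.2, st.2)
  else if n % 4 = 2 then (st.1, rel st.2 n m.2)
  else (st.1, clm st.2 m.1)

def OK (S : Set C) : Prop := IsClosed S ∧ S.Nonempty

lemma OK.clm {S : Set C} (h : OK S) (T : Set C) : OK (clm S T) := by
  unfold TG.clm; split_ifs with h1
  · exact ⟨h1.1, h1.2.1⟩
  · exact h
lemma OK.rel {S : Set C} (h : OK S) (n : ℕ) (t : C × ℕ) : OK (rel S n t) :=
  ⟨h.1.inter (cyl_clopen _ _).1, _, pick_mem h.2 _, self_mem_cyl _ _⟩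

lemma stepM_ok (n : ℕ) (m : M) {st : Set C × Set C} (h1 : OK st.1) (h2 : OK st.2) :
    OK (stepM n m st).1 ∧ OK (stepM n m st).2 := by
  unfold stepM
  split_ifs
  · exact ⟨h1.clm _, h2⟩
  · exact ⟨h1.rel _ _, h2⟩
  · exact ⟨h1, h2.rel _ _⟩
  · exact ⟨h1, h2.clm _⟩

lemma stepM_sub (n : ℕ) (m : M) (st : Set C × Set C) :
    (stepM n m st).1 ⊆ st.1 ∧ (stepM n m st).2 ⊆ st.2 := by
  unfold stepM
  split_ifs
  · exact ⟨clm_sub _ _, subset_rfl⟩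
  · exact ⟨rel_sub _ _ _, subset_rfl⟩
  · exact ⟨subset_rfl, rel_sub _ _ _⟩
  · exact ⟨subset_rfl, clm_sub _ _⟩

variable (F K : Set C)

noncomputable def stL : List M → Set C × Set C
  | [] => (F, K)
  | m :: l => stepM l.length m (stL l)

variable {F K}

lemma stL_ok (hF : OK F) (hK : OK K) (l : List M) : OK (stL F K l).1 ∧ OK (stL F K l).2 := by
  induction l with
  | nil => exact ⟨hF, hK⟩
  | cons m l ih => exact stepM_ok _ _ ih.1 ih.2

section
variable (F K)
noncomputable abbrev Fs (f : ℕ → M) (n : ℕ) : Set C := (stL F K (PiNat.res f n)).1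
noncomputable abbrev Ks (f : ℕ → M) (n : ℕ) : Set C := (stL F K (PiNat.res f n)).2
end

lemma Fs_anti (f : ℕ → M) : Antitone (Fs F K f) := antitone_nat_of_succ_le fun n => by
  show (stL F K (PiNat.res f (n+1))).1 ⊆ _
  rw [PiNat.res_succ]; exact (stepM_sub _ _ _).1
lemma Ks_anti (f : ℕ → M) : Antitone (Ks F K f) := antitone_nat_of_succ_le fun n => by
  show (stL F K (PiNat.res f (n+1))).2 ⊆ _
  rw [PiNat.res_succ]; exact (stepM_sub _ _ _).2

lemma inter_ne {S : ℕ → Set C} (ha : Antitone S) (h : ∀ n, OK (S n)) : ∃ x, ∀ n, x ∈ S n := by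
  obtain ⟨x, hx⟩ := IsCompact.nonempty_iInter_of_sequence_nonempty_isCompact_isClosed S (fun n => ha (Nat.le_succ n))
    (fun n => (h n).2) (h 0).1.isCompact (fun n => (h n).1)
  exact ⟨x, Set.mem_iInter.1 hx⟩

lemma Fs_small (f : ℕ → M) (n : ℕ) (hn : n % 4 = 1) : ∃ z, Fs F K f (n+1) ⊆ cyl z n := by
  refine ⟨pick (Fs F K f n) (f n).2.1, ?_⟩
  show (stL F K (PiNat.res f (n+1))).1 ⊆ _
  rw [PiNat.res_succ, stL, PiNat.res_length, stepM, if_neg (by omega), if_pos hn]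
  exact fun x hx => cyl_anti _ (le_max_right _ _) hx.2
lemma Ks_small (f : ℕ → M) (n : ℕ) (hn : n % 4 = 2) : ∃ z, Ks F K f (n+1) ⊆ cyl z n := by
  refine ⟨pick (Ks F K f n) (f n).2.1, ?_⟩
  show (stL F K (PiNat.res f (n+1))).2 ⊆ _
  rw [PiNat.res_succ, stL, PiNat.res_length, stepM, if_neg (by omega), if_neg (by omega), if_pos hn]
  exact fun x hx => cyl_anti _ (le_max_right _ _) hx.2

lemma Fs_bit (f : ℕ → M) (i : ℕ) {x y : C} (hx : x ∈ Fs F K f (4*i+6)) (hy : y ∈ Fs F K f (4*i+6)) : x i = y i := by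
  obtain ⟨z, hz⟩ := Fs_small (F := F) (K := K) f (4*i+5) (by omega)
  exact (hz hx i (by omega)).trans (hz hy i (by omega)).symm
lemma Ks_bit (f : ℕ → M) (i : ℕ) {x y : C} (hx : x ∈ Ks F K f (4*i+7)) (hy : y ∈ Ks F K f (4*i+7)) : x i = y i := by
  obtain ⟨z, hz⟩ := Ks_small (F := F) (K := K) f (4*i+6) (by omega)
  exact (hz hx i (by omega)).trans (hz hy i (by omega)).symm

/-- what II has to achieve -/
def IIok (A : Set C) (F K : Set C) (f : ℕ → M) : Prop :=
  (∀ x y, (∀ n, x ∈ Fs F K f n) → (∀ n, y ∈ Ks F K f n) → (x ∈ A ↔ y ∈ A)) ∧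
  ((∃ n, (Ks F K f n).Subsingleton) → ∃ n, (Fs F K f n).Subsingleton)

def IIwin (A F K : Set C) : Prop :=
  ∃ σ : List M → M, ∀ f : ℕ → M, (∀ n, n % 2 = 1 → f n = σ (PiNat.res f n)) → IIok A F K f
def Iwin (A F K : Set C) : Prop :=
  ∃ σ : List M → M, ∀ f : ℕ → M, (∀ n, n % 2 = 0 → f n = σ (PiNat.res f n)) → ¬ IIok A F K f

lemma isClopen_fin [TopologicalSpace M] [DiscreteTopology M] (N : ℕ) (P : List M → Prop) :
    IsClopen {f : ℕ → M | P (PiNat.res f N)} := by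
  have h : ∀ P : List M → Prop, IsOpen {f : ℕ → M | P (PiNat.res f N)} := by
    intro P
    rw [isOpen_iff_mem_nhds]
    intro f hf
    refine Filter.mem_of_superset ((PiNat.isOpen_cylinder (fun _ => M) f N).mem_nhds (PiNat.self_mem_cylinder f N)) ?_
    intro g hg
    have : PiNat.res g N = PiNat.res f N := by
      rw [PiNat.cylinder_eq_res] at hg; exact hg
    show P _
    rw [this]; exact hf
  refine ⟨⟨?_⟩, h P⟩
  exact h fun l => ¬ P l

theorem dichotomy {A : Set C} (hA : @MeasurableSet _ (borel C) A) (hF : OK F) (hK : OK K) :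
    Iwin A F K ∨ IIwin A F K := by
  letI : TopologicalSpace M := ⊥
  haveI : DiscreteTopology M := ⟨rfl⟩
  have hx := fun f : ℕ → M => inter_ne (Fs_anti (F := F) (K := K) f) (fun n => (stL_ok hF hK _).1)
  have hy := fun f : ℕ → M => inter_ne (Ks_anti (F := F) (K := K) f) (fun n => (stL_ok hF hK _).2)
  choose xf hxf using hx
  choose yf hyf using hy
  have ux : ∀ f x, (∀ n, x ∈ Fs F K f n) → x = xf f := fun f x h => funext fun i => Fs_bit f i (h _) (hxf f _)
  have uy : ∀ f x, (∀ n, x ∈ Ks F K f n) → x = yf f := fun f x h => funext fun i => Ks_bit f i (h _) (hyf f _)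
  have cx : Continuous xf := by
    refine continuous_pi fun i => ?_
    rw [continuous_discrete_rng]
    intro b
    have e : (fun f => xf f i) ⁻¹' {b} = {f : ℕ → M | ∀ x ∈ (stL F K (PiNat.res f (4*i+6))).1, x i = b} := by
      ext f
      exact ⟨fun h x hx => (Fs_bit f i hx (hxf f _)).trans h, fun h => h _ (hxf f _)⟩
    rw [e]; exact (isClopen_fin _ (fun l => ∀ x ∈ (stL F K l).1, x i = b)).2
  have cy : Continuous yf := by
    refine continuous_pi fun i => ?_
    rw [continuous_discrete_rng]
    intro b
    have e : (fun f => yf f i) ⁻¹' {b} = {f : ℕ → M | ∀ x ∈ (stL F K (PiNat.res f (4*i+7))).2, x i = b} := by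
      ext f
      exact ⟨fun h x hx => (Ks_bit f i hx (hyf f _)).trans h, fun h => h _ (hyf f _)⟩
    rw [e]; exact (isClopen_fin _ (fun l => ∀ x ∈ (stL F K l).2, x i = b)).2
  have hiff : ∀ f, IIok A F K f ↔ ((xf f ∈ A ↔ yf f ∈ A) ∧
     ((∃ n, (Ks F K f n).Subsingleton) → ∃ n, (Fs F K f n).Subsingleton)) := by
    intro f
    refine and_congr_left fun _ => ⟨fun h => h _ _ (hxf f) (hyf f), fun h x y h1 h2 => ?_⟩
    rw [ux f x h1, uy f y h2]; exact h
  letI mM : MeasurableSpace (ℕ → M) := borel (ℕ → M)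
  haveI : BorelSpace (ℕ → M) := ⟨rfl⟩
  letI mC : MeasurableSpace C := borel C
  haveI : BorelSpace C := ⟨rfl⟩
  have m1 : MeasurableSet {f | xf f ∈ A} := cx.measurable hA
  have m2 : MeasurableSet {f | yf f ∈ A} := cy.measurable hA
  have m3 : MeasurableSet {f : ℕ → M | ∃ n, (Ks F K f n).Subsingleton} := by
    have : {f : ℕ → M | ∃ n, (Ks F K f n).Subsingleton} = ⋃ n, {f : ℕ → M | (stL F K (PiNat.res f n)).2.Subsingleton} := by
      ext f; simp
    rw [this]
    exact MeasurableSet.iUnion fun n => (isClopen_fin n (fun l => (stL F K l).2.Subsingleton)).2.measurableSet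
  have m4 : MeasurableSet {f : ℕ → M | ∃ n, (Fs F K f n).Subsingleton} := by
    have : {f : ℕ → M | ∃ n, (Fs F K f n).Subsingleton} = ⋃ n, {f : ℕ → M | (stL F K (PiNat.res f n)).1.Subsingleton} := by
      ext f; simp
    rw [this]
    exact MeasurableSet.iUnion fun n => (isClopen_fin n (fun l => (stL F K l).1.Subsingleton)).2.measurableSet
  have m : MeasurableSet {f | ¬ IIok A F K f} := by
    simp only [hiff]
    exact MeasurableSet.compl (MeasurableSet.inter (MeasurableSet.iff m1 m2) (MeasurableSet.imp m3 m4))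
  haveI : Nonempty M := ⟨(∅, (fun _ => false, 0))⟩
  rcases BD.borel_determinacy {f | ¬ IIok A F K f} m with ⟨σ, h⟩ | ⟨σ, h⟩
  · exact Or.inl ⟨σ, h⟩
  · exact Or.inr ⟨σ, fun f hf => not_not.1 (h f hf)⟩

end TG

namespace TG

lemma weave {α : Type} (a b c d : ℕ → α) : ∃ f : ℕ → α, ∀ r, f (4*r) = a r ∧ f (4*r+1) = b r ∧ f (4*r+2) = c r ∧ f (4*r+3) = d r := by
  refine ⟨fun n => if n % 4 = 0 then a (n/4) else if n % 4 = 1 then b (n/4) else if n % 4 = 2 then c (n/4) else d (n/4), fun r => ⟨?_, ?_, ?_, ?_⟩⟩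
  · have h1 : (4*r) % 4 = 0 := by omega
    have h2 : (4*r) / 4 = r := by omega
    simp only [h1, h2, if_true]
  · have h1 : (4*r+1) % 4 = 1 := by omega
    have h2 : (4*r+1) / 4 = r := by omega
    simp [h1, h2]
  · have h1 : (4*r+2) % 4 = 2 := by omega
    have h2 : (4*r+2) / 4 = r := by omega
    simp [h1, h2]
  · have h1 : (4*r+3) % 4 = 3 := by omega
    have h2 : (4*r+3) / 4 = r := by omega
    simp [h1, h2]

def z0 : C := fun _ => false

/-- no isolated points -/
def Perf (S : Set C) : Prop := ∀ x ∈ S, ∀ n, ∃ y ∈ S, y ∈ cyl x n ∧ y ≠ x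

def PS (S : Set C) : Prop := Perf S ∨ ∃ x, S = {x}

lemma Perf.inter {S : Set C} (h : Perf S) (z : C) (k : ℕ) : Perf (S ∩ cyl z k) := by
  rintro x ⟨hx, hxz⟩ n
  obtain ⟨y, h1, h2, h3⟩ := h x hx (max n k)
  refine ⟨y, ⟨h1, ?_⟩, cyl_anti _ (le_max_left _ _) h2, h3⟩
  rw [← cyl_eq hxz]; exact cyl_anti _ (le_max_right _ _) h2

lemma Perf.not_sub {S : Set C} (h : Perf S) (hne : S.Nonempty) : ¬ S.Subsingleton := by
  obtain ⟨x, hx⟩ := hne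
  obtain ⟨y, h1, _, h3⟩ := h x hx 0
  exact fun hs => h3 (hs h1 hx)

lemma PS.perf {S : Set C} (h : PS S) {x y : C} (hx : x ∈ S) (hy : y ∈ S) (hxy : x ≠ y) : Perf S := by
  rcases h with h | ⟨z, rfl⟩
  · exact h
  · exact absurd (hx.trans hy.symm) hxy

lemma PS.rel {S : Set C} (h : PS S) (hne : S.Nonempty) (n : ℕ) (t : C × ℕ) : PS (rel S n t) := by
  rcases h with h | ⟨z, rfl⟩
  · exact Or.inl (h.inter _ _)
  · right
    refine ⟨z, ?_⟩
    have := pick_mem hne t.1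
    ext x
    constructor
    · exact fun h => h.1
    · rintro rfl
      exact ⟨rfl, by rw [Set.mem_singleton_iff.1 this]; exact self_mem_cyl _ _⟩

/-- `A`-preserving embeddings -/
def Emb (A F K : Set C) : Prop :=
  ∃ h : C → C, ContinuousOn h F ∧ Set.InjOn h F ∧ Set.MapsTo h F K ∧ ∀ x ∈ F, (h x ∈ A ↔ x ∈ A)

lemma Emb.mono {A F K F' K' : Set C} (h : Emb A F K) (hF : F' ⊆ F) (hK : K ⊆ K') : Emb A F' K' := by
  obtain ⟨f, h1, h2, h3, h4⟩ := h
  exact ⟨f, h1.mono hF, h2.mono hF, fun x hx => hK (h3 (hF hx)), fun x hx => h4 x (hF hx)⟩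

section II
variable (A F K : Set C) (τ : List M → M)

abbrev l1 (l : List M) (G : Set C) : List M := (G, (z0, 0)) :: l
noncomputable abbrev Fw (l : List M) : Set C := (stL F K l).1
noncomputable abbrev Kw (l : List M) : Set C := (stL F K l).2

def l2 (l : List M) (G : Set C) (z : C) (k : ℕ) : List M := (∅, (z, k)) :: τ (l1 l G) :: l1 l G
def rd (l : List M) (G : Set C) (z : C) (k : ℕ) : List M := τ (l2 τ l G z k) :: l2 τ l G z k

/-- the piece played by II after claim `G` -/
noncomputable def pc (l : List M) (G : Set C) : Set C := rel (clm (Fw F K l) G) (l.length + 1) (τ (l1 l G)).2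

variable {A F K τ}

lemma Fw_rd {l : List M} (hl : l.length % 4 = 0) (G : Set C) (z : C) (k : ℕ) :
    Fw F K (rd τ l G z k) = pc F K τ l G := by
  have h1 : (l.length+1) % 4 = 1 := by omega
  have h2 : (l.length+1+1) % 4 = 2 := by omega
  have h3 : (l.length+1+1+1) % 4 = 3 := by omega
  simp [Fw, rd, l2, l1, stL, stepM, hl, h1, h2, h3, pc]

lemma Kw_rd {l : List M} (hl : l.length % 4 = 0) (G : Set C) (z : C) (k : ℕ) :
    Kw F K (rd τ l G z k) = clm (rel (Kw F K l) (l.length+2) (z, k)) (τ (l2 τ l G z k)).1 := by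
  have h1 : (l.length+1) % 4 = 1 := by omega
  have h2 : (l.length+1+1) % 4 = 2 := by omega
  have h3 : (l.length+1+1+1) % 4 = 3 := by omega
  simp [Kw, rd, l2, l1, stL, stepM, hl, h1, h2, h3]

variable (A F K τ)
def Good (p : List M) : Prop := ∀ L : ℕ → List M, L 0 = p → (∀ r, ∃ G z k, L (r+1) = rd τ (L r) G z k) →
  (∀ x y, (∀ r, x ∈ Fw F K (L r)) → (∀ r, y ∈ Kw F K (L r)) → (x ∈ A ↔ y ∈ A)) ∧
  ((∃ r, (Kw F K (L r)).Subsingleton) → ∃ r, (Fw F K (L r)).Subsingleton)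

structure Valid (p : List M) : Prop where
  len : p.length % 4 = 0
  okF : OK (Fw F K p)
  okK : OK (Kw F K p)
  ps : PS (Fw F K p)
  good : Good A F K τ p

def Adm (p : List M) (G : Set C) : Prop := OK G ∧ G ⊆ Fw F K p ∧ PS G

variable {A F K τ}

lemma rd_sub {p : List M} (hl : p.length % 4 = 0) (G : Set C) (z : C) (k : ℕ) :
    Fw F K (rd τ p G z k) ⊆ Fw F K p ∧ Kw F K (rd τ p G z k) ⊆ Kw F K p := by
  rw [Fw_rd hl, Kw_rd hl]
  exact ⟨(rel_sub _ _ _).trans (clm_sub _ _), (clm_sub _ _).trans (rel_sub _ _ _)⟩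

lemma rd_len {p : List M} (hl : p.length % 4 = 0) (G : Set C) (z : C) (k : ℕ) : (rd τ p G z k).length % 4 = 0 := by
  show (p.length+1+1+1+1) % 4 = 0
  omega

lemma Kw_rd_sub {p : List M} (hl : p.length % 4 = 0) (G : Set C) {z : C} (hz : z ∈ Kw F K p) (k : ℕ) :
    Kw F K (rd τ p G z k) ⊆ cyl z k := by
  rw [Kw_rd hl]
  refine (clm_sub _ _).trans ?_
  intro x hx
  have := hx.2
  rw [pick_eq hz] at this
  exact cyl_anti _ (le_max_left _ _) this

lemma Good.step {p : List M} (hl : p.length % 4 = 0) (h : Good A F K τ p) (G : Set C) (z : C) (k : ℕ) :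
    Good A F K τ (rd τ p G z k) := by
  intro L hL0 hL
  let L' : ℕ → List M := fun n => Nat.casesOn n p (fun m => L m)
  have hsub := rd_sub (F := F) (K := K) (τ := τ) hl G z k
  rw [← hL0] at hsub
  obtain ⟨h1, h2⟩ := h L' rfl (by
    intro r
    cases r with
    | zero => exact ⟨G, z, k, hL0⟩
    | succ r => exact hL r)
  refine ⟨fun x y hx hy => h1 x y ?_ ?_, fun ⟨r, hr⟩ => ?_⟩
  · intro r
    cases r with
    | zero => exact hsub.1 (hx 0)
    | succ r => exact hx r
  · intro r
    cases r with
    | zero => exact hsub.2 (hy 0)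
    | succ r => exact hy r
  · obtain ⟨r', hr'⟩ := h2 ⟨r+1, hr⟩
    cases r' with
    | zero => exact ⟨0, hr'.anti hsub.1⟩
    | succ r' => exact ⟨r', hr'⟩

lemma Valid.step {p : List M} (h : Valid A F K τ p) {G : Set C} (hG : Adm F K p G) {z : C} (k : ℕ) :
    Valid A F K τ (rd τ p G z k) := by
  refine ⟨rd_len h.len _ _ _, ?_, ?_, ?_, h.good.step h.len _ _ _⟩
  · rw [Fw_rd h.len]; exact (h.okF.clm _).rel _ _
  · rw [Kw_rd h.len]; exact (h.okK.rel _ _).clm _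
  · rw [Fw_rd h.len, pc, clm_eq hG.1.1 hG.1.2 hG.2.1]
    exact hG.2.2.rel hG.1.2 _ _

lemma res_eq {f : ℕ → M} {L : ℕ → List M} (h0 : L 0 = [])
    (h : ∀ r, L (r+1) = f (4*r+3) :: f (4*r+2) :: f (4*r+1) :: f (4*r) :: L r) (r : ℕ) : PiNat.res f (4*r) = L r := by
  induction r with
  | zero => rw [h0]; rfl
  | succ r ih =>
    rw [h, ← ih]
    rfl

lemma valid_nil (hF : OK F) (hK : OK K) (hp : PS F)
    (hτ : ∀ f : ℕ → M, (∀ n, n % 2 = 1 → f n = τ (PiNat.res f n)) → IIok A F K f) : Valid A F K τ [] := by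
  refine ⟨rfl, hF, hK, hp, ?_⟩
  intro L h0 hL
  choose G z k hL using hL
  obtain ⟨f, hf⟩ := weave (fun r => ((G r, (z0, 0)) : M)) (fun r => τ (l1 (L r) (G r))) (fun r => (∅, (z r, k r)))
    (fun r => τ (l2 τ (L r) (G r) (z r) (k r)))
  have hres : ∀ r, PiNat.res f (4*r) = L r := res_eq h0 fun r => by
    rw [(hf r).1, (hf r).2.1, (hf r).2.2.1, (hf r).2.2.2, hL]; rfl
  have hfol : ∀ n, n % 2 = 1 → f n = τ (PiNat.res f n) := by
    intro n hn
    obtain ⟨r, hr⟩ : ∃ r, n = 4*r+1 ∨ n = 4*r+3 := ⟨n/4, by omega⟩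
    rcases hr with rfl | rfl
    · rw [(hf r).2.1, PiNat.res_succ, (hf r).1, hres]
    · rw [(hf r).2.2.2, PiNat.res_succ, PiNat.res_succ, PiNat.res_succ, (hf r).1, (hf r).2.1, (hf r).2.2.1, hres]; rfl
  obtain ⟨h1, h2⟩ := hτ f hfol
  have eF : ∀ r, Fw F K (L r) = Fs F K f (4*r) := fun r => by rw [← hres]
  have eK : ∀ r, Kw F K (L r) = Ks F K f (4*r) := fun r => by rw [← hres]
  refine ⟨fun x y hx hy => h1 x y (fun n => ?_) (fun n => ?_), fun ⟨r, hr⟩ => ?_⟩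
  · have := hx n; rw [eF] at this; exact Fs_anti f (by omega) this
  · have := hy n; rw [eK] at this; exact Ks_anti f (by omega) this
  · rw [eK] at hr
    obtain ⟨n, hn⟩ := h2 ⟨_, hr⟩
    exact ⟨n, by rw [eF]; exact hn.anti (Fs_anti f (by omega))⟩

/-- label fact -/
lemma Valid.label {p : List M} (h : Valid A F K τ p) (hp : Perf (Fw F K p)) : Perf (Kw F K p) := by
  intro z hz k
  by_contra hcon
  push Not at hcon
  let L : ℕ → List M := fun n => Nat.rec p (fun r l => rd τ l (Fw F K l) z k) n
  have hL : ∀ r, L (r+1) = rd τ (L r) (Fw F K (L r)) z k := fun r => rfl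
  have hv : ∀ r, Valid A F K τ (L r) ∧ Perf (Fw F K (L r)) := by
    intro r
    induction r with
    | zero => exact ⟨h, hp⟩
    | succ r ih =>
      rw [hL]
      refine ⟨ih.1.step ⟨ih.1.okF, subset_rfl, ih.1.ps⟩ _, ?_⟩
      rw [Fw_rd ih.1.len, pc, clm_self]
      exact ih.2.inter _ _
  obtain ⟨_, h2⟩ := h.good L rfl (fun r => ⟨_, _, _, hL r⟩)
  obtain ⟨r, hr⟩ := h2 ⟨1, by
    show (Kw F K (rd τ p (Fw F K p) z k)).Subsingleton
    have e1 := (rd_sub (F := F) (K := K) (τ := τ) h.len (Fw F K p) z k).2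
    have e2 := Kw_rd_sub (F := F) (K := K) (τ := τ) h.len (Fw F K p) hz k
    intro x hx y hy
    rw [hcon x (e1 hx) (e2 hx), hcon y (e1 hy) (e2 hy)]⟩
  exact (hv r).2.not_sub (hv r).1.okF.2 hr

lemma countable_cover {p : List M} (h : Valid A F K τ p) :
    ∃ g : ℕ → Set C, (∀ i, Adm F K p (g i)) ∧ Fw F K p ⊆ ⋃ i, pc F K τ p (g i) := by
  let Cov : Set C → Prop := fun S => ∃ 𝒢 : Set (Set C), 𝒢.Countable ∧ (∀ G ∈ 𝒢, Adm F K p G) ∧ S ⊆ ⋃ G ∈ 𝒢, pc F K τ p G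
  suffices hs : Cov (Fw F K p) by
    obtain ⟨𝒢, h1, h2, h3⟩ := hs
    have hne : 𝒢.Nonempty := by
      obtain ⟨x, hx⟩ := h.okF.2
      obtain ⟨G, hG, _⟩ := Set.mem_iUnion₂.1 (h3 hx)
      exact ⟨G, hG⟩
    obtain ⟨g, rfl⟩ := h1.exists_eq_range hne
    exact ⟨g, fun i => h2 _ ⟨i, rfl⟩, by simpa using h3⟩
  let I := {t : C × ℕ // Cov (Fw F K p ∩ cyl t.1 t.2)}
  obtain ⟨T, hTc, hT⟩ := TopologicalSpace.isOpen_iUnion_countable (fun t : I => cyl t.1.1 t.1.2) (fun t => (cyl_clopen _ _).2)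
  set O := ⋃ t : I, cyl t.1.1 t.1.2 with hO
  have hOo : IsOpen O := isOpen_iUnion fun t => (cyl_clopen _ _).2
  have hcO : Cov (Fw F K p ∩ O) := by
    choose 𝒢 h1 h2 h3 using fun t : I => t.2
    refine ⟨⋃ t ∈ T, 𝒢 t, hTc.biUnion fun t _ => h1 t, ?_, ?_⟩
    · intro G hG
      obtain ⟨t, _, hG⟩ := Set.mem_iUnion₂.1 hG
      exact h2 t G hG
    · rintro x ⟨hx, hxO⟩
      rw [← hT] at hxO
      obtain ⟨t, ht, hxt⟩ := Set.mem_iUnion₂.1 hxO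
      obtain ⟨G, hG, hxG⟩ := Set.mem_iUnion₂.1 (h3 t ⟨hx, hxt⟩)
      exact Set.mem_iUnion₂.2 ⟨G, Set.mem_iUnion₂.2 ⟨t, ht, hG⟩, hxG⟩
  by_cases hsub : Fw F K p ⊆ O
  · have e : Fw F K p ∩ O = Fw F K p := Set.inter_eq_left.2 hsub
    rwa [e] at hcO
  exfalso
  set G0 := Fw F K p \ O with hG0
  have hG0ok : OK G0 := ⟨h.okF.1.sdiff hOo, Set.not_subset.1 hsub⟩
  -- common step
  have key : ∀ (G : Set C) (x : C) (n : ℕ), Adm F K p G → x ∈ G0 → G0 ∩ cyl x n ⊆ pc F K τ p G → False := by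
    intro G x n hG hx hsub
    apply hx.2
    refine Set.mem_iUnion.2 ⟨⟨(x, n), ?_⟩, self_mem_cyl _ _⟩
    obtain ⟨𝒢, h1, h2, h3⟩ := hcO
    refine ⟨insert G 𝒢, h1.insert _, ?_, ?_⟩
    · intro G' hG'
      rcases hG' with rfl | hG'
      · exact hG
      · exact h2 _ hG'
    · rintro y ⟨hy, hyx⟩
      by_cases hyO : y ∈ O
      · obtain ⟨G', hG', hyG⟩ := Set.mem_iUnion₂.1 (h3 ⟨hy, hyO⟩)
        exact Set.mem_iUnion₂.2 ⟨G', Or.inr hG', hyG⟩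
      · exact Set.mem_iUnion₂.2 ⟨G, Or.inl rfl, hsub ⟨⟨hy, hyO⟩, hyx⟩⟩
  by_cases hperf : Perf G0
  · have hadm : Adm F K p G0 := ⟨hG0ok, Set.sdiff_subset, Or.inl hperf⟩
    set t := (τ (l1 p G0)).2
    refine key G0 (pick G0 t.1) (max t.2 (p.length+1)) hadm (pick_mem hG0ok.2 _) ?_
    rw [pc, clm_eq hG0ok.1 hG0ok.2 hadm.2.1]
    exact subset_rfl
  · unfold Perf at hperf
    push Not at hperf
    obtain ⟨x, hx, n, hn⟩ := hperf
    have hadm : Adm F K p {x} := ⟨⟨isClosed_singleton, x, rfl⟩, by rintro _ rfl; exact hx.1, Or.inr ⟨x, rfl⟩⟩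
    refine key {x} x n hadm hx ?_
    rw [pc, clm_eq hadm.1.1 hadm.1.2 hadm.2.1]
    rintro y ⟨hy, hyx⟩
    rw [hn y hy hyx]
    refine ⟨rfl, ?_⟩
    have := pick_mem (S := {x}) ⟨x, rfl⟩ (τ (l1 p {x})).2.1
    rw [Set.mem_singleton_iff.1 this]; exact self_mem_cyl _ _

end II
end TG

namespace TG

def cylL (σ : List Bool) : Set C := {x | PiNat.res x σ.length = σ}

lemma cylL_res (x : C) (n : ℕ) : cylL (PiNat.res x n) = cyl x n := by
  unfold cyl
  rw [PiNat.cylinder_eq_res]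
  unfold cylL
  rw [PiNat.res_length]
lemma cylL_cons_sub (b : Bool) (σ : List Bool) : cylL (b :: σ) ⊆ cylL σ := by
  intro x hx
  have h : PiNat.res x (σ.length+1) = b :: σ := hx
  rw [PiNat.res_succ] at h
  exact (List.cons.inj h).2
lemma cylL_cons_ne (σ : List Bool) {x y : C} (b : Bool) (hx : x ∈ cylL (b :: σ)) (hy : y ∈ cylL ((!b) :: σ)) : x ≠ y := by
  rintro rfl
  have h : PiNat.res x (σ.length+1) = b :: σ := hx
  have h' : PiNat.res x (σ.length+1) = (!b) :: σ := hy
  rw [h] at h'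
  have := (List.cons.inj h').1
  cases b <;> simp at this
lemma mem_cylL_cons {σ : List Bool} {x : C} (hx : x ∈ cylL σ) : ∃ b, x ∈ cylL (b :: σ) := by
  refine ⟨x σ.length, ?_⟩
  show PiNat.res x (σ.length+1) = _
  rw [PiNat.res_succ]
  exact congrArg _ hx

lemma suffix_dropWhile {α : Type} {p : α → Bool} {v : α} {l c : List α} (h : (v :: l) <:+ c) (hv : p v = false) :
    (v :: l) <:+ c.dropWhile p := by
  obtain ⟨a, rfl⟩ := h
  induction a with
  | nil => simp [List.dropWhile_cons, hv]
  | cons x a ih =>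
    simp only [List.cons_append, List.dropWhile_cons]
    split_ifs
    · exact ih
    · exact ⟨x :: a, by simp⟩

section tree
variable {A F K : Set C} {τ : List M → M}

variable (F K τ) in
inductive Ch : List (List M) → Prop
  | base : Ch [[]]
  | step (v : List M) (rest : List (List M)) (G : Set C) (z : C) (k : ℕ) : Ch (v :: rest) → Adm F K v G → z ∈ Kw F K v →
      Ch (rd τ v G z k :: v :: rest)

lemma Ch.valid (hv : Valid A F K τ []) {c : List (List M)} (h : Ch F K τ c) : ∀ v ∈ c, Valid A F K τ v := by
  induction h with
  | base => intro v hv'; rw [List.mem_singleton.1 hv']; exact hv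
  | step v rest G z k _ hG hz ih =>
    intro u hu
    rcases List.mem_cons.1 hu with rfl | hu
    · exact (ih v (List.mem_cons_self)).step hG _
    · exact ih u hu

lemma Ch.ne {c : List (List M)} (h : Ch F K τ c) : c ≠ [] := by
  cases h <;> simp

lemma Ch.tail {u v : List M} {rest : List (List M)} (h : Ch F K τ (u :: v :: rest)) :
    Ch F K τ (v :: rest) ∧ ∃ G z k, u = rd τ v G z k := by
  generalize hc : u :: v :: rest = c at h
  cases h with
  | base => simp at hc
  | step v' rest' G z k h1 h2 h3 =>
    injection hc with e1 e2
    injection e2 with e2 e3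
    subst e1 e2 e3
    exact ⟨h1, G, z, k, rfl⟩

lemma Ch.suffix {c c' : List (List M)} (h : Ch F K τ c) (hs : c' <:+ c) (hne : c' ≠ []) : Ch F K τ c' := by
  induction h with
  | base =>
    rcases List.suffix_cons_iff.1 hs with rfl | hs
    · exact Ch.base
    · exact absurd (List.suffix_nil.1 hs) hne
  | step v rest G z k h1 hG hz ih =>
    rcases List.suffix_cons_iff.1 hs with rfl | hs
    · exact Ch.step v rest G z k h1 hG hz
    · exact ih hs

lemma Ch.root {c : List (List M)} (h : Ch F K τ c) : [[]] <:+ c := by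
  induction h with
  | base => exact List.suffix_rfl
  | step v rest G z k h1 hG hz ih => exact ih.trans (List.suffix_cons _ _)

lemma Ch.sub (hv : Valid A F K τ []) {c : List (List M)} (h : Ch F K τ c) : ∀ v rest, c = v :: rest → ∀ u ∈ c, Fw F K v ⊆ Fw F K u ∧ Kw F K v ⊆ Kw F K u := by
  induction h with
  | base =>
    intro v rest e u hu
    rw [e] at hu
    injection e with e1 e2
    subst e1 e2
    rw [List.mem_singleton.1 hu]; exact ⟨subset_rfl, subset_rfl⟩
  | step v rest G z k h1 hG hz ih =>
    intro v' rest' e u hu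
    injection e with e1 e2
    subst e1 e2
    rcases List.mem_cons.1 hu with rfl | hu
    · exact ⟨subset_rfl, subset_rfl⟩
    · have := ih v rest rfl u hu
      have h2 := rd_sub (F := F) (K := K) (τ := τ) ((h1.valid hv v List.mem_cons_self).len) G z k
      exact ⟨h2.1.trans this.1, h2.2.trans this.2⟩

variable (F K) in
open Classical in
noncomputable def drp (σ : List Bool) (c : List (List M)) : List (List M) :=
  c.dropWhile (fun v => decide (¬ (Fw F K v ∩ cylL σ).Nonempty))

lemma drp_suffix (σ : List Bool) (c : List (List M)) : drp F K σ c <:+ c := List.dropWhile_suffix _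

lemma suffix_drp {σ : List Bool} {c l : List (List M)} {v : List M} (h : (v :: l) <:+ c) (hv : (Fw F K v ∩ cylL σ).Nonempty) :
    (v :: l) <:+ drp F K σ c := suffix_dropWhile h (by simpa using hv)

open Classical in
lemma drp_spec {σ : List Bool} {c : List (List M)} (h : Ch F K τ c) (hσ : (F ∩ cylL σ).Nonempty) :
    ∃ v rest, drp F K σ c = v :: rest ∧ (Fw F K v ∩ cylL σ).Nonempty ∧ Ch F K τ (v :: rest) ∧ (v :: rest) <:+ c := by
  have hne : drp F K σ c ≠ [] := by
    intro e
    have := suffix_drp (F := F) (K := K) (σ := σ) h.root hσ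
    rw [e] at this
    simp at this
  obtain ⟨v, rest, e⟩ := List.exists_cons_of_ne_nil hne
  refine ⟨v, rest, e, ?_, h.suffix (e ▸ drp_suffix _ _) (by simp), e ▸ drp_suffix _ _⟩
  have h1 := List.head_dropWhile_not (p := fun v => decide (¬ (Fw F K v ∩ cylL σ).Nonempty)) (l := c) (w := hne)
  have h2 : (drp F K σ c).head hne = v := by simp [e]
  have h3 : (List.dropWhile (fun v => decide (¬ (Fw F K v ∩ cylL σ).Nonempty)) c).head hne = v := h2
  rw [h3] at h1
  simpa using h1

variable (F K τ) in
def Inv (σ : List Bool) (s : List (List M) × (C × ℕ)) : Prop :=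
  Ch F K τ s.1 ∧ ∃ v rest, s.1 = v :: rest ∧ (Fw F K v ∩ cylL σ).Nonempty ∧ s.2.1 ∈ Kw F K v

lemma split_t (hv : Valid A F K τ []) (σ : List Bool) (s : List (List M) × (C × ℕ)) :
    ∃ t : Bool → C × ℕ, Inv F K τ σ s →
      (∀ b v rest, drp F K (b :: σ) s.1 = v :: rest → (t b).1 ∈ Kw F K v ∧ cyl (t b).1 (t b).2 ⊆ cyl s.2.1 s.2.2 ∧
        σ.length + 1 ≤ (t b).2) ∧
      ((∀ b, (F ∩ cylL (b :: σ)).Nonempty) → Disjoint (cyl (t false).1 (t false).2) (cyl (t true).1 (t true).2)) := by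
  obtain ⟨c, y, k⟩ := s
  have memK : Inv F K τ σ (c, (y, k)) → ∀ b v rest, drp F K (b :: σ) c = v :: rest → y ∈ Kw F K v := by
    rintro ⟨h1, v', rest', e, _, hy⟩ b v rest hd
    refine (h1.sub hv v' rest' e v ?_).2 hy
    have : (v :: rest) <:+ c := hd ▸ drp_suffix _ _
    exact this.subset List.mem_cons_self
  by_cases hex : ∃ b v rest, drp F K (b :: σ) c = v :: rest ∧ ∃ y' ∈ Kw F K v, y' ∈ cyl y k ∧ y' ≠ y
  · obtain ⟨b, v, rest, e, y', hy', hyc, hne⟩ := hex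
    obtain ⟨i, hi⟩ := Function.ne_iff.1 hne
    set N := max (max k (σ.length+1)) (i+1) with hN
    have hNk : k ≤ N := by omega
    have hNi : i < N := by omega
    have hNs : σ.length + 1 ≤ N := by omega
    refine ⟨fun b' => if b' = b then (y', N) else (y, N), fun hI => ⟨?_, fun _ => ?_⟩⟩
    · intro b' v1 rest1 e1
      by_cases hb : b' = b
      · subst hb
        rw [e] at e1
        injection e1 with e2 e3
        subst e2 e3
        simp only [if_true]
        refine ⟨hy', ?_, hNs⟩
        rw [← cyl_eq hyc]; exact cyl_anti _ hNk
      · simp only [if_neg hb]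
        exact ⟨memK hI _ _ _ e1, cyl_anti _ hNk, hNs⟩
    · have hd : Disjoint (cyl y' N) (cyl y N) := by
        rw [Set.disjoint_left]
        intro x h1 h2
        exact hi ((h1 i hNi).symm.trans (h2 i hNi))
      cases b
      · simpa using hd
      · simpa using hd.symm
  · push Not at hex
    refine ⟨fun b => (y, max k (σ.length+1)), fun hI => ⟨?_, fun hb => ?_⟩⟩
    · intro b v rest e
      exact ⟨memK hI b v rest e, cyl_anti _ (le_max_left _ _), le_max_right _ _⟩
    · exfalso
      obtain ⟨v0, r0, e0, n0, c0, s0⟩ := drp_spec hI.1 (hb false)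
      obtain ⟨v1, r1, e1, n1, c1, s1⟩ := drp_spec hI.1 (hb true)
      have main : ∀ b v r v' r', drp F K (b :: σ) c = v :: r → (v :: r) <:+ (v' :: r') → Ch F K τ (v' :: r') → Ch F K τ (v :: r) →
          (Fw F K v ∩ cylL (b :: σ)).Nonempty → (Fw F K v' ∩ cylL ((!b) :: σ)).Nonempty → False := by
        rintro b v r v' r' e hs c' c'' ⟨x, hx, hxb⟩ ⟨x', hx', hxb'⟩
        have hsub := (c'.sub hv v' r' rfl v (hs.subset List.mem_cons_self)).1
        have hval := c''.valid hv v List.mem_cons_self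
        have hp := hval.ps.perf hx (hsub hx') (cylL_cons_ne σ b hxb hxb')
        obtain ⟨y', h1, h2, h3⟩ := hval.label hp y (memK hI b v r e) k
        exact h3 (hex b v r e y' h1 h2)
      rcases List.suffix_or_suffix_of_suffix s0 s1 with h | h
      · exact main false _ _ _ _ e0 h c1 c0 n0 n1
      · exact main true _ _ _ _ e1 h c0 c1 n1 n0

/-- D4: if II wins and F is perfect then F embeds in K. -/
theorem emb_of_IIwin (hF : OK F) (hK : OK K) (hp : Perf F) (hw : IIwin A F K) : Emb A F K := by
  classical
  obtain ⟨τ, hτ⟩ := hw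
  have hv : Valid A F K τ [] := valid_nil hF hK (Or.inl hp) hτ
  have hg : ∀ v, ∃ g : ℕ → Set C, Valid A F K τ v → (∀ i, Adm F K v (g i)) ∧ Fw F K v ⊆ ⋃ i, pc F K τ v (g i) := by
    intro v
    by_cases h : Valid A F K τ v
    · obtain ⟨g, h1⟩ := countable_cover h
      exact ⟨g, fun _ => h1⟩
    · exact ⟨fun _ => ∅, fun h' => absurd h' h⟩
  choose g hg using hg
  choose T hT using split_t (K := K) hv
  let idx : List M → List Bool → ℕ := fun v σ => sInf {i | (pc F K τ v (g v i) ∩ cylL σ).Nonempty}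
  let nw : List Bool → List (List M) × (C × ℕ) → Bool → List M → List M := fun σ s b v =>
    rd τ v (g v (idx v (b :: σ))) (T σ s b).1 (T σ s b).2
  let nxt : List Bool → List (List M) × (C × ℕ) → Bool → List (List M) × (C × ℕ) := fun σ s b =>
    match drp F K (b :: σ) s.1 with
    | [] => s
    | v :: rest => (nw σ s b v :: v :: rest, (pick (Kw F K (nw σ s b v)) z0, (T σ s b).2))
  let St : List Bool → List (List M) × (C × ℕ) := fun σ => List.rec ([[]], (pick K z0, 0)) (fun b σ s => nxt σ s b) σ
  have St_cons : ∀ b σ, St (b :: σ) = nxt σ (St σ) b := fun b σ => rfl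
  have nxt_eq : ∀ σ s b v rest, drp F K (b :: σ) s.1 = v :: rest →
      nxt σ s b = (nw σ s b v :: v :: rest, (pick (Kw F K (nw σ s b v)) z0, (T σ s b).2)) := by
    intro σ s b v rest e
    simp only [nxt, e]
  -- facts about one step
  have stepf : ∀ σ b, Inv F K τ σ (St σ) → (F ∩ cylL (b :: σ)).Nonempty → Inv F K τ (b :: σ) (St (b :: σ)) ∧
      cyl (St (b :: σ)).2.1 (St (b :: σ)).2.2 = cyl (T σ (St σ) b).1 (T σ (St σ) b).2 ∧
      cyl (T σ (St σ) b).1 (T σ (St σ) b).2 ⊆ cyl (St σ).2.1 (St σ).2.2 ∧ σ.length + 1 ≤ (St (b :: σ)).2.2 := by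
    intro σ b hI hb
    obtain ⟨v, rest, e, hn, hc, hs⟩ := drp_spec hI.1 hb
    obtain ⟨t1, t2, t3⟩ := (hT σ (St σ) hI).1 b v rest e
    have hval := hc.valid hv v List.mem_cons_self
    obtain ⟨ga, gc⟩ := hg v hval
    rw [St_cons, nxt_eq _ _ _ _ _ e]
    have hch : Ch F K τ (nw σ (St σ) b v :: v :: rest) := Ch.step v rest _ _ _ hc (ga _) t1
    have hval' := hch.valid hv _ List.mem_cons_self
    have hpk := pick_mem hval'.okK.2 z0
    refine ⟨⟨hch, _, _, rfl, ?_, hpk⟩, ?_, t2, t3⟩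
    · have e1 : Fw F K (nw σ (St σ) b v) = pc F K τ v (g v (idx v (b :: σ))) := Fw_rd hval.len _ _ _
      rw [e1]
      have : idx v (b :: σ) ∈ {i | (pc F K τ v (g v i) ∩ cylL (b :: σ)).Nonempty} := by
        apply Nat.sInf_mem
        obtain ⟨x, hx, hxb⟩ := hn
        obtain ⟨i, hi⟩ := Set.mem_iUnion.1 (gc hx)
        exact ⟨i, x, hi, hxb⟩
      exact this
    · exact cyl_eq (Kw_rd_sub hval.len _ t1 _ hpk)
  have inv : ∀ σ, (F ∩ cylL σ).Nonempty → Inv F K τ σ (St σ) := by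
    intro σ
    induction σ with
    | nil => intro h; exact ⟨Ch.base, _, _, rfl, h, pick_mem hK.2 _⟩
    | cons b σ ih =>
      intro h
      exact (stepf σ b (ih (h.mono fun x hx => ⟨hx.1, cylL_cons_sub _ _ hx.2⟩)) h).1
  -- along branches
  let s : C → ℕ → List (List M) × (C × ℕ) := fun x n => St (PiNat.res x n)
  have ne : ∀ x ∈ F, ∀ n, (F ∩ cylL (PiNat.res x n)).Nonempty := fun x hx n =>
    ⟨x, hx, by rw [cylL_res]; exact self_mem_cyl _ _⟩
  let t : C → ℕ → Set C := fun x n => cyl (s x n).2.1 (s x n).2.2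
  have tsub : ∀ x ∈ F, ∀ n, t x (n+1) ⊆ t x n ∧ n + 1 ≤ (s x (n+1)).2.2 := by
    intro x hx n
    have h := stepf (PiNat.res x n) (x n) (inv _ (ne x hx n)) (by have := ne x hx (n+1); rwa [PiNat.res_succ] at this)
    rw [PiNat.res_length] at h
    exact ⟨h.2.1.subset.trans h.2.2.1, h.2.2.2⟩
  have tok : ∀ x n, OK (t x n) := fun x n => ⟨(cyl_clopen _ _).1, _, self_mem_cyl _ _⟩
  have hex : ∀ x, ∃ y, x ∈ F → ∀ n, y ∈ t x n := by
    intro x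
    by_cases hx : x ∈ F
    · obtain ⟨y, hy⟩ := inter_ne (antitone_nat_of_succ_le fun n => (tsub x hx n).1) (tok x)
      exact ⟨y, fun _ => hy⟩
    · exact ⟨x, fun h => absurd h hx⟩
  choose h hh using hex
  have tclose : ∀ x ∈ F, ∀ n, ∀ y ∈ t x (n+1), y ∈ cyl (h x) (n+1) := by
    intro x hx n y hy
    have := cyl_eq (hh x hx (n+1))
    have hy' : y ∈ cyl (h x) (s x (n+1)).2.2 := by rw [this]; exact hy
    exact cyl_anti _ (tsub x hx n).2 hy'
  have tcongr : ∀ x y n, y ∈ cyl x n → t x n = t y n := by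
    intro x y n hy
    have : PiNat.res y n = PiNat.res x n := by unfold cyl at hy; rw [PiNat.cylinder_eq_res] at hy; exact hy
    simp only [t, s, this]
  refine ⟨h, ?_, ?_, ?_⟩
  · -- continuity
    rw [continuousOn_pi]
    intro i x hx
    rw [ContinuousWithinAt, nhds_discrete, Filter.tendsto_pure]
    have : cyl x (i+1) ∈ nhds x := (cyl_clopen _ _).2.mem_nhds (self_mem_cyl _ _)
    filter_upwards [self_mem_nhdsWithin, mem_nhdsWithin_of_mem_nhds this] with y hyF hy
    have h1 := hh y hyF (i+1)
    rw [← tcongr x y (i+1) hy] at h1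
    exact tclose x hx i _ h1 i (by omega)
  · -- injectivity
    intro x hx y hy hxy
    by_contra hne
    have hd : ∃ n, x n ≠ y n := Function.ne_iff.1 hne
    set n := Nat.find hd with hn
    have hlt : ∀ i < n, y i = x i := fun i hi => by
      have := Nat.find_min hd hi
      push Not at this; exact this.symm
    have hdn : x n ≠ y n := Nat.find_spec hd
    have hres : PiNat.res y n = PiNat.res x n := by
      have : y ∈ cyl x n := hlt
      unfold cyl at this; rw [PiNat.cylinder_eq_res] at this; exact this
    have hbx := ne x hx (n+1)
    have hby := ne y hy (n+1)
    have mx := hh x hx (n+1)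
    have my := hh y hy (n+1)
    simp only [t, s] at mx my
    rw [PiNat.res_succ] at hbx hby mx my
    rw [hres] at hby my
    have hI := inv _ (ne x hx n)
    rw [(stepf _ _ hI hbx).2.1] at mx
    rw [(stepf _ _ hI hby).2.1] at my
    rw [← hxy] at my
    have hall : ∀ b, (F ∩ cylL (b :: PiNat.res x n)).Nonempty := by
      intro b
      by_cases hb : b = x n
      · rw [hb]; exact hbx
      · have : b = y n := by revert hb hdn; cases b <;> cases x n <;> cases y n <;> simp
        rw [this]; exact hby
    have hdis := Set.disjoint_left.1 ((hT _ _ hI).2 hall)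
    revert hdn mx my
    cases x n <;> cases y n <;> intro hdn mx my
    · exact hdn rfl
    · exact hdis mx my
    · exact hdis my mx
    · exact hdn rfl
  -- stabilisation
  have stab : ∀ x ∈ F, ∀ v l, x ∈ Fw F K v → (∃ N, ∀ n ≥ N, (v :: l) <:+ (s x n).1) →
      ∃ u, x ∈ Fw F K u ∧ ∃ N, ∀ n ≥ N, (u :: v :: l) <:+ (s x n).1 := by
    rintro x hx v l hxv ⟨N, hN⟩
    have hmem : ∀ n, x ∈ cylL (PiNat.res x n) := fun n => by rw [cylL_res]; exact self_mem_cyl _ _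
    -- chain at stage n+1
    have succ : ∀ n, ∃ u rest, (s x (n+1)).1 = nw (PiNat.res x n) (s x n) (x n) u :: u :: rest ∧
        drp F K (PiNat.res x (n+1)) (s x n).1 = u :: rest := by
      intro n
      obtain ⟨u, rest, e, _⟩ := drp_spec (inv _ (ne x hx n)).1 (ne x hx (n+1))
      refine ⟨u, rest, ?_, e⟩
      have e' := e
      rw [PiNat.res_succ] at e'
      have := nxt_eq _ _ _ _ _ e'
      exact congrArg Prod.fst this
    have persist : ∀ u l' n, x ∈ Fw F K u → (u :: l') <:+ (s x n).1 → (u :: l') <:+ (s x (n+1)).1 := by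
      intro u l' n hxu hs
      obtain ⟨u', rest, e1, e2⟩ := succ n
      have := suffix_drp (F := F) (K := K) hs ⟨x, hxu, hmem (n+1)⟩
      rw [e2] at this
      rw [e1]; exact this.trans (List.suffix_cons _ _)
    have persist' : ∀ u l' n, x ∈ Fw F K u → (u :: l') <:+ (s x n).1 → ∀ m ≥ n, (u :: l') <:+ (s x m).1 := by
      intro u l' n hxu hs m hm
      induction m, hm using Nat.le_induction with
      | base => exact hs
      | succ m _ ih => exact persist _ _ _ hxu ih
    have hval : Valid A F K τ v := (inv _ (ne x hx N)).1.valid hv v ((hN N le_rfl).subset List.mem_cons_self)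
    obtain ⟨ga, gc⟩ := hg v hval
    have hi0 : ∃ i, x ∈ pc F K τ v (g v i) := Set.mem_iUnion.1 (gc hxv)
    set i0 := Nat.find hi0 with hi0d
    have hx0 : x ∈ pc F K τ v (g v i0) := Nat.find_spec hi0
    -- eventually idx = i0
    have hev : ∃ N1, ∀ n ≥ N1, idx v (PiNat.res x n) = i0 := by
      have : ∀ i, ∃ Ni, i < i0 → ∀ n ≥ Ni, ¬ (pc F K τ v (g v i) ∩ cyl x n).Nonempty := by
        intro i
        by_cases hi : i < i0
        · have hxi := Nat.find_min hi0 hi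
          have hcl : IsClosed (pc F K τ v (g v i)) := ((hval.okF.clm _).rel _ _).1
          obtain ⟨n, hn⟩ := exists_cyl_subset hcl.isOpen_compl hxi
          refine ⟨n, fun _ m hm => ?_⟩
          rintro ⟨y, hy1, hy2⟩
          exact hn (cyl_anti _ hm hy2) hy1
        · exact ⟨0, fun h => absurd h hi⟩
      choose Ni hNi using this
      refine ⟨(Finset.range i0).sup Ni, fun n hn => ?_⟩
      apply le_antisymm
      · exact Nat.sInf_le ⟨x, hx0, hmem n⟩
      · refine le_csInf ⟨i0, x, hx0, hmem n⟩ ?_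
        intro i hi
        by_contra hlt
        push Not at hlt
        refine hNi i hlt n (le_trans (Finset.le_sup (Finset.mem_range.2 hlt)) hn) ?_
        rw [← cylL_res]; exact hi
    obtain ⟨N1, hN1⟩ := hev
    by_cases hret : ∃ n ≥ max N N1, drp F K (PiNat.res x (n+1)) (s x n).1 = v :: l
    · obtain ⟨n, hn, e⟩ := hret
      obtain ⟨u', rest, e1, e2⟩ := succ n
      rw [e] at e2
      injection e2 with e3 e4
      subst e3 e4
      have hxu : x ∈ Fw F K (nw (PiNat.res x n) (s x n) (x n) v) := by
        have e5 : Fw F K (nw (PiNat.res x n) (s x n) (x n) v) = pc F K τ v (g v (idx v (x n :: PiNat.res x n))) :=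
          Fw_rd hval.len _ _ _
        have e6 := hN1 (n+1) (by omega)
        rw [PiNat.res_succ] at e6
        rw [e5, e6]; exact hx0
      refine ⟨_, hxu, n+1, persist' _ _ _ hxu ?_⟩
      rw [e1]
    · push Not at hret
      have hu : ∀ n ≥ max N N1, ∃ u, (u :: v :: l) <:+ drp F K (PiNat.res x (n+1)) (s x n).1 := by
        intro n hn
        obtain ⟨a, ha⟩ := suffix_drp (F := F) (K := K) (hN n (by omega)) ⟨x, hxv, hmem (n+1)⟩
        rcases List.eq_nil_or_concat a with rfl | ⟨a', u, rfl⟩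
        · exact absurd ha.symm (hret n hn)
        · exact ⟨u, a', by rw [← ha]; simp⟩
      choose! u hu using hu
      have uniq : ∀ (c : List (List M)) u u', (u :: v :: l) <:+ c → (u' :: v :: l) <:+ c → u = u' := by
        intro c u u' h1 h2
        have h3 := List.suffix_of_suffix_length_le h1 h2 (by simp)
        have := h3.eq_of_length (by simp)
        exact (List.cons.inj this).1
      set N2 := max N N1 with hN2
      have hcn : ∀ n ≥ N2, (u n :: v :: l) <:+ (s x n).1 := fun n hn => (hu n hn).trans (drp_suffix _ _)
      have hcn' : ∀ n ≥ N2, (u n :: v :: l) <:+ (s x (n+1)).1 := fun n hn => by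
        obtain ⟨u', rest, e1, e2⟩ := succ n
        have := hu n hn
        rw [e2] at this
        rw [e1]; exact this.trans (List.suffix_cons _ _)
      have hconst : ∀ n ≥ N2, u n = u N2 := by
        intro n hn
        induction n, hn using Nat.le_induction with
        | base => rfl
        | succ n hn ih =>
          rw [← ih]
          exact uniq _ _ _ (hcn (n+1) (by omega)) (hcn' n hn)
      refine ⟨u N2, ?_, N2, fun n hn => by rw [← hconst n hn]; exact hcn n hn⟩
      -- x is in the closed set Fw (u N2)
      have hvu : Valid A F K τ (u N2) := (inv _ (ne x hx N2)).1.valid hv _ ((hcn N2 le_rfl).subset List.mem_cons_self)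
      by_contra hxu
      obtain ⟨n, hn⟩ := exists_cyl_subset hvu.okF.1.isOpen_compl hxu
      set m := max n N2 with hm
      have h1 := hu m (by omega)
      rw [hconst m (by omega)] at h1
      obtain ⟨w, rest, e, ⟨y, hy1, hy2⟩, hc, _⟩ := drp_spec (inv _ (ne x hx m)).1 (ne x hx (m+1))
      have h1' := h1
      simp only [s] at h1'
      rw [e] at h1'
      have hy3 := (hc.sub hv w rest rfl (u N2) (h1'.subset List.mem_cons_self)).1 hy1
      rw [cylL_res] at hy2
      exact hn (cyl_anti _ (by omega) hy2) hy3
  have Kmem : ∀ x ∈ F, ∀ v l, (∃ N, ∀ n ≥ N, (v :: l) <:+ (s x n).1) → h x ∈ Kw F K v := by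
    rintro x hx v l ⟨N, hN⟩
    have hvu : Valid A F K τ v := (inv _ (ne x hx N)).1.valid hv _ ((hN N le_rfl).subset List.mem_cons_self)
    by_contra hxu
    obtain ⟨n, hn⟩ := exists_cyl_subset hvu.okK.1.isOpen_compl hxu
    set m := max n N with hm
    obtain ⟨hc, w, rest, e, _, hy⟩ := inv _ (ne x hx (m+1))
    have h1 := hN (m+1) (by omega)
    have hy3 := (hc.sub hv w rest e v (h1.subset List.mem_cons_self)).2 hy
    have : (s x (m+1)).2.1 ∈ cyl (h x) (m+1) := tclose x hx m _ (self_mem_cyl _ _)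
    exact hn (cyl_anti _ (by omega) this) hy3
  have rootst : ∀ x ∈ F, ∃ N, ∀ n ≥ N, [[]] <:+ (s x n).1 := fun x hx => ⟨0, fun n _ => (inv _ (ne x hx n)).1.root⟩
  refine ⟨fun x hx => Kmem x hx [] [] (rootst x hx), fun x hx => ?_⟩
  -- sequence of histories
  let Q := {p : List M × List (List M) // x ∈ Fw F K p.1 ∧ ∃ N, ∀ n ≥ N, (p.1 :: p.2) <:+ (s x n).1}
  have hstep : ∀ q : Q, ∃ q' : Q, ∃ u, q'.1 = (u, q.1.1 :: q.1.2) := by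
    rintro ⟨⟨v, l⟩, h1, h2⟩
    obtain ⟨u, h3, h4⟩ := stab x hx v l h1 h2
    exact ⟨⟨(u, v :: l), h3, h4⟩, u, rfl⟩
  choose nq hnq using hstep
  let q : ℕ → Q := fun n => Nat.rec ⟨([], []), hx, rootst x hx⟩ (fun _ q => nq q) n
  have hq : ∀ n, ∃ u, (q (n+1)).1 = (u, (q n).1.1 :: (q n).1.2) := fun n => hnq (q n)
  have hgood := hv.good (fun n => (q n).1.1) rfl (by
    intro r
    obtain ⟨u, hu⟩ := hq r
    obtain ⟨_, N, hN⟩ := (q (r+1)).2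
    have h1 := hN N le_rfl
    rw [hu] at h1
    have := ((inv _ (ne x hx N)).1.suffix h1 (by simp)).tail.2
    rw [hu]; exact this)
  exact (hgood.1 x (h x) (fun r => (q r).2.1) (fun r => Kmem x hx _ _ (q r).2.2)).symm

end tree
end TG

namespace TG
section I
variable (A : Set C)

abbrev P := (Set C × Set C) × List M

open Classical in
noncomputable def sg (q : Set C × Set C) : List M → M :=
  if h : Iwin A q.1 q.2 then h.choose else fun _ => (∅, (z0, 0))

noncomputable abbrev pF (p : P) : Set C := Fw p.1.1 p.1.2 p.2
noncomputable abbrev pK (p : P) : Set C := Kw p.1.1 p.1.2 p.2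

noncomputable def il2 (p : P) (s : C × ℕ) : List M := (∅, s) :: sg A p.1 p.2 :: p.2
noncomputable def nx (p : P) (s : C × ℕ) (K' : Set C) : P :=
  (p.1, (K', (z0, 0)) :: sg A p.1 (il2 A p s) :: il2 A p s)

noncomputable def cl (p : P) : Set C := clm (pF p) (sg A p.1 p.2).1
noncomputable def rep (p : P) (s : C × ℕ) : Set C := rel (pK p) (p.2.length + 2) (sg A p.1 (il2 A p s)).2

variable {A}

lemma pF_nx {p : P} (hl : p.2.length % 4 = 0) (s : C × ℕ) (K' : Set C) :
    pF (nx A p s K') = rel (cl A p) (p.2.length+1) s := by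
  have h1 : (p.2.length+1) % 4 = 1 := by omega
  have h2 : (p.2.length+1+1) % 4 = 2 := by omega
  have h3 : (p.2.length+1+1+1) % 4 = 3 := by omega
  simp [pF, Fw, nx, il2, stL, stepM, hl, h1, h2, h3, cl]

lemma pK_nx {p : P} (hl : p.2.length % 4 = 0) (s : C × ℕ) (K' : Set C) :
    pK (nx A p s K') = clm (rep A p s) K' := by
  have h1 : (p.2.length+1) % 4 = 1 := by omega
  have h2 : (p.2.length+1+1) % 4 = 2 := by omega
  have h3 : (p.2.length+1+1+1) % 4 = 3 := by omega
  simp [pK, Kw, nx, il2, stL, stepM, hl, h1, h2, h3, rep]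

lemma nx_len (p : P) (s : C × ℕ) (K' : Set C) : (nx A p s K').2.length = p.2.length + 4 := rfl

/-- I's winning strategy, in terms of sequences of positions. -/
lemma I_wins {q : Set C × Set C} (hw : Iwin A q.1 q.2) (L : ℕ → P) (h0 : L 0 = (q, []))
    (hL : ∀ r, ∃ s K', L (r+1) = nx A (L r) s K') {x y : C} (hx : ∀ r, x ∈ pF (L r)) (hy : ∀ r, y ∈ pK (L r)) :
    ¬ ((x ∈ A ↔ y ∈ A) ∧ ((∃ r, (pK (L r)).Subsingleton) → ∃ r, (pF (L r)).Subsingleton)) := by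
  choose s K' hL using hL
  have hσ : ∀ f : ℕ → M, (∀ n, n % 2 = 0 → f n = sg A q (PiNat.res f n)) → ¬ IIok A q.1 q.2 f := by
    have : sg A q = hw.choose := dif_pos hw
    rw [this]; exact hw.choose_spec
  have hq : ∀ r, (L r).1 = q := by
    intro r
    induction r with
    | zero => rw [h0]
    | succ r ih => rw [hL, ← ih]; rfl
  obtain ⟨f, hf⟩ := weave (fun r => sg A q (L r).2) (fun r => (∅, s r)) (fun r => sg A q (il2 A (L r) (s r)))
    (fun r => ((K' r, (z0, 0)) : M))
  have hres : ∀ r, PiNat.res f (4*r) = (L r).2 := res_eq (by rw [h0]) fun r => by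
    rw [(hf r).1, (hf r).2.1, (hf r).2.2.1, (hf r).2.2.2, hL]
    simp only [nx, il2, hq]
  have hfol : ∀ n, n % 2 = 0 → f n = sg A q (PiNat.res f n) := by
    intro n hn
    obtain ⟨r, hr⟩ : ∃ r, n = 4*r ∨ n = 4*r+2 := ⟨n/4, by omega⟩
    rcases hr with rfl | rfl
    · rw [(hf r).1, hres]
    · rw [(hf r).2.2.1, PiNat.res_succ, PiNat.res_succ, (hf r).1, (hf r).2.1, hres, il2, hq]
  have eF : ∀ r, pF (L r) = Fs q.1 q.2 f (4*r) := fun r => by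
    show (stL (L r).1.1 (L r).1.2 (L r).2).1 = (stL q.1 q.2 (PiNat.res f (4*r))).1
    rw [hres, hq]
  have eK : ∀ r, pK (L r) = Ks q.1 q.2 f (4*r) := fun r => by
    show (stL (L r).1.1 (L r).1.2 (L r).2).2 = (stL q.1 q.2 (PiNat.res f (4*r))).2
    rw [hres, hq]
  have hx' : ∀ n, x ∈ Fs q.1 q.2 f n := fun n => by
    have := hx n; rw [eF] at this; exact Fs_anti f (by omega) this
  have hy' : ∀ n, y ∈ Ks q.1 q.2 f n := fun n => by
    have := hy n; rw [eK] at this; exact Ks_anti f (by omega) this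
  rintro ⟨h1, h2⟩
  refine hσ f hfol ⟨?_, ?_⟩
  · intro x' y' h3 h4
    have e1 : x' = x := funext fun i => Fs_bit f i (h3 _) (hx' _)
    have e2 : y' = y := funext fun i => Ks_bit f i (h4 _) (hy' _)
    rw [e1, e2]; exact h1
  · rintro ⟨n, hn⟩
    obtain ⟨r, hr⟩ := h2 ⟨n, by rw [eK]; exact hn.anti (Ks_anti f (by omega))⟩
    rw [eF] at hr
    exact ⟨_, hr⟩

end I

/-- relatively clopen pieces -/
def Pc (S X : Set C) (k0 : ℕ) : Prop := ∃ z ∈ X, ∃ k ≥ k0, S = X ∩ cyl z k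

lemma Pc.sub {S X : Set C} {k : ℕ} (h : Pc S X k) : S ⊆ X := by
  obtain ⟨z, _, k, _, rfl⟩ := h; exact Set.inter_subset_left
lemma Pc.ok {S X : Set C} {k : ℕ} (h : Pc S X k) (hX : OK X) : OK S := by
  obtain ⟨z, hz, k, _, rfl⟩ := h; exact ⟨hX.1.inter (cyl_clopen _ _).1, z, hz, self_mem_cyl _ _⟩
lemma Pc.perf {S X : Set C} {k : ℕ} (h : Pc S X k) (hX : Perf X) : Perf S := by
  obtain ⟨z, hz, k, _, rfl⟩ := h; exact hX.inter _ _
lemma Pc.trans {S X Y : Set C} {k l : ℕ} (h : Pc S X k) (h' : Pc X Y l) : Pc S Y l := by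
  obtain ⟨z, hz, m, hm, rfl⟩ := h'
  obtain ⟨z', hz', m', hm', rfl⟩ := h
  refine ⟨z', hz'.1, max m m', by omega, ?_⟩
  rw [Set.inter_assoc, cyl_inter hz'.2]
lemma Pc.mono {S X : Set C} {k l : ℕ} (h : Pc S X k) (hl : l ≤ k) : Pc S X l := by
  obtain ⟨z, hz, k, hk, rfl⟩ := h; exact ⟨z, hz, k, hl.trans hk, rfl⟩
lemma Pc.small {S X : Set C} {k : ℕ} (h : Pc S X k) {x y : C} (hx : x ∈ S) (hy : y ∈ S) {i : ℕ} (hi : i < k) : x i = y i := by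
  obtain ⟨z, hz, k, hk, rfl⟩ := h
  exact (hx.2 i (by omega)).trans (hy.2 i (by omega)).symm
lemma rel_pc {X : Set C} (h : X.Nonempty) (n : ℕ) (t : C × ℕ) : Pc (rel X n t) X n :=
  ⟨_, pick_mem h _, _, le_max_right _ _, rfl⟩

open Classical in
noncomputable def sel (X S : Set C) (k0 : ℕ) : C × ℕ :=
  if h : ∃ s : C × ℕ, s.1 ∈ X ∧ k0 ≤ s.2 ∧ S = X ∩ cyl s.1 s.2 then h.choose else (z0, 0)

lemma sel_spec {S X : Set C} {k0 : ℕ} (h : Pc S X k0) :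
    (sel X S k0).1 ∈ X ∧ k0 ≤ (sel X S k0).2 ∧ S = X ∩ cyl (sel X S k0).1 (sel X S k0).2 := by
  have h' : ∃ s : C × ℕ, s.1 ∈ X ∧ k0 ≤ s.2 ∧ S = X ∩ cyl s.1 s.2 := by
    obtain ⟨z, hz, k, hk, e⟩ := h; exact ⟨(z, k), hz, hk, e⟩
  have e : sel X S k0 = h'.choose := dif_pos h'
  rw [e]; exact h'.choose_spec

section cascade
variable (A Z : Set C) (shr : Set C → Set C)

/-- stored data at a node: position, relocation, current set -/
structure Rec where
  pos : P
  s : C × ℕ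
  cur : Set C

abbrev Env := List ℕ → Rec

abbrev BB (d : List ℕ) : ℕ := 4 * d.length + 1

noncomputable def npos (env : Env) (c : List ℕ) (Y : Set C) : P :=
  if c.length = 2 then (((env [c.headD 0]).cur, Y), [])
  else nx A (env c.dropLast).pos (env c.dropLast).s Y

noncomputable def EE (env : Env) : ℕ → List ℕ → Set C → Set C
  | 0, d, X => rel X (BB d) (z0, 0)
  | j+1, d, X => rep A (npos A env (j :: d) (EE env j d X))
      (sel (cl A (npos A env (j :: d) (EE env j d X)))
        (EE env j (j :: d) (cl A (npos A env (j :: d) (EE env j d X)))) (BB (j :: d)))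

noncomputable def nd (env : Env) : List ℕ → Set C
  | [] => Z
  | j :: d => if d = [] then (if j = 0 then Z else shr (env [j-1]).cur) else cl A (npos A env (j :: d) (EE A env j d (nd env d)))

noncomputable def mk (env : Env) (c : List ℕ) : Rec where
  pos := npos A env c (EE A env (c.headD 0) c.tail (nd A Z shr env c.tail))
  s := sel (nd A Z shr env c) (EE A env (c.headD 0) c (nd A Z shr env c)) (BB c)
  cur := EE A env (c.headD 0) c (nd A Z shr env c)

noncomputable def env : ℕ → Env
  | 0 => fun _ => ⟨((∅, ∅), []), (z0, 0), ∅⟩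
  | n+1 => fun l => if l.getLastD 0 = n then mk A Z shr (env n) l else env n l

lemma env_eq (n : ℕ) (l : List ℕ) (h : l.getLastD 0 < n) : env A Z shr n l = mk A Z shr (env A Z shr (l.getLastD 0)) l := by
  induction n with
  | zero => omega
  | succ n ih =>
    by_cases e : l.getLastD 0 = n
    · simp only [env, e, if_true]
    · simp only [env, if_neg e]; exact ih (by omega)

/-- global data -/
noncomputable def ev (c : List ℕ) : Env := env A Z shr (c.getLastD 0)
noncomputable def gN (c : List ℕ) : Set C := nd A Z shr (ev A Z shr c) c
noncomputable def gY (d : List ℕ) (j : ℕ) : Set C := EE A (ev A Z shr d) j d (gN A Z shr d)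
noncomputable def gcur (c : List ℕ) : Set C := gY A Z shr c (c.headD 0)
noncomputable def gpos (c : List ℕ) : P := (mk A Z shr (ev A Z shr c) c).pos
noncomputable def gs (c : List ℕ) : C × ℕ := sel (gN A Z shr c) (gcur A Z shr c) (BB c)

lemma env_cur (n : ℕ) (l : List ℕ) (h : l.getLastD 0 < n) : (env A Z shr n l).cur = gcur A Z shr l := by
  rw [env_eq _ _ _ _ _ h]; rfl
lemma env_pos (n : ℕ) (l : List ℕ) (h : l.getLastD 0 < n) : (env A Z shr n l).pos = gpos A Z shr l := by
  rw [env_eq _ _ _ _ _ h]; rfl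
lemma env_s (n : ℕ) (l : List ℕ) (h : l.getLastD 0 < n) : (env A Z shr n l).s = gs A Z shr l := by
  rw [env_eq _ _ _ _ _ h]; rfl

lemma gN_zero : gN A Z shr [0] = Z := by simp [gN, nd]
lemma gN_succ (n : ℕ) : gN A Z shr [n+1] = shr (gcur A Z shr [n]) := by
  rw [← env_cur A Z shr (n+1) [n] (by simp)]
  simp [gN, nd, ev]

lemma ev_cons (j : ℕ) {d : List ℕ} (hd : d ≠ []) : ev A Z shr (j :: d) = ev A Z shr d := by
  unfold ev
  congr 1
  cases d with
  | nil => simp at hd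
  | cons a d => simp [List.getLastD]

lemma gpos_eq (j : ℕ) {d : List ℕ} (hd : d ≠ []) :
    gpos A Z shr (j :: d) = npos A (ev A Z shr d) (j :: d) (gY A Z shr d j) := by
  show npos A (ev A Z shr (j :: d)) (j :: d) (EE A (ev A Z shr (j :: d)) j d (nd A Z shr (ev A Z shr (j :: d)) d)) = _
  rw [ev_cons _ _ _ _ hd]; rfl

lemma gN_cons (j : ℕ) {d : List ℕ} (hd : d ≠ []) : gN A Z shr (j :: d) = cl A (gpos A Z shr (j :: d)) := by
  rw [gpos_eq _ _ _ _ hd]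
  show nd A Z shr (ev A Z shr (j :: d)) (j :: d) = _
  rw [ev_cons _ _ _ _ hd, nd, if_neg hd]; rfl

lemma gY_zero (d : List ℕ) : gY A Z shr d 0 = rel (gN A Z shr d) (BB d) (z0, 0) := rfl

lemma gY_succ (j : ℕ) {d : List ℕ} (hd : d ≠ []) :
    gY A Z shr d (j+1) = rep A (gpos A Z shr (j :: d)) (gs A Z shr (j :: d)) := by
  have e1 : gY A Z shr d (j+1) = rep A (npos A (ev A Z shr d) (j :: d) (gY A Z shr d j))
      (sel (cl A (npos A (ev A Z shr d) (j :: d) (gY A Z shr d j)))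
        (EE A (ev A Z shr d) j (j :: d) (cl A (npos A (ev A Z shr d) (j :: d) (gY A Z shr d j)))) (BB (j :: d))) := rfl
  rw [e1, ← gpos_eq _ _ _ _ hd, ← gN_cons _ _ _ _ hd, ← ev_cons A Z shr j hd]
  rfl

lemma gpos_two (j n : ℕ) (h : j < n) : gpos A Z shr [j, n] = ((gcur A Z shr [j], gY A Z shr [n] j), []) := by
  rw [gpos_eq _ _ _ _ (by simp), npos, if_pos (by simp)]
  have := env_cur A Z shr n [j] (by simpa using h)
  simp only [ev, List.headD_cons]
  rw [← this]; rfl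

lemma gpos_long (c : List ℕ) (hc : 3 ≤ c.length) (h : c.dropLast.getLastD 0 < c.getLastD 0) :
    gpos A Z shr c = nx A (gpos A Z shr c.dropLast) (gs A Z shr c.dropLast) (gY A Z shr c.tail (c.headD 0)) := by
  match c, hc with
  | j :: a :: d, hc =>
    rw [gpos_eq _ _ _ _ (by simp), npos, if_neg (by omega)]
    have e : ev A Z shr (a :: d) = env A Z shr ((j :: a :: d).getLastD 0) := by
      rw [← ev_cons A Z shr j (by simp)]; rfl
    rw [e, env_pos _ _ _ _ _ h, env_s _ _ _ _ _ h]
    rfl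
end cascade
end TG

namespace TG
section inv
variable (A Z : Set C) (shr : Set C → Set C)

structure PG (c : List ℕ) : Prop where
  ok : OK (gN A Z shr c)
  len : 2 ≤ c.length → (gpos A Z shr c).2.length = 4 * (c.length - 2)
  pk : 2 ≤ c.length → pK (gpos A Z shr c) = gY A Z shr c.tail (c.headD 0)
  pf : 2 ≤ c.length → pF (gpos A Z shr c) = gcur A Z shr c.dropLast
  sub : 2 ≤ c.length → gN A Z shr c ⊆ gcur A Z shr c.dropLast
  win : 2 ≤ c.length → Iwin A (gpos A Z shr c).1.1 (gpos A Z shr c).1.2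

structure Qc (c : List ℕ) : Prop where
  pg : PG A Z shr c
  pc : ∀ j ≤ c.headD 0, Pc (gY A Z shr c j) (gN A Z shr c) (BB c)
  an : ∀ j < c.headD 0, gY A Z shr c (j+1) ⊆ gY A Z shr c j

structure QQ (n : ℕ) : Prop where
  q : ∀ c : List ℕ, c ≠ [] → c.Pairwise (· < ·) → c.getLastD 0 = n → Qc A Z shr c
  z : Pc (gN A Z shr [n]) Z 0

variable {A Z shr}

lemma Qc.anti {c : List ℕ} (h : Qc A Z shr c) {i j : ℕ} (hij : i ≤ j) (hj : j ≤ c.headD 0) :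
    gY A Z shr c j ⊆ gY A Z shr c i := by
  induction j, hij using Nat.le_induction with
  | base => exact subset_rfl
  | succ j hij ih => exact (h.an j (by omega)).trans (ih (by omega))

lemma Qc.cur {c : List ℕ} (h : Qc A Z shr c) : Pc (gcur A Z shr c) (gN A Z shr c) (BB c) := h.pc _ le_rfl

lemma Pc.refl {X : Set C} (h : X.Nonempty) : Pc X X 0 := by
  obtain ⟨z, hz⟩ := h
  exact ⟨z, hz, 0, le_rfl, by ext x; simp [mem_cyl]⟩

lemma getLastD_cons (j : ℕ) {d : List ℕ} (hd : d ≠ []) : (j :: d).getLastD 0 = d.getLastD 0 := by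
  cases d with
  | nil => simp at hd
  | cons a d => simp [List.getLastD]


lemma pg_step (hA : @MeasurableSet _ (borel C) A) (hZ : OK Z) (hpZ : Perf Z)
  (hsh : ∀ S, Pc S Z 0 → Pc (shr S) S 0 ∧ ¬ Emb A S (shr S))
    {n : ℕ} (hQ : ∀ m < n, QQ A Z shr m) {j : ℕ} {d : List ℕ} (hd : d ≠ [])
    (hs : (j :: d).Pairwise (· < ·)) (hl : d.getLastD 0 = n) (hpg : PG A Z shr d)
    (hpc : Pc (gY A Z shr d j) (gN A Z shr d) (BB d)) : PG A Z shr (j :: d) := by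
  have key : (gpos A Z shr (j :: d)).2.length = 4 * ((j :: d).length - 2) ∧
      pK (gpos A Z shr (j :: d)) = gY A Z shr d j ∧
      pF (gpos A Z shr (j :: d)) = gcur A Z shr (j :: d).dropLast ∧
      Iwin A (gpos A Z shr (j :: d)).1.1 (gpos A Z shr (j :: d)).1.2 ∧
      OK (gcur A Z shr (j :: d).dropLast) := by
    match d, hd with
    | [a], _ =>
      have ha : a = n := by simpa using hl
      subst ha
      have hj : j < a := by simpa using hs
      rw [gpos_two _ _ _ _ _ hj]
      have hQc : ∀ m < a, Qc A Z shr [m] := fun m hm => (hQ m hm).q [m] (by simp) (by simp) (by simp)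
      have hcZ : ∀ m < a, Pc (gcur A Z shr [m]) Z 0 := fun m hm => (hQc m hm).cur.trans (hQ m hm).z
      have hgj : OK (gcur A Z shr [j]) := (hQc j hj).cur.ok (hQc j hj).pg.ok
      have hY : OK (gY A Z shr [a] j) := hpc.ok hpg.ok
      refine ⟨rfl, rfl, rfl, ?_, hgj⟩
      rcases dichotomy hA hgj hY with h | h
      · exact h
      · exfalso
        have he := emb_of_IIwin hgj hY ((hcZ j hj).perf hpZ) h
        obtain ⟨b, rfl⟩ : ∃ b, a = b + 1 := ⟨a - 1, by omega⟩
        have hm : ∀ m, j ≤ m → m < b + 1 → gcur A Z shr [m] ⊆ gcur A Z shr [j] := by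
          intro m hm
          induction m, hm using Nat.le_induction with
          | base => exact fun _ => subset_rfl
          | succ m hm ih =>
            intro hmb
            refine subset_trans ?_ (ih (by omega))
            refine (hQc (m+1) hmb).cur.sub.trans ?_
            rw [gN_succ]; exact (hsh _ (hcZ m (by omega))).1.sub
        refine (hsh _ (hcZ b (by omega))).2 (he.mono (hm b (by omega) (by omega)) ?_)
        rw [← gN_succ A Z shr]; exact hpc.sub
    | a :: b :: e, _ =>
      set d := a :: b :: e with hdef
      set c' := j :: d.dropLast with hc'
      have hcd : (j :: d).dropLast = c' := by rw [hc', hdef]; rfl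
      have hde : d.dropLast ≠ [] := by rw [hdef]; simp
      have hsd : d.Pairwise (· < ·) := hs.of_cons
      have hlast : c'.getLastD 0 < n := by
        rw [hc', getLastD_cons _ hde, ← hl]
        have h1 : d = d.dropLast ++ [d.getLastD 0] := by
          conv_lhs => rw [← List.dropLast_append_getLast (l := d) (by rw [hdef]; simp)]
          congr 2
        have h2 : d.dropLast.getLastD 0 ∈ d.dropLast := by
          rw [List.getLastD_eq_getLast?, List.getLast?_eq_getLast_of_ne_nil hde]
          exact List.getLast_mem _
        rw [h1, List.pairwise_append] at hsd
        exact hsd.2.2 _ h2 _ (by simp)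
      have hsc' : c'.Pairwise (· < ·) := by
        rw [← hcd]; exact hs.sublist (List.dropLast_sublist _)
      have q' : Qc A Z shr c' := (hQ _ hlast).q c' (by simp [hc']) hsc' rfl
      have qe : Qc A Z shr d.dropLast := (hQ _ (by rwa [hc', getLastD_cons _ hde] at hlast)).q _ hde
        (hsd.sublist (List.dropLast_sublist _)) rfl
      have hlc' : 2 ≤ c'.length := by simp [hc', hdef]
      have hlen := q'.pg.len hlc'
      have hmod : (gpos A Z shr c').2.length % 4 = 0 := by omega
      have hgp := gpos_long A Z shr (j :: d) (by simp [hdef]) (by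
        rw [hcd, getLastD_cons j (d := d) (by rw [hdef]; simp), hl]; exact hlast)
      rw [hcd] at hgp ⊢
      obtain ⟨s1, s2, s3⟩ := sel_spec q'.cur
      change (gs A Z shr c').1 ∈ _ at s1
      change _ ≤ (gs A Z shr c').2 at s2
      change _ = gN A Z shr c' ∩ cyl (gs A Z shr c').1 (gs A Z shr c').2 at s3
      have hcl : cl A (gpos A Z shr c') = gN A Z shr c' := (gN_cons A Z shr j hde).symm
      have hY := hpc.ok hpg.ok
      rw [hgp]
      refine ⟨?_, ?_, ?_, q'.pg.win hlc', q'.cur.ok q'.pg.ok⟩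
      · rw [nx_len, hlen]; simp [hc', hdef]; omega
      · rw [pK_nx hmod]
        refine clm_eq hY.1 hY.2 ?_
        have e1 : rep A (gpos A Z shr c') (gs A Z shr c') = gY A Z shr d.dropLast (j+1) :=
          (gY_succ A Z shr j hde).symm
        rw [e1]
        refine hpc.sub.trans ((hpg.sub (by simp [hdef])).trans (qe.anti ?_ le_rfl))
        have : j < a := by
          rw [List.pairwise_cons] at hs; exact hs.1 a (by simp [hdef])
        simpa [hdef] using this
      · rw [pF_nx hmod, hcl, rel, pick_eq s1, s3, max_eq_left]
        rw [hlen]; refine le_trans ?_ s2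
        show _ ≤ 4 * c'.length + 1
        omega
  obtain ⟨k1, k2, k3, k4, k5⟩ := key
  have hN : gN A Z shr (j :: d) = clm (gcur A Z shr (j :: d).dropLast) (sg A (gpos A Z shr (j :: d)).1 (gpos A Z shr (j :: d)).2).1 := by
    rw [gN_cons _ _ _ _ hd, cl, k3]
  exact ⟨by rw [hN]; exact k5.clm _, fun _ => k1, fun _ => k2, fun _ => k3, fun _ => by rw [hN]; exact clm_sub _ _, fun _ => k4⟩

lemma claim (hA : @MeasurableSet _ (borel C) A) (hZ : OK Z) (hpZ : Perf Z)
  (hsh : ∀ S, Pc S Z 0 → Pc (shr S) S 0 ∧ ¬ Emb A S (shr S))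
    {n : ℕ} (hQ : ∀ m < n, QQ A Z shr m) {d : List ℕ} (hd : d ≠ [])
    (hs : d.Pairwise (· < ·)) (hl : d.getLastD 0 = n) (hpg : PG A Z shr d) (j : ℕ) (hj : j ≤ d.headD 0) :
    Pc (gY A Z shr d j) (gN A Z shr d) (BB d) ∧
     ∀ i < j, PG A Z shr (i :: d) ∧ gY A Z shr d (i+1) ⊆ gY A Z shr d i := by
  induction j with
  | zero => exact ⟨by rw [gY_zero]; exact rel_pc hpg.ok.2 _ _, by simp⟩
  | succ j ih =>
    obtain ⟨h1, h2⟩ := ih (by omega)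
    have hs' : (j :: d).Pairwise (· < ·) := by
      match d, hd with
      | a :: d, _ =>
        have : j < a := hj
        rw [List.pairwise_cons]
        refine ⟨fun x hx => ?_, hs⟩
        rcases List.mem_cons.1 hx with rfl | hx
        · exact this
        · exact this.trans ((List.pairwise_cons.1 hs).1 x hx)
    have hp := pg_step hA hZ hpZ hsh hQ hd hs' hl hpg h1
    have hpk := hp.pk (by have := List.length_pos_iff.2 hd; simp; omega)
    have h3 : Pc (gY A Z shr d (j+1)) (gY A Z shr d j) 0 := by
      rw [gY_succ _ _ _ _ hd, rep, hpk]
      exact (rel_pc (h1.ok hpg.ok).2 _ _).mono (by omega)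
    refine ⟨h3.trans h1, fun i hi => ?_⟩
    rcases Nat.lt_succ_iff_lt_or_eq.1 hi with h | rfl
    · exact h2 i h
    · exact ⟨hp, h3.sub⟩

theorem allQ (hA : @MeasurableSet _ (borel C) A) (hZ : OK Z) (hpZ : Perf Z)
  (hsh : ∀ S, Pc S Z 0 → Pc (shr S) S 0 ∧ ¬ Emb A S (shr S))
    (n : ℕ) : QQ A Z shr n := by
  induction n using Nat.strong_induction_on with
  | _ n hQ =>
  have hz : Pc (gN A Z shr [n]) Z 0 := by
    cases n with
    | zero => rw [gN_zero]; exact Pc.refl hZ.2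
    | succ n =>
      rw [gN_succ]
      have h := ((hQ n (by omega)).q [n] (by simp) (by simp) (by simp)).cur.trans (hQ n (by omega)).z
      exact (hsh _ h).1.trans h
  refine ⟨?_, hz⟩
  have hpg : ∀ c : List ℕ, c ≠ [] → c.Pairwise (· < ·) → c.getLastD 0 = n → PG A Z shr c := by
    intro c
    induction c with
    | nil => simp
    | cons j d ih =>
      intro _ hs hl
      by_cases hd : d = []
      · subst hd
        have : j = n := by simpa using hl
        subst this
        exact ⟨hz.ok hZ, by simp, by simp, by simp, by simp, by simp⟩
      · rw [getLastD_cons _ hd] at hl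
        have hp := ih hd hs.of_cons hl
        refine ((claim hA hZ hpZ hsh hQ hd hs.of_cons hl hp (d.headD 0) le_rfl).2 j ?_).1
        match d, hd with
        | a :: d, _ => exact (List.pairwise_cons.1 hs).1 a (by simp)
  intro c hc hs hl
  have hp := hpg c hc hs hl
  exact ⟨hp, fun j hj => (claim hA hZ hpZ hsh hQ hc hs hl hp j hj).1,
    fun j hj => ((claim hA hZ hpZ hsh hQ hc hs hl hp (j+1) hj).2 j (by omega)).2⟩

theorem allC (hA : @MeasurableSet _ (borel C) A) (hZ : OK Z) (hpZ : Perf Z)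
  (hsh : ∀ S, Pc S Z 0 → Pc (shr S) S 0 ∧ ¬ Emb A S (shr S))
    {c : List ℕ} (hc : c ≠ []) (hs : c.Pairwise (· < ·)) : Qc A Z shr c :=
  (allQ hA hZ hpZ hsh _).q c hc hs rfl
end inv
end TG

namespace TG

def cc (h : ℕ → ℕ) (k : ℕ) : List ℕ := (List.range (k+1)).map h
lemma cc_ne (h : ℕ → ℕ) (k : ℕ) : cc h k ≠ [] := by simp [cc]
lemma cc_pw {h : ℕ → ℕ} (hh : StrictMono h) (k : ℕ) : (cc h k).Pairwise (· < ·) := by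
  rw [cc, List.pairwise_map]
  exact List.pairwise_lt_range.imp fun hab => hh hab
lemma cc_succ (h : ℕ → ℕ) (k : ℕ) : cc h (k+1) = h 0 :: cc (fun i => h (i+1)) k := by
  rw [cc, List.range_succ_eq_map, List.map_cons, List.map_map]; rfl
lemma cc_drop (h : ℕ → ℕ) (k : ℕ) : (cc h (k+1)).dropLast = cc h k := by
  rw [cc, List.range_succ, List.map_append]; simp [cc]
lemma cc_zero (h : ℕ → ℕ) : cc h 0 = [h 0] := rfl
lemma cc_head (h : ℕ → ℕ) (k : ℕ) : (cc h k).headD 0 = h 0 := by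
  cases k with
  | zero => rfl
  | succ k => rw [cc_succ]; rfl
lemma cc_len (h : ℕ → ℕ) (k : ℕ) : (cc h k).length = k+1 := by simp [cc]
lemma cc_last (h : ℕ → ℕ) (k : ℕ) : (cc h k).getLastD 0 = h k := by
  rw [cc, List.range_succ, List.map_append, List.getLastD_eq_getLast?]; simp

lemma nth_agree {H H' : Set ℕ} (hH : H.Infinite) {r : ℕ} (hag : ∀ i < Nat.nth (· ∈ H) r + 1, i ∈ H' ↔ i ∈ H)
    {i : ℕ} (hi : i ≤ r) : Nat.nth (· ∈ H') i = Nat.nth (· ∈ H) i := by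
  classical
  have hm : StrictMono (Nat.nth (· ∈ H)) := Nat.nth_strictMono hH
  set a := Nat.nth (· ∈ H) i with ha
  have hle : a ≤ Nat.nth (· ∈ H) r := hm.monotone hi
  have haH : a ∈ H := Nat.nth_mem_of_infinite hH i
  have haH' : a ∈ H' := (hag a (by omega)).2 haH
  have hc : Nat.count (· ∈ H') a = Nat.count (· ∈ H) a := by
    rw [Nat.count_eq_card_filter_range, Nat.count_eq_card_filter_range]
    congr 1
    apply Finset.filter_congr
    intro x hx
    rw [Finset.mem_range] at hx
    exact hag x (by omega)
  have hc2 : Nat.count (· ∈ H) a = i := Nat.count_nth_of_infinite (p := (· ∈ H)) hH i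
  have := Nat.nth_count (p := (· ∈ H')) haH'
  rw [hc, hc2] at this
  exact this

section fin
variable {A Z : Set C} {shr : Set C → Set C}

lemma gcur_anti (hA : @MeasurableSet _ (borel C) A) (hZ : OK Z) (hpZ : Perf Z)
  (hsh : ∀ S, Pc S Z 0 → Pc (shr S) S 0 ∧ ¬ Emb A S (shr S))
    {h : ℕ → ℕ} (hh : StrictMono h) : Antitone fun r => gcur A Z shr (cc h r) :=
  antitone_nat_of_succ_le fun r => by
    have q := allC hA hZ hpZ hsh (cc_ne h (r+1)) (cc_pw hh _)
    have h1 := q.pg.sub (by rw [cc_len]; omega)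
    rw [cc_drop] at h1
    exact q.cur.sub.trans h1

lemma gcur_ok (hA : @MeasurableSet _ (borel C) A) (hZ : OK Z) (hpZ : Perf Z)
  (hsh : ∀ S, Pc S Z 0 → Pc (shr S) S 0 ∧ ¬ Emb A S (shr S))
    {h : ℕ → ℕ} (hh : StrictMono h) (r : ℕ) : OK (gcur A Z shr (cc h r)) := by
  have q := allC hA hZ hpZ hsh (cc_ne h r) (cc_pw hh _)
  exact q.cur.ok q.pg.ok

lemma gcur_bit (hA : @MeasurableSet _ (borel C) A) (hZ : OK Z) (hpZ : Perf Z)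
  (hsh : ∀ S, Pc S Z 0 → Pc (shr S) S 0 ∧ ¬ Emb A S (shr S))
    {h : ℕ → ℕ} (hh : StrictMono h) {r : ℕ} {x y : C} (hx : x ∈ gcur A Z shr (cc h r))
    (hy : y ∈ gcur A Z shr (cc h r)) : x r = y r := by
  have q := allC hA hZ hpZ hsh (cc_ne h r) (cc_pw hh _)
  exact q.cur.small hx hy (by show _ < 4 * _ + 1; rw [cc_len]; omega)

lemma no_agree (hA : @MeasurableSet _ (borel C) A) (hZ : OK Z) (hpZ : Perf Z)
  (hsh : ∀ S, Pc S Z 0 → Pc (shr S) S 0 ∧ ¬ Emb A S (shr S))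
    {h : ℕ → ℕ} (hh : StrictMono h) {x y : C} (hx : ∀ r, x ∈ gcur A Z shr (cc h r))
    (hy : ∀ r, y ∈ gcur A Z shr (cc (fun i => h (i+1)) r)) :
    ¬ ((x ∈ A ↔ y ∈ A) ∧ ((∃ r, (gcur A Z shr (cc (fun i => h (i+1)) r)).Subsingleton) →
      ∃ r, (gcur A Z shr (cc h r)).Subsingleton)) := by
  have hh' : StrictMono (fun i => h (i+1)) := fun i j hij => hh (by omega)
  have q := fun r => allC hA hZ hpZ hsh (cc_ne h (r+1)) (cc_pw hh _)
  have hF : ∀ r, pF (gpos A Z shr (cc h (r+1))) = gcur A Z shr (cc h r) := fun r => by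
    rw [(q r).pg.pf (by rw [cc_len]; omega), cc_drop]
  have hK : ∀ r, gcur A Z shr (cc (fun i => h (i+1)) r) ⊆ pK (gpos A Z shr (cc h (r+1))) := fun r => by
    rw [(q r).pg.pk (by rw [cc_len]; omega), cc_head, cc_succ, List.tail_cons]
    have q' := allC hA hZ hpZ hsh (cc_ne (fun i => h (i+1)) r) (cc_pw hh' _)
    refine q'.anti ?_ le_rfl
    rw [cc_head]; exact (hh (by omega)).le
  have e0 : gpos A Z shr (cc h 1) = ((gcur A Z shr [h 0], gY A Z shr [h 1] (h 0)), []) := by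
    rw [cc_succ, cc_zero]; exact gpos_two _ _ _ _ _ (hh (by omega))
  rintro ⟨h1, h2⟩
  have hwin := (q 0).pg.win (by rw [cc_len])
  rw [e0] at hwin
  refine I_wins (A := A) (q := (gcur A Z shr [h 0], gY A Z shr [h 1] (h 0))) hwin (fun r => gpos A Z shr (cc h (r+1))) e0 ?_
    (x := x) (y := y) (fun r => by rw [hF]; exact hx r) (fun r => hK r (hy r)) ⟨h1, ?_⟩
  · intro r
    have := gpos_long A Z shr (cc h (r+2)) (by rw [cc_len]; omega) (by
      rw [cc_drop, cc_last, cc_last]; exact hh (by omega))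
    rw [cc_drop] at this
    exact ⟨_, _, this⟩
  · rintro ⟨r, hr⟩
    obtain ⟨r', hr'⟩ := h2 ⟨r, hr.anti (hK r)⟩
    exact ⟨r', by rw [hF]; exact hr'⟩

lemma cascade_false (hA : @MeasurableSet _ (borel C) A) (hZ : OK Z) (hpZ : Perf Z)
  (hsh : ∀ S, Pc S Z 0 → Pc (shr S) S 0 ∧ ¬ Emb A S (shr S))
    : False := by
  classical
  have hx : ∀ H : Set ℕ, ∃ x : C, H.Infinite → ∀ r, x ∈ gcur A Z shr (cc (Nat.nth (· ∈ H)) r) := by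
    intro H
    by_cases hH : H.Infinite
    · obtain ⟨x, hx⟩ := inter_ne (gcur_anti hA hZ hpZ hsh (Nat.nth_strictMono (p := (· ∈ H)) hH))
        (fun n => gcur_ok hA hZ hpZ hsh (Nat.nth_strictMono (p := (· ∈ H)) hH) n)
      exact ⟨x, fun _ => hx⟩
    · exact ⟨z0, fun h => absurd h hH⟩
  choose f hf using hx
  have hcc : ∀ H H' : Set ℕ, H.Infinite → ∀ r, (∀ i < Nat.nth (· ∈ H) r + 1, i ∈ H' ↔ i ∈ H) →
      cc (Nat.nth (· ∈ H')) r = cc (Nat.nth (· ∈ H)) r := by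
    intro H H' hH r hag
    refine List.map_congr_left fun i hi => ?_
    rw [List.mem_range] at hi
    exact nth_agree hH hag (by omega)
  have c1 : GP.CR {H | f H ∈ A} := by
    refine GP.CR.of_borel hA f ?_
    intro H hH n
    refine ⟨Nat.nth (· ∈ H) n + 1, fun H' hH' hag k hk => ?_⟩
    have hm : StrictMono (Nat.nth (· ∈ H)) := Nat.nth_strictMono hH
    have e := hcc H H' hH k fun i hi => hag i (hi.trans (by have := hm hk; omega))
    have h1 := hf H' hH' k
    rw [e] at h1
    exact gcur_bit hA hZ hpZ hsh hm h1 (hf H hH k)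
  have c2 : GP.CR {H | ∃ r, (gcur A Z shr (cc (Nat.nth (· ∈ H)) r)).Subsingleton} := by
    refine GP.CR.of_open ?_
    rintro H hH ⟨r, hr⟩
    refine ⟨Nat.nth (· ∈ H) r + 1, fun H' hH' hag => ⟨r, ?_⟩⟩
    rw [hcc H H' hH r hag]; exact hr
  obtain ⟨H, hH, h2⟩ := GP.two c1 c2
  have hm : StrictMono (Nat.nth (· ∈ H)) := Nat.nth_strictMono hH
  have hm' : StrictMono (fun i => Nat.nth (· ∈ H) (i+1)) := fun i j hij => hm (by omega)
  set H' : Set ℕ := Set.range (fun i => Nat.nth (· ∈ H) (i+1)) with hHd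
  have hH' : H'.Infinite := Set.infinite_range_of_injective hm'.injective
  have hsub : H' ⊆ H := by rintro _ ⟨i, rfl⟩; exact Nat.nth_mem_of_infinite hH _
  have he : Nat.nth (· ∈ H') = fun i => Nat.nth (· ∈ H) (i+1) := by
    rw [← StrictMono.range_inj (Nat.nth_strictMono (p := (· ∈ H')) hH') hm']
    exact Nat.range_nth_of_infinite (p := (· ∈ H')) hH'
  obtain ⟨k1, k2⟩ := h2 H subset_rfl hH H' hsub hH'
  have y1 := hf H' hH'
  change (f H ∈ A ↔ f H' ∈ A) at k1
  change ((∃ r, (gcur A Z shr (cc (Nat.nth (· ∈ H)) r)).Subsingleton) ↔ (∃ r, (gcur A Z shr (cc (Nat.nth (· ∈ H')) r)).Subsingleton)) at k2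
  rw [he] at y1 k2
  exact no_agree hA hZ hpZ hsh hm (hf H hH) y1 ⟨k1, k2.2⟩
end fin

theorem W {A Z : Set C} (hA : @MeasurableSet _ (borel C) A) (hZ : OK Z) (hpZ : Perf Z) :
    ∃ z ∈ Z, ∃ k, ∀ x ∈ Z ∩ cyl z k, ∀ n, Emb A (Z ∩ cyl z k) (Z ∩ cyl z k ∩ cyl x n) := by
  by_contra hcon
  push Not at hcon
  have : ∀ S, ∃ S', Pc S Z 0 → Pc S' S 0 ∧ ¬ Emb A S S' := by
    intro S
    by_cases hS : Pc S Z 0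
    · obtain ⟨z, hz, k, _, rfl⟩ := hS
      obtain ⟨x, hx, n, h⟩ := hcon z hz k
      exact ⟨_, fun _ => ⟨⟨x, hx, n, by omega, rfl⟩, h⟩⟩
    · exact ⟨∅, fun h => absurd h hS⟩
  choose shr hshr using this
  exact cascade_false hA hZ hpZ hshr
end TG

namespace BF
open TG

def Nw (P G : Set C) : Prop := ∀ O, IsOpen O → (P ∩ O).Nonempty → ∃ x ∈ P ∩ O, x ∉ G
def Cp (P U : Set C) : Prop := ∃ O, IsClopen O ∧ U = P ∩ O ∧ U.Nonempty
def Ag (n : ℕ) (U : Set C) : Prop := ∀ x ∈ U, ∀ y ∈ U, ∀ i < n, x i = y i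

lemma Ag.mono {n : ℕ} {U U' : Set C} (h : Ag n U) (h' : U' ⊆ U) : Ag n U' :=
  fun x hx y hy => h x (h' hx) y (h' hy)

structure St where
  U : Set C
  V : Set C
  R : Set (C × C)
  m : ℕ

structure Inv (A P : Set C) (s : St) : Prop where
  cu : Cp P s.U
  cv : Cp P s.V
  cl : IsClosed s.R
  su : ∀ p ∈ s.R, p.1 ∈ s.U
  sv : ∀ p ∈ s.R, p.2 ∈ s.V
  fn : ∀ p ∈ s.R, ∀ q ∈ s.R, p.1 = q.1 ↔ p.2 = q.2
  ap : ∀ p ∈ s.R, p.1 ∈ A ↔ p.2 ∈ A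
  nu : Nw P (Prod.fst '' s.R)
  nv : Nw P (Prod.snd '' s.R)

def St.sw (s : St) : St := ⟨s.V, s.U, Prod.swap ⁻¹' s.R, s.m⟩

variable {A P : Set C}

lemma fst_sw (R : Set (C × C)) : Prod.fst '' (Prod.swap ⁻¹' R) = Prod.snd '' R := by
  ext x; simp
lemma snd_sw (R : Set (C × C)) : Prod.snd '' (Prod.swap ⁻¹' R) = Prod.fst '' R := by
  ext x; simp

lemma Inv.sw {s : St} (h : Inv A P s) : Inv A P s.sw where
  cu := h.cv
  cv := h.cu
  cl := h.cl.preimage continuous_swap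
  su := fun p hp => h.sv _ hp
  sv := fun p hp => h.su _ hp
  fn := fun p hp q hq => (h.fn _ hp _ hq).symm
  ap := fun p hp => (h.ap _ hp).symm
  nu := by show Nw P (Prod.fst '' (Prod.swap ⁻¹' s.R)); rw [fst_sw]; exact h.nv
  nv := by show Nw P (Prod.snd '' (Prod.swap ⁻¹' s.R)); rw [snd_sw]; exact h.nu

lemma Nw.mono {G G' : Set C} (h : Nw P G) (hs : G' ⊆ G) : Nw P G' := fun O hO hn => by
  obtain ⟨x, hx, hx'⟩ := h O hO hn
  exact ⟨x, hx, fun h => hx' (hs h)⟩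

lemma Cp.sub {U : Set C} (h : Cp P U) : U ⊆ P := by
  obtain ⟨O, _, rfl, _⟩ := h; exact Set.inter_subset_left
lemma Cp.ok {U : Set C} (h : Cp P U) (hP : IsClosed P) : OK U := by
  obtain ⟨O, hO, rfl, hn⟩ := h; exact ⟨hP.inter hO.1, hn⟩
lemma Cp.inter {U W : Set C} (h : Cp P U) (hW : IsClopen W) (hn : (U ∩ W).Nonempty) : Cp P (U ∩ W) := by
  obtain ⟨O, hO, rfl, _⟩ := h
  exact ⟨O ∩ W, hO.inter hW, by rw [Set.inter_assoc], hn⟩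

lemma refillU (hP : IsClosed P) (hE : ∀ x ∈ P, ∀ n, Emb A P (P ∩ cyl x n)) {s : St} (h : Inv A P s)
    {G : Set C} (hG : IsClosed G) (hGn : Nw P G) :
    ∃ R', Inv A P ⟨s.U, s.V, R', s.m+1⟩ ∧ ∀ x ∈ s.U, x ∈ G → x ∈ Prod.fst '' R' := by
  obtain ⟨O, hO, eV, ⟨v, hv⟩⟩ := h.cv
  rw [eV] at hv
  obtain ⟨n, hn⟩ := exists_cyl_subset hO.2 hv.2
  obtain ⟨f, f1, f2, f3, f4⟩ := hE v hv.1 n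
  have hU := h.cu.sub
  have hUV : ∀ x ∈ P, f x ∈ s.V := fun x hx => by
    rw [eV]; exact ⟨(f3 hx).1, hn (f3 hx).2⟩
  have hc : IsCompact (G ∩ s.U) := (hG.inter (h.cu.ok hP).1).isCompact
  refine ⟨(fun a => (a, f a)) '' (G ∩ s.U), ⟨h.cu, h.cv, ?_, ?_, ?_, ?_, ?_, ?_, ?_⟩, ?_⟩
  · exact (hc.image_of_continuousOn (continuousOn_id.prodMk (f1.mono fun x hx => hU hx.2))).isClosed
  · rintro _ ⟨a, ha, rfl⟩; exact ha.2
  · rintro _ ⟨a, ha, rfl⟩; exact hUV _ (hU ha.2)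
  · rintro _ ⟨a, ha, rfl⟩ _ ⟨b, hb, rfl⟩
    exact ⟨fun e => congrArg f e, fun e => f2 (hU ha.2) (hU hb.2) e⟩
  · rintro _ ⟨a, ha, rfl⟩; exact (f4 a (hU ha.2)).symm
  · refine hGn.mono ?_
    rintro _ ⟨_, ⟨a, ha, rfl⟩, rfl⟩; exact ha.1
  · intro O' hO' hne
    by_contra hcon
    push Not at hcon
    obtain ⟨q, hq⟩ := hne
    obtain ⟨_, ⟨a, ha, rfl⟩, e⟩ := hcon q hq
    have hfa : f a ∈ O' := by rw [show f a = q from e]; exact hq.2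
    obtain ⟨O2, hO2, h1, h2⟩ := mem_nhdsWithin.1 (f1 a (hU ha.2) (hO'.mem_nhds hfa))
    obtain ⟨x, hx, hxG⟩ := hGn O2 hO2 ⟨a, hU ha.2, h1⟩
    have hfx : f x ∈ O' := h2 ⟨hx.2, hx.1⟩
    obtain ⟨_, ⟨a', ha', rfl⟩, e'⟩ := hcon (f x) ⟨h.cv.sub (hUV x hx.1), hfx⟩
    have := f2 (hU ha'.2) hx.1 e'
    exact hxG (this ▸ ha'.1)
  · intro x hx hxG
    exact ⟨(x, f x), ⟨x, ⟨hxG, hx⟩, rfl⟩, rfl⟩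

lemma sep {E0 E1 : Set C} (h0 : IsClosed E0) (h1 : IsClosed E1) (hd : Disjoint E0 E1) :
    ∃ W, IsClopen W ∧ E0 ⊆ W ∧ Disjoint W E1 := by
  have : ∀ x : E0, ∃ n, cyl x.1 n ⊆ E1ᶜ := fun x => exists_cyl_subset h1.isOpen_compl (Set.disjoint_left.1 hd x.2)
  choose n hn using this
  obtain ⟨t, ht⟩ := h0.isCompact.elim_finite_subcover (fun x : E0 => cyl x.1 (n x)) (fun x => (cyl_clopen _ _).2)
    (fun x hx => Set.mem_iUnion.2 ⟨⟨x, hx⟩, self_mem_cyl _ _⟩)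
  refine ⟨_, t.finite_toSet.isClopen_biUnion (f := fun x : E0 => cyl x.1 (n x)) fun i _ => cyl_clopen _ _, ht, ?_⟩
  rw [Set.disjoint_left]
  intro x hx
  simp only [Set.mem_iUnion] at hx
  obtain ⟨i, _, hi⟩ := hx
  exact hn i hi

def bt (W : Set C) (b : Bool) : Set C := if b then W else Wᶜ
lemma bt_clopen {W : Set C} (h : IsClopen W) (b : Bool) : IsClopen (bt W b) := by
  cases b
  · exact h.compl
  · exact h
lemma bt_ex (W : Set C) (x : C) : ∃ b, x ∈ bt W b := by
  by_cases h : x ∈ W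
  · exact ⟨true, h⟩
  · exact ⟨false, h⟩
lemma bt_uniq {W : Set C} {x : C} {b b' : Bool} (h : x ∈ bt W b) (h' : x ∈ bt W b') : b = b' := by
  cases b <;> cases b' <;> simp_all [bt]

/-- restriction of a state by clopen sets -/
def St.res (s : St) (W W' : Set C) : St := ⟨s.U ∩ W, s.V ∩ W', s.R ∩ {p | p.1 ∈ W}, s.m⟩

lemma splitU (hP : IsClosed P) (hp : Perf P) {s : St} (h : Inv A P s) :
    ∃ W W', (∀ b, Inv A P (s.res (bt W b) (bt W' b))) ∧ (∀ p ∈ s.R, ∀ b, p.1 ∈ bt W b ↔ p.2 ∈ bt W' b) ∧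
      ∀ n, Ag n s.U → ∀ b, Ag (n+1) (s.U ∩ bt W b) := by
  classical
  obtain ⟨O, hO, eU, ⟨u, hu⟩⟩ := h.cu
  rw [eU] at hu
  have hex : ∃ i, ∃ x ∈ s.U, ∃ y ∈ s.U, x i ≠ y i := by
    obtain ⟨n, hn⟩ := exists_cyl_subset hO.2 hu.2
    obtain ⟨y, hy, hy1, hy2⟩ := hp u hu.1 n
    obtain ⟨i, hi⟩ := Function.ne_iff.1 hy2
    rw [eU]
    exact ⟨i, y, ⟨hy, hn hy1⟩, u, hu, hi⟩
  set i := Nat.find hex with hi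
  have hmin : ∀ k < i, ∀ x ∈ s.U, ∀ y ∈ s.U, x k = y k := by
    intro k hk x hx y hy
    by_contra hne
    exact Nat.find_min hex hk ⟨x, hx, y, hy, hne⟩
  obtain ⟨x0, hx0, y0, hy0, hxy⟩ := Nat.find_spec hex
  rw [← hi] at hxy
  set W : Set C := {x | x i = true} with hW
  have hWc : IsClopen W := by
    have : W = (fun x : C => x i) ⁻¹' {true} := rfl
    rw [this]; exact (isClopen_discrete _).preimage (continuous_apply i)
  have hWb : ∀ b x, x ∈ bt W b ↔ x i = b := by
    intro b x; cases b <;> simp [bt, hW]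
  have hUb : ∀ b, (s.U ∩ bt W b).Nonempty := by
    intro b
    by_cases e : x0 i = b
    · exact ⟨x0, hx0, (hWb _ _).2 e⟩
    · refine ⟨y0, hy0, (hWb _ _).2 ?_⟩
      revert hxy e; cases x0 i <;> cases y0 i <;> cases b <;> simp
  set D : Bool → Set C := fun b => Prod.snd '' (s.R ∩ Prod.fst ⁻¹' bt W b) with hD
  have hDc : ∀ b, IsClosed (D b) := fun b =>
    ((h.cl.inter ((bt_clopen hWc b).1.preimage continuous_fst)).isCompact.image continuous_snd).isClosed
  obtain ⟨O', hO', eV, hVn⟩ := h.cv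
  rw [eV] at hVn
  obtain ⟨p0, hp0, hp0'⟩ := h.nv O' hO'.2 hVn
  obtain ⟨p1, hp1, hp1'⟩ := h.nv (O' \ {p0}) (hO'.2.sdiff isClosed_singleton) (by
    obtain ⟨n, hn⟩ := exists_cyl_subset hO'.2 hp0.2
    obtain ⟨y, hy, hy1, hy2⟩ := hp p0 hp0.1 n
    exact ⟨y, hy, hn hy1, hy2⟩)
  have hDR : ∀ b, D b ⊆ Prod.snd '' s.R := fun b => Set.image_mono Set.inter_subset_left
  obtain ⟨W', hW', w1, w2⟩ := sep (E0 := D true ∪ {p1}) (E1 := D false ∪ {p0})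
    ((hDc _).union isClosed_singleton) ((hDc _).union isClosed_singleton) (by
      rw [Set.disjoint_left]
      rintro y (hy | rfl) (hy' | rfl)
      · obtain ⟨p, ⟨a1, a2⟩, a3⟩ := hy
        obtain ⟨q, ⟨b1, b2⟩, b3⟩ := hy'
        have := (h.fn p a1 q b1).2 (a3.trans b3.symm)
        have e1 := (hWb true p.1).1 a2
        have e2 := (hWb false q.1).1 b2
        rw [this, e2] at e1
        simp at e1
      · exact hp0' (hDR _ hy)
      · exact hp1' (hDR _ hy')
      · exact hp1.2.2 rfl)
  rw [Set.disjoint_left] at w2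
  have hiff : ∀ p ∈ s.R, ∀ b, p.1 ∈ bt W b ↔ p.2 ∈ bt W' b := by
    have hone : ∀ p ∈ s.R, ∀ b, p.1 ∈ bt W b → p.2 ∈ bt W' b := by
      intro p hp b hb
      have : p.2 ∈ D b := ⟨p, ⟨hp, hb⟩, rfl⟩
      cases b
      · exact fun hh => w2 hh (Or.inl this)
      · exact w1 (Or.inl this)
    intro p hp b
    refine ⟨hone p hp b, fun hb => ?_⟩
    obtain ⟨b', hb'⟩ := bt_ex W p.1
    have := bt_uniq hb (hone p hp b' hb')
    rwa [this]
  refine ⟨W, W', fun b => ?_, hiff, ?_⟩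
  · refine ⟨h.cu.inter (bt_clopen hWc b) (hUb b), h.cv.inter (bt_clopen hW' b) ?_,
      h.cl.inter ((bt_clopen hWc b).1.preimage continuous_fst), ?_, ?_, ?_, ?_, ?_, ?_⟩
    · cases b
      · exact ⟨p0, by rw [eV]; exact hp0, fun hh => w2 hh (Or.inr rfl)⟩
      · exact ⟨p1, by rw [eV]; exact ⟨hp1.1, hp1.2.1⟩, w1 (Or.inr rfl)⟩
    · exact fun p hp => ⟨h.su p hp.1, hp.2⟩
    · exact fun p hp => ⟨h.sv p hp.1, (hiff p hp.1 b).1 hp.2⟩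
    · exact fun p hp q hq => h.fn p hp.1 q hq.1
    · exact fun p hp => h.ap p hp.1
    · exact h.nu.mono (Set.image_mono Set.inter_subset_left)
    · exact h.nv.mono (Set.image_mono Set.inter_subset_left)
  · intro n hn b x hx y hy k hk
    rcases lt_trichotomy k i with hki | rfl | hki
    · exact hmin k hki x hx.1 y hy.1
    · exact ((hWb _ _).1 hx.2).trans ((hWb _ _).1 hy.2).symm
    · exact absurd (hn x0 hx0 y0 hy0 i (by omega)) hxy
end BF

namespace BF
open TG
variable {A P : Set C}

abbrev B2 := Bool × Bool

structure Step (G : ℕ → Set C) (s : St) (c : B2 → St) (R' : Set (C × C)) (X Y : B2 → Set C) : Prop where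
  u : ∀ b, (c b).U = s.U ∩ X b
  v : ∀ b, (c b).V = s.V ∩ Y b
  r : ∀ b, (c b).R = R' ∩ {p | p.1 ∈ X b}
  xy : ∀ p ∈ R', ∀ b, p.1 ∈ X b ↔ p.2 ∈ Y b
  xe : ∀ x, ∃ b, x ∈ X b
  ye : ∀ x, ∃ b, x ∈ Y b
  xu : ∀ x b b', x ∈ X b → x ∈ X b' → b = b'
  yu : ∀ x b b', x ∈ Y b → x ∈ Y b' → b = b'
  agu : ∀ n, Ag n s.U → ∀ b, Ag (n+1) (c b).U
  agv : ∀ n, Ag n s.V → ∀ b, Ag (n+1) (c b).V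
  rne : s.R.Nonempty → R' = s.R ∧ ∀ b, (c b).m = s.m
  rem : s.R = ∅ → (∀ b, (c b).m = s.m + 1) ∧ (s.m % 2 = 0 → ∀ x ∈ s.U, x ∈ G (s.m / 2) → x ∈ Prod.fst '' R') ∧
    (s.m % 2 = 1 → ∀ x ∈ s.V, x ∈ G (s.m / 2) → x ∈ Prod.snd '' R')

variable {G : ℕ → Set C}

lemma refill (hP : IsClosed P) (hE : ∀ x ∈ P, ∀ n, Emb A P (P ∩ cyl x n))
    (hG : ∀ j, IsClosed (G j)) (hGn : ∀ j, Nw P (G j)) {s : St} (h : Inv A P s) :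
    ∃ R' m', Inv A P ⟨s.U, s.V, R', m'⟩ ∧ (s.R.Nonempty → R' = s.R ∧ m' = s.m) ∧
    (s.R = ∅ → m' = s.m + 1 ∧ (s.m % 2 = 0 → ∀ x ∈ s.U, x ∈ G (s.m / 2) → x ∈ Prod.fst '' R') ∧
    (s.m % 2 = 1 → ∀ x ∈ s.V, x ∈ G (s.m / 2) → x ∈ Prod.snd '' R')) := by
  rcases Set.eq_empty_or_nonempty s.R with h0 | h0
  · rcases Nat.mod_two_eq_zero_or_one s.m with hm | hm
    · obtain ⟨R', h1, h2⟩ := refillU hP hE h (hG (s.m/2)) (hGn (s.m/2))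
      exact ⟨R', s.m+1, h1, fun hh => absurd h0 hh.ne_empty, fun _ => ⟨rfl, fun _ => h2, fun hh => by omega⟩⟩
    · obtain ⟨R', h1, h2⟩ := refillU hP hE h.sw (hG (s.m/2)) (hGn (s.m/2))
      refine ⟨Prod.swap ⁻¹' R', s.m+1, h1.sw, fun hh => absurd h0 hh.ne_empty, fun _ => ⟨rfl, fun hh => by omega, fun _ => ?_⟩⟩
      rw [snd_sw]; exact h2
  · exact ⟨s.R, s.m, h, fun _ => ⟨rfl, rfl⟩, fun hh => absurd hh h0.ne_empty⟩

lemma exists_step (hP : IsClosed P) (hp : Perf P) (hE : ∀ x ∈ P, ∀ n, Emb A P (P ∩ cyl x n))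
    (hG : ∀ j, IsClosed (G j)) (hGn : ∀ j, Nw P (G j)) {s : St} (h : Inv A P s) :
    ∃ c R' X Y, (∀ b, Inv A P (c b)) ∧ Step G s c R' X Y := by
  obtain ⟨R', m', i1, r1, r2⟩ := refill hP hE hG hGn h
  obtain ⟨W, W', i2, k2, a2⟩ := splitU hP hp i1
  have := fun b => splitU hP hp (i2 b).sw
  choose T T' i3 k3 a3 using this
  refine ⟨fun b => (((St.mk s.U s.V R' m').res (bt W b.1) (bt W' b.1)).sw.res (bt (T b.1) b.2) (bt (T' b.1) b.2)).sw,
    R', fun b => bt W b.1 ∩ bt (T' b.1) b.2, fun b => bt W' b.1 ∩ bt (T b.1) b.2,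
    fun b => (i3 b.1 b.2).sw, ?_⟩
  have kk : ∀ p ∈ R', ∀ b : B2, p.1 ∈ bt W b.1 → (p.2 ∈ bt (T b.1) b.2 ↔ p.1 ∈ bt (T' b.1) b.2) := by
    intro p hp b hb
    exact k3 b.1 p.swap ⟨hp, hb⟩ b.2
  have ex : ∀ (W : Set C) (T : Bool → Set C) x, ∃ b : B2, x ∈ bt W b.1 ∩ bt (T b.1) b.2 := by
    intro W T x
    obtain ⟨b, hb⟩ := bt_ex W x
    obtain ⟨b', hb'⟩ := bt_ex (T b) x
    exact ⟨(b, b'), hb, hb'⟩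
  have un : ∀ (W : Set C) (T : Bool → Set C) x (b b' : B2), x ∈ bt W b.1 ∩ bt (T b.1) b.2 →
      x ∈ bt W b'.1 ∩ bt (T b'.1) b'.2 → b = b' := by
    rintro W T x ⟨b1, b2⟩ ⟨b1', b2'⟩ ⟨h1, h2⟩ ⟨h3, h4⟩
    obtain rfl : b1 = b1' := bt_uniq h1 h3
    obtain rfl : b2 = b2' := bt_uniq h2 h4
    rfl
  refine ⟨?_, ?_, ?_, ?_, ex _ _, ex _ _, un _ _, un _ _, ?_, ?_, ?_, ?_⟩
  · intro b; exact Set.inter_assoc _ _ _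
  · intro b; exact Set.inter_assoc _ _ _
  · intro b
    ext p
    constructor
    · rintro ⟨⟨h1, h2⟩, h3⟩
      exact ⟨h1, h2, (kk p h1 b h2).1 h3⟩
    · rintro ⟨h1, h2, h3⟩
      exact ⟨⟨h1, h2⟩, (kk p h1 b h2).2 h3⟩
  · intro p hp b
    constructor
    · rintro ⟨h1, h2⟩; exact ⟨(k2 p hp _).1 h1, (kk p hp b h1).2 h2⟩
    · rintro ⟨h1, h2⟩
      have h1' := (k2 p hp _).2 h1
      exact ⟨h1', (kk p hp b h1').1 h2⟩
  · intro n hn b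
    exact (a2 n hn b.1).mono Set.inter_subset_left
  · intro n hn b
    exact a3 b.1 n (hn.mono Set.inter_subset_left) b.2
  · intro hh; exact ⟨(r1 hh).1, fun _ => (r1 hh).2⟩
  · intro hh; exact ⟨fun _ => (r2 hh).1, (r2 hh).2⟩

/-- The tree of partial isomorphisms. -/
theorem bf_rel (hP : IsClosed P) (hp : Perf P) (hE : ∀ x ∈ P, ∀ n, Emb A P (P ∩ cyl x n))
    (hG : ∀ j, IsClosed (G j)) (hGn : ∀ j, Nw P (G j))
    (hgen : ∀ x ∈ P, ∀ y ∈ P, (∀ j, x ∉ G j) → (∀ j, y ∉ G j) → (x ∈ A ↔ y ∈ A))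
    {U V : Set C} (hU : Cp P U) (hV : Cp P V) :
    ∃ S S' : List B2 → Set C, S [] = U ∧ S' [] = V ∧ (∀ l, Cp P (S l)) ∧ (∀ l, Cp P (S' l)) ∧
      (∀ l, ∀ x ∈ S l, ∃ b, x ∈ S (b :: l)) ∧ (∀ l, ∀ x ∈ S' l, ∃ b, x ∈ S' (b :: l)) ∧
      (∀ l b, S (b :: l) ⊆ S l) ∧ (∀ l b, S' (b :: l) ⊆ S' l) ∧
      (∀ l x b b', x ∈ S (b :: l) → x ∈ S (b' :: l) → b = b') ∧
      (∀ l x b b', x ∈ S' (b :: l) → x ∈ S' (b' :: l) → b = b') ∧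
      (∀ l, Ag l.length (S l)) ∧ (∀ l, Ag l.length (S' l)) ∧
      (∀ x y, (∀ l, x ∈ S l ↔ y ∈ S' l) → x ∈ U → (x ∈ A ↔ y ∈ A)) := by
  have hst := fun s : {s : St // Inv A P s} => exists_step (G := G) hP hp hE hG hGn s.2
  choose c R' X Y hi hs using hst
  let s0 : {s : St // Inv A P s} := ⟨⟨U, V, ∅, 0⟩, hU, hV, isClosed_empty, by simp, by simp, by simp, by simp,
    by intro O _ h; obtain ⟨x, hx⟩ := h; exact ⟨x, hx, by simp⟩,
    by intro O _ h; obtain ⟨x, hx⟩ := h; exact ⟨x, hx, by simp⟩⟩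
  let t : List B2 → {s : St // Inv A P s} := fun l => List.rec s0 (fun b _ s => ⟨c s b, hi s b⟩) l
  have t0 : t [] = s0 := rfl
  have tc : ∀ b l, (t (b :: l)).1 = c (t l) b := fun _ _ => rfl
  have tu : ∀ b l, (t (b :: l)).1.U = (t l).1.U ∩ X (t l) b := fun b l => (hs (t l)).u b
  have tv : ∀ b l, (t (b :: l)).1.V = (t l).1.V ∩ Y (t l) b := fun b l => (hs (t l)).v b
  have tr : ∀ b l, (t (b :: l)).1.R = R' (t l) ∩ {p | p.1 ∈ X (t l) b} := fun b l => (hs (t l)).r b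
  have agU : ∀ l, Ag l.length (t l).1.U := by
    intro l
    induction l with
    | nil => intro x _ y _ i hi; simp at hi
    | cons b l ih => exact (hs (t l)).agu _ ih b
  have agV : ∀ l, Ag l.length (t l).1.V := by
    intro l
    induction l with
    | nil => intro x _ y _ i hi; simp at hi
    | cons b l ih => exact (hs (t l)).agv _ ih b
  refine ⟨fun l => (t l).1.U, fun l => (t l).1.V, rfl, rfl, fun l => (t l).2.cu, fun l => (t l).2.cv, ?_, ?_, ?_, ?_, ?_, ?_,
    agU, agV, ?_⟩
  · intro l x hx
    obtain ⟨b, hb⟩ := (hs (t l)).xe x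
    exact ⟨b, by simp only [tu]; exact ⟨hx, hb⟩⟩
  · intro l x hx
    obtain ⟨b, hb⟩ := (hs (t l)).ye x
    exact ⟨b, by simp only [tv]; exact ⟨hx, hb⟩⟩
  · intro l b; simp only [tu]; exact Set.inter_subset_left
  · intro l b; simp only [tv]; exact Set.inter_subset_left
  · intro l x b b' h1 h2
    simp only [tu] at h1 h2
    exact (hs (t l)).xu x b b' h1.2 h2.2
  · intro l x b b' h1 h2
    simp only [tv] at h1 h2
    exact (hs (t l)).yu x b b' h1.2 h2.2
  · intro x y hxy hxU
    -- the path
    have hpath : ∃ p : ℕ → List B2, p 0 = [] ∧ (∀ n, ∃ b, p (n+1) = b :: p n) ∧ ∀ n, x ∈ (t (p n)).1.U := by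
      have hnext : ∀ l : {l // x ∈ (t l).1.U}, ∃ b, x ∈ (t (b :: l.1)).1.U := by
        intro l
        obtain ⟨b, hb⟩ := (hs (t l.1)).xe x
        exact ⟨b, by rw [tu]; exact ⟨l.2, hb⟩⟩
      choose nb hnb using hnext
      let p : ℕ → {l // x ∈ (t l).1.U} := fun n => Nat.rec ⟨[], hxU⟩ (fun _ l => ⟨nb l :: l.1, hnb l⟩) n
      exact ⟨fun n => (p n).1, rfl, fun n => ⟨nb (p n), rfl⟩, fun n => (p n).2⟩
    obtain ⟨p, p0, pn, px⟩ := hpath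
    have py : ∀ n, y ∈ (t (p n)).1.V := fun n => (hxy _).1 (px n)
    have plen : ∀ n, (p n).length = n := by
      intro n
      induction n with
      | zero => rw [p0]; rfl
      | succ n ih => obtain ⟨b, hb⟩ := pn n; rw [hb, List.length_cons, ih]
    choose pb hpb using pn
    have pX : ∀ n, x ∈ X (t (p n)) (pb n) := fun n => by
      have := px (n+1); rw [hpb, tu] at this; exact this.2
    have pY : ∀ n, y ∈ Y (t (p n)) (pb n) := fun n => by
      have := py (n+1); rw [hpb, tv] at this; exact this.2
    have hUa : Antitone fun n => (t (p n)).1.U := antitone_nat_of_succ_le fun n => by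
      rw [hpb, tu]; exact Set.inter_subset_left
    have hVa : Antitone fun n => (t (p n)).1.V := antitone_nat_of_succ_le fun n => by
      rw [hpb, tv]; exact Set.inter_subset_left
    have hxu : ∀ n x', (∀ k ≥ n, x' ∈ (t (p k)).1.U) → x' = x := by
      intro n x' h
      funext i
      have h1 := h (max n (i+1)) (le_max_left _ _)
      exact agU _ x' h1 x (px _) i (by rw [plen]; omega)
    have hyu : ∀ n x', (∀ k ≥ n, x' ∈ (t (p k)).1.V) → x' = y := by
      intro n x' h
      funext i
      have h1 := h (max n (i+1)) (le_max_left _ _)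
      exact agV _ x' h1 y (py _) i (by rw [plen]; omega)
    have hRs : ∀ n, (t (p n)).1.R ⊆ R' (t (p n)) := by
      intro n
      rcases Set.eq_empty_or_nonempty (t (p n)).1.R with h | h
      · rw [h]; exact Set.empty_subset _
      · rw [((hs (t (p n))).rne h).1]
    have hRn : ∀ n, (t (p (n+1))).1.R = R' (t (p n)) ∩ {q | q.1 ∈ X (t (p n)) (pb n)} := fun n => by
      rw [hpb, tr]
    -- captured on the left
    have capx : ∀ n y', (x, y') ∈ (t (p n)).1.R → y' = y := by
      intro n y' h
      refine hyu n y' fun k hk => ?_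
      refine (t (p k)).2.sv (x, y') ?_
      induction k, hk using Nat.le_induction with
      | base => exact h
      | succ k hk ih => rw [hRn]; exact ⟨hRs k ih, pX k⟩
    have capy : ∀ n x', (x', y) ∈ (t (p n)).1.R → x' = x := by
      intro n x' h
      refine hxu n x' fun k hk => ?_
      refine (t (p k)).2.su (x', y) ?_
      induction k, hk using Nat.le_induction with
      | base => exact h
      | succ k hk ih => rw [hRn]; exact ⟨hRs k ih, ((hs (t (p k))).xy _ (hRs k ih) _).2 (pY k)⟩
    by_cases hcap : ∃ n, (x, y) ∈ (t (p n)).1.R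
    · obtain ⟨n, hn⟩ := hcap
      exact (t (p n)).2.ap _ hn
    push Not at hcap
    have hemp : ∀ n, ∃ k ≥ n, (t (p k)).1.R = ∅ := by
      intro n
      by_contra hcon
      push Not at hcon
      have hne : ∀ k, (t (p (n+k))).1.R.Nonempty := fun k => Set.nonempty_iff_ne_empty.2 (Set.nonempty_iff_ne_empty.1 (hcon (n+k) (by omega)))
      have hdec : ∀ k, (t (p (n+(k+1)))).1.R ⊆ (t (p (n+k))).1.R := fun k => by
        rw [← add_assoc, hRn, ((hs (t (p (n+k)))).rne (hne k)).1]; exact Set.inter_subset_left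
      obtain ⟨q, hq⟩ := IsCompact.nonempty_iInter_of_sequence_nonempty_isCompact_isClosed
        (fun k => (t (p (n+k))).1.R) hdec hne (t (p (n+0))).2.cl.isCompact (fun k => (t (p (n+k))).2.cl)
      have hq' := Set.mem_iInter.1 hq
      have e : q.1 = x := hxu n q.1 fun k hk => by
        have := (t _).2.su q (hq' (k-n))
        rwa [Nat.add_sub_cancel' hk] at this
      have hq0 : (x, q.2) ∈ (t (p (n+0))).1.R := by rw [← e]; exact hq' 0
      have e2 := capx _ _ hq0
      rw [e2] at hq0
      exact hcap _ hq0
    have hcount : ∀ m, ∃ k, (t (p k)).1.R = ∅ ∧ (t (p k)).1.m = m := by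
      have hgo : ∀ n, ∃ k ≥ n, (t (p k)).1.R = ∅ ∧ (t (p k)).1.m = (t (p n)).1.m := by
        intro n
        classical
        have hx := hemp n
        obtain ⟨h1, h2⟩ := Nat.find_spec hx
        refine ⟨Nat.find hx, h1, h2, ?_⟩
        have : ∀ k ≥ n, k ≤ Nat.find hx → (t (p k)).1.m = (t (p n)).1.m := by
          intro k hk
          induction k, hk using Nat.le_induction with
          | base => exact fun _ => rfl
          | succ k hk ih =>
            intro hle
            rw [← ih (by omega)]
            have hm := Nat.find_min hx (m := k) (by omega)
            have hne : (t (p k)).1.R.Nonempty := by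
              rw [Set.nonempty_iff_ne_empty]; exact fun h0 => hm ⟨hk, h0⟩
            rw [hpb]
            exact ((hs (t (p k))).rne hne).2 _
        exact this _ h1 le_rfl
      intro m
      induction m with
      | zero =>
        obtain ⟨k, _, h1, h2⟩ := hgo 0
        exact ⟨k, h1, by rw [h2, p0]⟩
      | succ m ih =>
        obtain ⟨k, h1, h2⟩ := ih
        obtain ⟨k', _, h3, h4⟩ := hgo (k+1)
        refine ⟨k', h3, ?_⟩
        rw [h4, hpb, ← h2]
        exact ((hs (t (p k))).rem h1).1 _
    refine hgen x (hU.sub hxU) y ((t (p 0)).2.cv.sub (py 0)) ?_ ?_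
    · intro j hj
      obtain ⟨k, h1, h2⟩ := hcount (2*j)
      have := ((hs (t (p k))).rem h1).2.1 (by omega) x (px k) (by rw [h2]; simpa using hj)
      obtain ⟨⟨x', y'⟩, h3, rfl⟩ := this
      have h4 : (x', y') ∈ (t (p (k+1))).1.R := by rw [hRn]; exact ⟨h3, pX k⟩
      have e := capx _ _ h4
      subst e
      exact hcap _ h4
    · intro j hj
      obtain ⟨k, h1, h2⟩ := hcount (2*j+1)
      have := ((hs (t (p k))).rem h1).2.2 (by omega) y (py k) (by
        rw [h2, show (2*j+1)/2 = j by omega]; exact hj)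
      obtain ⟨⟨x', y'⟩, h3, rfl⟩ := this
      have h4 : (x', y') ∈ (t (p (k+1))).1.R := by
        rw [hRn]; exact ⟨h3, ((hs (t (p k))).xy _ h3 _).2 (pY k)⟩
      have e := capy _ _ h4
      subst e
      exact hcap _ h4
end BF

namespace BF
open TG
variable {A P : Set C}

lemma path_uniq {S : List B2 → Set C} (an : ∀ l b, S (b :: l) ⊆ S l)
    (un : ∀ l x b b', x ∈ S (b :: l) → x ∈ S (b' :: l) → b = b') {p : ℕ → List B2} (p0 : p 0 = [])
    (pn : ∀ n, ∃ b, p (n+1) = b :: p n) {x : C} (px : ∀ n, x ∈ S (p n)) (l : List B2) (hx : x ∈ S l) : l = p l.length := by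
  induction l with
  | nil => exact p0.symm
  | cons b l ih =>
    have e := ih (an l b hx)
    obtain ⟨b', hb'⟩ := pn l.length
    have h1 := px (l.length+1)
    rw [hb', ← e] at h1
    rw [List.length_cons, hb', ← e, un l x b b' hx h1]

lemma ex_path {S : List B2 → Set C} (sp : ∀ l, ∀ x ∈ S l, ∃ b, x ∈ S (b :: l)) {x : C} (hx : x ∈ S []) :
    ∃ p : ℕ → List B2, p 0 = [] ∧ (∀ n, ∃ b, p (n+1) = b :: p n) ∧ (∀ n, (p n).length = n) ∧ ∀ n, x ∈ S (p n) := by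
  have hnext : ∀ l : {l // x ∈ S l}, ∃ b, x ∈ S (b :: l.1) := fun l => sp l.1 x l.2
  choose nb hnb using hnext
  let p : ℕ → {l // x ∈ S l} := fun n => Nat.rec ⟨[], hx⟩ (fun _ l => ⟨nb l :: l.1, hnb l⟩) n
  refine ⟨fun n => (p n).1, rfl, fun n => ⟨nb (p n), rfl⟩, fun n => ?_, fun n => (p n).2⟩
  induction n with
  | zero => rfl
  | succ n ih => show (nb (p n) :: (p n).1).length = _; rw [List.length_cons, ih]

lemma ex_rel {S S' : List B2 → Set C} (ok : ∀ l, OK (S' l)) (sp : ∀ l, ∀ x ∈ S l, ∃ b, x ∈ S (b :: l))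
    (an : ∀ l b, S (b :: l) ⊆ S l) (an' : ∀ l b, S' (b :: l) ⊆ S' l)
    (un : ∀ l x b b', x ∈ S (b :: l) → x ∈ S (b' :: l) → b = b')
    (un' : ∀ l x b b', x ∈ S' (b :: l) → x ∈ S' (b' :: l) → b = b') (x : S []) :
    ∃ y : S' [], ∀ l, x.1 ∈ S l ↔ y.1 ∈ S' l := by
  obtain ⟨p, p0, pn, _, px⟩ := ex_path sp x.2
  have ha : Antitone fun n => S' (p n) := antitone_nat_of_succ_le fun n => by
    obtain ⟨b, hb⟩ := pn n
    rw [hb]; exact an' _ _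
  obtain ⟨y, hy⟩ := inter_ne ha (fun n => ok _)
  refine ⟨⟨y, by have := hy 0; rwa [p0] at this⟩, fun l => ⟨fun h => ?_, fun h => ?_⟩⟩
  · rw [path_uniq an un p0 pn px l h]; exact hy _
  · rw [path_uniq an' un' p0 pn hy l h]; exact px _

lemma rel_cont {S S' : List B2 → Set C} (cp : ∀ l, Cp P (S l)) (sp : ∀ l, ∀ x ∈ S l, ∃ b, x ∈ S (b :: l))
    (ag' : ∀ l, Ag l.length (S' l)) (f : S [] → S' []) (hf : ∀ x, ∀ l, x.1 ∈ S l ↔ (f x).1 ∈ S' l) : Continuous f := by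
  refine Continuous.subtype_mk (continuous_pi fun i => ?_) _
  refine IsLocallyConstant.continuous ?_
  rw [IsLocallyConstant.iff_exists_open]
  intro x
  obtain ⟨p, _, _, pl, px⟩ := ex_path sp x.2
  obtain ⟨O, hO, e, _⟩ := cp (p (i+1))
  have hx := px (i+1)
  rw [e] at hx
  refine ⟨Subtype.val ⁻¹' O, hO.2.preimage continuous_subtype_val, hx.2, fun x' hx' => ?_⟩
  have h1 : x'.1 ∈ S (p (i+1)) := by rw [e]; exact ⟨(cp []).sub x'.2, hx'⟩
  exact ag' _ _ ((hf x' _).1 h1) _ ((hf x _).1 (px _)) i (by rw [pl]; omega)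

theorem bf_homeo {G : ℕ → Set C} (hP : IsClosed P) (hp : Perf P) (hE : ∀ x ∈ P, ∀ n, Emb A P (P ∩ cyl x n))
    (hG : ∀ j, IsClosed (G j)) (hGn : ∀ j, Nw P (G j))
    (hgen : ∀ x ∈ P, ∀ y ∈ P, (∀ j, x ∉ G j) → (∀ j, y ∉ G j) → (x ∈ A ↔ y ∈ A))
    {U V : Set C} (hU : Cp P U) (hV : Cp P V) :
    ∃ f : U ≃ₜ V, ∀ x : U, (x : C) ∈ A ↔ (f x : C) ∈ A := by
  obtain ⟨S, S', rfl, rfl, cp, cp', sp, sp', an, an', un, un', ag, ag', hA⟩ := bf_rel hP hp hE hG hGn hgen hU hV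
  choose f hf using ex_rel (fun l => (cp' l).ok hP) sp an an' un un'
  choose g hg using ex_rel (fun l => (cp l).ok hP) sp' an' an un' un
  have key : ∀ {T : List B2 → Set C}, (∀ l, ∀ x ∈ T l, ∃ b, x ∈ T (b :: l)) → (∀ l, Ag l.length (T l)) → ∀ x x' : T [],
      (∀ l, x.1 ∈ T l ↔ x'.1 ∈ T l) → x = x' := by
    intro T sp ag x x' h
    obtain ⟨p, _, _, pl, px⟩ := ex_path sp x.2
    refine Subtype.ext (funext fun i => ?_)
    exact ag (p (i+1)) _ (px _) _ ((h _).1 (px _)) i (by rw [pl]; omega)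
  refine ⟨⟨⟨f, g, fun x => ?_, fun y => ?_⟩, rel_cont cp sp ag' f hf, rel_cont cp' sp' ag g hg⟩, fun x => hA x.1 (f x).1 (hf x) x.2⟩
  · exact key sp ag _ _ fun l => ((hf x l).trans (hg (f x) l)).symm
  · exact key sp' ag' _ _ fun l => ((hg y l).trans (hf (g y) l)).symm
end BF

namespace HH
open TG BF Topology

lemma dec (p : C → ℕ → Prop) : ∃ L : ℕ → Set C, (∀ n, IsClopen (L n)) ∧ Pairwise (Function.onFun Disjoint L) ∧
    (∀ n, L n = ∅ ∨ ∃ z k, p z k ∧ L n ⊆ cyl z k) ∧ ∀ x, (∃ n, x ∈ L n) ↔ ∃ z k, p z k ∧ x ∈ cyl z k := by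
  classical
  let s : C × ℕ → Set C := fun q => if p q.1 q.2 then cyl q.1 q.2 else ∅
  have hs : ∀ q, IsClopen (s q) := by
    intro q
    by_cases h : p q.1 q.2
    · simp only [s, if_pos h]; exact cyl_clopen _ _
    · simp only [s, if_neg h]; exact isClopen_empty
  obtain ⟨T, hT, hU⟩ := TopologicalSpace.isOpen_iUnion_countable s (fun q => (hs q).2)
  obtain ⟨f, hf⟩ := Set.countable_iff_exists_subset_range.1 hT
  refine ⟨disjointed (fun n => s (f n)), fun n => ?_, disjoint_disjointed _, fun n => ?_, fun x => ?_⟩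
  · exact disjointedRec (p := IsClopen) (fun _ i ht => ht.diff (hs (f i))) (hs (f n))
  · have hle : disjointed (fun n => s (f n)) n ⊆ s (f n) := disjointed_le _ n
    by_cases h : p (f n).1 (f n).2
    · right
      simp only [s, if_pos h] at hle
      exact ⟨_, _, h, hle⟩
    · left
      simp only [s, if_neg h] at hle
      exact Set.subset_empty_iff.1 hle
  · have e : (⋃ n, disjointed (fun n => s (f n)) n) = ⋃ n, s (f n) := iUnion_disjointed
    rw [← Set.mem_iUnion, e]
    constructor
    · intro h
      obtain ⟨n, hn⟩ := Set.mem_iUnion.1 h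
      by_cases h : p (f n).1 (f n).2
      · simp only [s, if_pos h] at hn
        exact ⟨_, _, h, hn⟩
      · simp only [s, if_neg h] at hn; exact hn.elim
    · rintro ⟨z, k, h, hx⟩
      have h1 : x ∈ ⋃ q, s q := Set.mem_iUnion.2 ⟨(z, k), by simp only [s, if_pos h]; exact hx⟩
      rw [← hU] at h1
      simp only [Set.mem_iUnion] at h1
      obtain ⟨q, hq, hx⟩ := h1
      obtain ⟨n, rfl⟩ := hf hq
      exact Set.mem_iUnion.2 ⟨n, hx⟩

lemma baire {A P : Set C} (hA : @MeasurableSet _ (borel C) A) (hP : OK P) :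
    ∃ x ∈ P, ∃ n, ∃ G : ℕ → Set C, (∀ j, IsClosed (G j)) ∧ (∀ j, Nw (P ∩ cyl x n) (G j)) ∧
      ∀ x' ∈ P ∩ cyl x n, ∀ y ∈ P ∩ cyl x n, (∀ j, x' ∉ G j) → (∀ j, y ∉ G j) → (x' ∈ A ↔ y ∈ A) := by
  letI : MeasurableSpace C := borel C
  haveI : BorelSpace C := ⟨rfl⟩
  haveI : CompactSpace P := isCompact_iff_compactSpace.1 hP.1.isCompact
  have hA' : MeasurableSet (Subtype.val ⁻¹' A : Set P) := measurable_subtype_coe hA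
  obtain ⟨u, hu, he⟩ := hA'.baireMeasurableSet.residualEq_isOpen
  obtain ⟨t, ht, hg, hd⟩ := mem_residual.1 he
  obtain ⟨f, hf, rfl⟩ := hg.eq_iInter_nat
  have ht' : ∀ x : P, (∀ n, x ∈ f n) → (x.1 ∈ A ↔ x ∈ u) := by
    intro x hx
    have : (Subtype.val ⁻¹' A : Set P) x = u x := ht (Set.mem_iInter.2 hx)
    exact iff_of_eq this
  have hpc : ∃ x ∈ P, ∃ n, ∀ x' y : P, x'.1 ∈ cyl x n → y.1 ∈ cyl x n → (x' ∈ u ↔ y ∈ u) := by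
    rcases Set.eq_empty_or_nonempty u with rfl | ⟨x, hx⟩
    · obtain ⟨x, hx⟩ := hP.2
      exact ⟨x, hx, 0, fun _ _ _ _ => Iff.rfl⟩
    · obtain ⟨O, hO, rfl⟩ := isOpen_induced_iff.1 hu
      obtain ⟨n, hn⟩ := exists_cyl_subset hO hx
      exact ⟨x.1, x.2, n, fun x' y h1 h2 => iff_of_true (hn h1) (hn h2)⟩
  obtain ⟨x, hx, n, hxn⟩ := hpc
  refine ⟨x, hx, n, fun j => Subtype.val '' (f j)ᶜ, fun j => ?_, fun j => ?_, ?_⟩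
  · exact ((hf j).isClosed_compl.isCompact.image continuous_subtype_val).isClosed
  · intro O hO hne
    obtain ⟨y, ⟨hy1, hy2⟩, hy3⟩ := hne
    have hdj : Dense (f j) := hd.mono (Set.iInter_subset _ _)
    obtain ⟨w, hw1, hw2⟩ := hdj.inter_open_nonempty (Subtype.val ⁻¹' (cyl x n ∩ O))
      (((cyl_clopen x n).2.inter hO).preimage continuous_subtype_val) ⟨⟨y, hy1⟩, hy2, hy3⟩
    refine ⟨w.1, ⟨⟨w.2, hw1.1⟩, hw1.2⟩, ?_⟩
    rintro ⟨w', hw', e⟩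
    rw [Subtype.ext e] at hw'
    exact hw' hw2
  · intro a ha b hb h1 h2
    have k : ∀ c (hc : c ∈ P), (∀ j, c ∉ Subtype.val '' (f j)ᶜ) → (c ∈ A ↔ (⟨c, hc⟩ : P) ∈ u) := by
      intro c hc h
      refine ht' ⟨c, hc⟩ fun j => ?_
      by_contra hh
      exact h j ⟨⟨c, hc⟩, hh, rfl⟩
    rw [k a ha.1 h1, k b hb.1 h2]
    exact hxn _ _ ha.2 hb.2

lemma sum_homeo {E : Set C} {V : ℕ → Set C} (hE : E = ⋃ n, V n) (hd : Pairwise (Function.onFun Disjoint V))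
    (ho : ∀ n, ∃ O, IsOpen O ∧ V n = E ∩ O) : Nonempty ((Σ n, V n) ≃ₜ E) := by
  have hsub : ∀ n, V n ⊆ E := fun n => by rw [hE]; exact Set.subset_iUnion _ _
  let f : (Σ n, V n) → E := fun q => ⟨q.2.1, hsub q.1 q.2.2⟩
  have hb : Function.Bijective f := by
    constructor
    · rintro ⟨n, x, hx⟩ ⟨m, y, hy⟩ h
      have e : x = y := congrArg Subtype.val h
      subst e
      have : n = m := by
        by_contra hne
        exact Set.disjoint_left.1 (hd hne) hx hy
      subst this
      rfl
    · rintro ⟨x, hx⟩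
      have hx' := hx
      rw [hE] at hx'
      obtain ⟨n, hn⟩ := Set.mem_iUnion.1 hx'
      exact ⟨⟨n, x, hn⟩, rfl⟩
  refine ⟨(Equiv.ofBijective f hb).toHomeomorphOfContinuousOpen ?_ ?_⟩
  · show Continuous f
    exact continuous_sigma fun n => Continuous.subtype_mk continuous_subtype_val _
  · show IsOpenMap f
    rw [isOpenMap_sigma]
    intro n
    obtain ⟨O, hO, e⟩ := ho n
    have hsv : ∀ n, V n ⊆ E := hsub
    intro T hT
    obtain ⟨O', hO', rfl⟩ := isOpen_induced_iff.1 hT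
    rw [isOpen_induced_iff]
    refine ⟨O ∩ O', hO.inter hO', ?_⟩
    ext x
    constructor
    · rintro ⟨h1, h2⟩
      exact ⟨⟨x.1, by rw [e]; exact ⟨x.2, h1⟩⟩, h2, rfl⟩
    · rintro ⟨y, hy, rfl⟩
      exact ⟨((Set.ext_iff.1 e y.1).1 y.2).2, hy⟩

lemma glue {E E' : Set C} {V V' : ℕ → Set C} (hE : E = ⋃ n, V n) (hd : Pairwise (Function.onFun Disjoint V))
    (ho : ∀ n, ∃ O, IsOpen O ∧ V n = E ∩ O) (hE' : E' = ⋃ n, V' n) (hd' : Pairwise (Function.onFun Disjoint V'))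
    (ho' : ∀ n, ∃ O, IsOpen O ∧ V' n = E' ∩ O) (e : ∀ n, Nonempty (V n ≃ₜ V' n)) : Nonempty (E ≃ₜ E') := by
  obtain ⟨a⟩ := sum_homeo hE hd ho
  obtain ⟨a'⟩ := sum_homeo hE' hd' ho'
  have e' := fun n => (e n).some
  let m : (Σ n, V n) ≃ₜ (Σ n, V' n) :=
    { toEquiv := Equiv.sigmaCongrRight fun n => (e' n).toEquiv
      continuous_toFun := continuous_sigma fun n => continuous_sigmaMk.comp (e' n).continuous
      continuous_invFun := continuous_sigma fun n => continuous_sigmaMk.comp (e' n).symm.continuous }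
  exact ⟨(a.symm.trans m).trans a'⟩

/-- open subsets of a perfect set, minus a point, as infinite disjoint sums of clopen pieces -/
lemma pieces {P O : Set C} (hpP : Perf P) (hO : IsOpen O) {q : C} (hq : q ∈ P ∩ O) (hP : IsClosed P) :
    ∃ L : ℕ → Set C, (∀ n, IsClopen (L n)) ∧ Pairwise (Function.onFun Disjoint L) ∧ (∀ n, (P ∩ L n).Nonempty) ∧
      ∀ x ∈ P, (∃ n, x ∈ L n) ↔ (x ∈ O ∧ x ≠ q) := by
  obtain ⟨L, l1, l2, l3, l4⟩ := dec fun z k => cyl z k ⊆ O \ {q}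
  have hmem : ∀ x, (∃ n, x ∈ L n) ↔ (x ∈ O ∧ x ≠ q) := by
    intro x
    rw [l4]
    constructor
    · rintro ⟨z, k, h1, h2⟩; exact h1 h2
    · intro hx
      obtain ⟨k, hk⟩ := exists_cyl_subset (hO.sdiff isClosed_singleton) (x := x) hx
      exact ⟨x, k, hk, self_mem_cyl _ _⟩
  set S : Set ℕ := {n | (P ∩ L n).Nonempty} with hS
  have hinf : S.Infinite := by
    intro hfin
    have hcl : IsClosed (⋃ n ∈ S, L n) := hfin.isClosed_biUnion fun n _ => (l1 n).1
    have hqn : q ∈ (⋃ n ∈ S, L n)ᶜ := by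
      intro h
      simp only [Set.mem_iUnion] at h
      obtain ⟨n, _, h⟩ := h
      exact ((hmem q).1 ⟨n, h⟩).2 rfl
    obtain ⟨k, hk⟩ := exists_cyl_subset (hO.inter hcl.isOpen_compl) ⟨hq.2, hqn⟩
    obtain ⟨y, hy, hy1, hy2⟩ := hpP q hq.1 k
    obtain ⟨n, hn⟩ := (hmem y).2 ⟨(hk hy1).1, hy2⟩
    refine (hk hy1).2 ?_
    simp only [Set.mem_iUnion]
    exact ⟨n, ⟨y, hy, hn⟩, hn⟩
  have hm : StrictMono (Nat.nth (· ∈ S)) := Nat.nth_strictMono hinf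
  refine ⟨fun n => L (Nat.nth (· ∈ S) n), fun n => l1 _, fun i j hij => l2 fun h => hij (hm.injective h),
    fun n => Nat.nth_mem_of_infinite (p := (· ∈ S)) hinf n, fun x hx => ?_⟩
  rw [← hmem]
  constructor
  · rintro ⟨n, hn⟩; exact ⟨_, hn⟩
  · rintro ⟨n, hn⟩
    have hr : Set.range (Nat.nth (· ∈ S)) = S := Nat.range_nth_of_infinite (p := (· ∈ S)) hinf
    have : n ∈ Set.range (Nat.nth (· ∈ S)) := by rw [hr]; exact ⟨x, hx, hn⟩
    obtain ⟨i, rfl⟩ := this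
    exact ⟨i, hn⟩
end HH


namespace HH
open TG BF Topology

/-- h-homogeneity of a subset, phrased with ambient sets -/
def HHs (S : Set C) : Prop := ∀ D O O', IsOpen O → IsOpen O' → D = S ∩ O → S \ D = S ∩ O' →
  D.Nonempty → Nonempty (D ≃ₜ S)

lemma HHs.hh {S : Set C} (h : HHs S) : HHomogeneous ↥S := by
  intro U hU hne
  obtain ⟨O, hO, e1⟩ := isOpen_induced_iff.1 hU.2
  obtain ⟨O', hO', e2⟩ := isOpen_induced_iff.1 hU.1.isOpen_compl
  have k1 : Subtype.val '' U = S ∩ O := by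
    rw [← e1]; exact Subtype.image_preimage_coe S O
  have k2 : S \ (Subtype.val '' U) = S ∩ O' := by
    have : Subtype.val '' Uᶜ = S ∩ O' := by rw [← e2]; exact Subtype.image_preimage_coe S O'
    rw [← this]
    ext x
    constructor
    · rintro ⟨h1, h2⟩
      exact ⟨⟨x, h1⟩, fun h3 => h2 ⟨_, h3, rfl⟩, rfl⟩
    · rintro ⟨y, hy, rfl⟩
      refine ⟨y.2, ?_⟩
      rintro ⟨w, hw, e⟩
      rw [Subtype.ext e] at hw
      exact hy hw
  obtain ⟨g⟩ := h _ O O' hO hO' k1 k2 (hne.image _)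
  exact ⟨((IsEmbedding.subtypeVal (p := (· ∈ S))).homeomorphImage U).trans g⟩

lemma HHs.clopen {S O : Set C} (h : HHs S) (hO : IsClopen O) : HHs (S ∩ O) := by
  intro D O1 O2 h1 h2 e1 e2 hne
  have hD : D ⊆ S ∩ O := by rw [e1]; exact Set.inter_subset_left
  obtain ⟨a⟩ := h D (O ∩ O1) (Oᶜ ∪ O2) (hO.2.inter h1) (hO.1.isOpen_compl.union h2)
    (by rw [e1, Set.inter_assoc]) (by
      ext x
      have := Set.ext_iff.1 e2 x
      constructor
      · rintro ⟨k1, k2⟩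
        by_cases k3 : x ∈ O
        · exact ⟨k1, Or.inr (this.1 ⟨⟨k1, k3⟩, k2⟩).2⟩
        · exact ⟨k1, Or.inl k3⟩
      · rintro ⟨k1, k2⟩
        refine ⟨k1, fun k3 => ?_⟩
        rcases k2 with k2 | k2
        · exact k2 (hD k3).2
        · exact (this.2 ⟨hD k3, k2⟩).2 k3) hne
  obtain ⟨b⟩ := h (S ∩ O) O Oᶜ hO.2 hO.1.isOpen_compl rfl (by
      ext x; simp) (hne.mono hD)
  exact ⟨a.trans b.symm⟩

lemma HHs.subsing {S : Set C} (h : S.Subsingleton) : HHs S := by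
  intro D O1 O2 h1 h2 e1 e2 hne
  have : D = S := by
    apply Set.Subset.antisymm
    · rw [e1]; exact Set.inter_subset_left
    · intro x hx
      obtain ⟨y, hy⟩ := hne
      have hy' : y ∈ S := by rw [e1] at hy; exact hy.1
      rw [h hx hy']; exact hy
  exact ⟨Homeomorph.setCongr this⟩

lemma restr {X U V : Set C} (f : U ≃ₜ V) (hf : ∀ x : U, (x : C) ∈ X ↔ (f x : C) ∈ X) :
    Nonempty (↥(X ∩ U) ≃ₜ ↥(X ∩ V)) := by
  refine ⟨{ toFun := fun x => ⟨(f ⟨x.1, x.2.2⟩).1, (hf ⟨x.1, x.2.2⟩).1 x.2.1, (f ⟨x.1, x.2.2⟩).2⟩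
            invFun := fun y => ⟨(f.symm ⟨y.1, y.2.2⟩).1, ?_, (f.symm ⟨y.1, y.2.2⟩).2⟩
            left_inv := ?_
            right_inv := ?_
            continuous_toFun := ?_
            continuous_invFun := ?_ }⟩
  · refine (hf _).2 ?_
    rw [f.apply_symm_apply]
    exact y.2.1
  · intro x
    have h := congrArg Subtype.val (f.symm_apply_apply ⟨x.1, x.2.2⟩)
    exact Subtype.ext h
  · intro x
    have h := congrArg Subtype.val (f.apply_symm_apply ⟨x.1, x.2.2⟩)
    exact Subtype.ext h
  · exact Continuous.subtype_mk (continuous_subtype_val.comp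
      (f.continuous.comp (Continuous.subtype_mk continuous_subtype_val _))) _
  · exact Continuous.subtype_mk (continuous_subtype_val.comp
      (f.symm.continuous.comp (Continuous.subtype_mk continuous_subtype_val _))) _

lemma hh_full {X P : Set C} (hP : OK P) (hX : P ⊆ X)
    (hb : ∀ U V, Cp P U → Cp P V → Nonempty (↥(X ∩ U) ≃ₜ ↥(X ∩ V))) : HHs (X ∩ P) := by
  have e : X ∩ P = P := Set.inter_eq_right.2 hX
  rw [e]
  intro D O O' hO hO' e1 e2 hne
  have hD : D ⊆ P := by rw [e1]; exact Set.inter_subset_left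
  have c1 : IsClosed D := by
    have : D = P ∩ O'ᶜ := by
      ext x
      have := Set.ext_iff.1 e2 x
      constructor
      · intro h
        exact ⟨hD h, fun h' => (this.2 ⟨hD h, h'⟩).2 h⟩
      · rintro ⟨h1, h2⟩
        by_contra h3
        exact h2 (this.1 ⟨h1, h3⟩).2
    rw [this]; exact hP.1.inter hO'.isClosed_compl
  have c2 : IsClosed (P \ D) := by
    have : P \ D = P ∩ Oᶜ := by
      rw [e1]; ext x; simp
    rw [this]; exact hP.1.inter hO.isClosed_compl
  obtain ⟨W, hW, s1, s2⟩ := sep c1 c2 Set.disjoint_sdiff_right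
  have k : D = P ∩ W := by
    apply Set.Subset.antisymm
    · exact fun x hx => ⟨hD hx, s1 hx⟩
    · rintro x ⟨h1, h2⟩
      by_contra h3
      exact Set.disjoint_left.1 s2 h2 ⟨h1, h3⟩
  have := hb D P ⟨W, hW, k, hne⟩ ⟨Set.univ, isClopen_univ, by simp, hP.2⟩
  rw [Set.inter_eq_right.2 hX, Set.inter_eq_right.2 (hD.trans hX)] at this
  exact this

lemma hh_dense {X P : Set C} (hP : OK P) (hp : Perf P) (hX : ∀ x ∈ P, ∀ n, ∃ y ∈ P ∩ cyl x n, y ∉ X)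
    (hb : ∀ U V, Cp P U → Cp P V → Nonempty (↥(X ∩ U) ≃ₜ ↥(X ∩ V))) : HHs (X ∩ P) := by
  have key : ∀ D O : Set C, IsOpen O → D = X ∩ P ∩ O → D.Nonempty → ∃ V : ℕ → Set C, D = ⋃ n, X ∩ V n ∧
      Pairwise (Function.onFun Disjoint fun n => X ∩ V n) ∧
      (∀ n, ∃ O, IsOpen O ∧ X ∩ V n = D ∩ O) ∧ ∀ n, Cp P (V n) := by
    intro D O hO e hne
    obtain ⟨x, hx⟩ := hne
    rw [e] at hx
    obtain ⟨n, hn⟩ := exists_cyl_subset hO hx.2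
    obtain ⟨q, hq, hqX⟩ := hX x hx.1.2 n
    obtain ⟨L, l1, l2, l3, l4⟩ := pieces hp hO ⟨hq.1, hn hq.2⟩ hP.1
    have k : ∀ n, X ∩ (P ∩ L n) = D ∩ L n := by
      intro n
      rw [e]
      ext y
      constructor
      · rintro ⟨h1, h2, h3⟩
        exact ⟨⟨⟨h1, h2⟩, ((l4 y h2).1 ⟨n, h3⟩).1⟩, h3⟩
      · rintro ⟨⟨⟨h1, h2⟩, _⟩, h3⟩
        exact ⟨h1, h2, h3⟩
    refine ⟨fun n => P ∩ L n, ?_, ?_, fun n => ⟨L n, (l1 n).2, k n⟩, fun n => ⟨L n, l1 n, rfl, l3 n⟩⟩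
    · ext y
      rw [Set.mem_iUnion]
      constructor
      · intro hy
        have hy' := hy
        rw [e] at hy'
        obtain ⟨m, hm⟩ := (l4 y hy'.1.2).2 ⟨hy'.2, fun h => hqX (h ▸ hy'.1.1)⟩
        exact ⟨m, hy'.1.1, hy'.1.2, hm⟩
      · rintro ⟨m, hm⟩
        rw [k m] at hm
        exact hm.1
    · intro i j hij
      refine Set.disjoint_left.2 fun y h1 h2 => ?_
      exact Set.disjoint_left.1 (l2 hij) h1.2.2 h2.2.2
  intro D O O' hO hO' e1 e2 hne
  obtain ⟨V, v1, v2, v3, v4⟩ := key D O hO e1 hne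
  obtain ⟨V', v1', v2', v3', v4'⟩ := key (X ∩ P) Set.univ isOpen_univ (by simp)
    (hne.mono (by rw [e1]; exact Set.inter_subset_left))
  exact glue v1 v2 v3 v1' v2' v3' fun n => hb _ _ (v4 n) (v4' n)

lemma local_claim {X Z : Set C} (hA : @MeasurableSet _ (borel C) X) (hZ : OK Z) :
    ∃ z ∈ Z, ∃ k, HHs (X ∩ (Z ∩ cyl z k)) := by
  classical
  by_cases hp : Perf Z
  swap
  · unfold Perf at hp
    push Not at hp
    obtain ⟨x, hx, n, h⟩ := hp
    refine ⟨x, hx, n, HHs.subsing ?_⟩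
    rintro a ⟨_, a1, a2⟩ b ⟨_, b1, b2⟩
    rw [h a a1 a2, h b b1 b2]
  obtain ⟨z, hz, k, hE⟩ := W hA hZ hp
  set P0 := Z ∩ cyl z k with hP0
  have okP0 : OK P0 := ⟨hZ.1.inter (cyl_clopen z k).1, z, hz, self_mem_cyl z k⟩
  have pP0 : Perf P0 := hp.inter z k
  have hEP : ∀ x n, ∀ y ∈ P0 ∩ cyl x n, ∀ m, Emb X (P0 ∩ cyl x n) (P0 ∩ cyl x n ∩ cyl y m) := by
    intro x n y hy m
    refine (hE y hy.1 (max n m)).mono Set.inter_subset_left ?_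
    rintro w ⟨h1, h2⟩
    refine ⟨⟨h1, ?_⟩, cyl_anti y (le_max_right n m) h2⟩
    have : w ∈ cyl y n := cyl_anti y (le_max_left n m) h2
    rw [cyl_eq hy.2] at this
    exact this
  have key : ∀ x ∈ P0, ∀ n, HHs (X ∩ (P0 ∩ cyl x n)) → ∃ z ∈ Z, ∃ k, HHs (X ∩ (Z ∩ cyl z k)) := by
    intro x hx n h
    refine ⟨x, hx.1, max k n, ?_⟩
    have e : Z ∩ cyl x (max k n) = P0 ∩ cyl x n ∩ cyl x (max k n) := by
      ext w
      constructor
      · rintro ⟨h1, h2⟩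
        refine ⟨⟨⟨h1, ?_⟩, cyl_anti x (le_max_right k n) h2⟩, h2⟩
        have : w ∈ cyl x k := cyl_anti x (le_max_left k n) h2
        rw [cyl_eq hx.2] at this
        exact this
      · rintro ⟨⟨⟨h1, _⟩, _⟩, h2⟩
        exact ⟨h1, h2⟩
    rw [e, ← Set.inter_assoc]
    exact h.clopen (cyl_clopen _ _)
  have okP : ∀ x ∈ P0, ∀ n, OK (P0 ∩ cyl x n) := fun x hx n =>
    ⟨okP0.1.inter (cyl_clopen x n).1, x, hx, self_mem_cyl x n⟩
  by_cases hc : ∃ x ∈ P0, ∃ n, P0 ∩ cyl x n ⊆ X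
  · obtain ⟨x, hx, n, h⟩ := hc
    refine key x hx n (hh_full (okP x hx n) h fun U V hU hV => ?_)
    obtain ⟨f, hf⟩ := bf_homeo (G := fun _ => ∅) (okP x hx n).1 (pP0.inter x n) (hEP x n) (fun _ => isClosed_empty)
      (fun _ O _ ⟨y, hy⟩ => ⟨y, hy, fun h => h⟩) (fun a ha b hb _ _ => ⟨fun _ => h hb, fun _ => h ha⟩) hU hV
    exact restr f hf
  · push Not at hc
    obtain ⟨x, hx, n, G, g1, g2, g3⟩ := baire hA okP0
    refine key x hx n (hh_dense (okP x hx n) (pP0.inter x n) ?_ fun U V hU hV => ?_)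
    · intro y hy m
      obtain ⟨w, hw, hwX⟩ := Set.not_subset.1 (hc y hy.1 (max n m))
      refine ⟨w, ⟨⟨hw.1, ?_⟩, cyl_anti y (le_max_right n m) hw.2⟩, hwX⟩
      have : w ∈ cyl y n := cyl_anti y (le_max_left n m) hw.2
      rw [cyl_eq hy.2] at this
      exact this
    · obtain ⟨f, hf⟩ := bf_homeo (okP x hx n).1 (pP0.inter x n) (hEP x n) g1 g2 g3 hU hV
      exact restr f hf

end HH

namespace HH
open TG BF Topology

/-- `E` is partitioned into countably many relatively closed h-homogeneous subsets of `X` -/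
def Good (X E : Set C) : Prop := ∃ f : ℕ → Set C, Pairwise (Function.onFun Disjoint f) ∧
  (∀ i, ∃ K, IsClosed K ∧ f i = X ∩ K) ∧ (∀ i, HHs (f i)) ∧ E = ⋃ i, f i

lemma Good.clopen {X E O : Set C} (h : Good X E) (hO : IsClopen O) : Good X (E ∩ O) := by
  obtain ⟨f, h1, h2, h3, h4⟩ := h
  refine ⟨fun i => f i ∩ O, ?_, ?_, fun i => (h3 i).clopen hO, ?_⟩
  · intro i j hij
    exact (h1 hij).mono Set.inter_subset_left Set.inter_subset_left
  · intro i
    obtain ⟨K, hK, e⟩ := h2 i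
    exact ⟨K ∩ O, hK.inter hO.1, by show f i ∩ O = _; rw [e, Set.inter_assoc]⟩
  · rw [h4, Set.iUnion_inter]

lemma Good.iUnion {X : Set C} {E : ℕ → Set C} (h : ∀ n, Good X (E n)) (hd : Pairwise (Function.onFun Disjoint E)) :
    Good X (⋃ n, E n) := by
  choose f h1 h2 h3 h4 using h
  refine ⟨fun i => f (Nat.unpair i).1 (Nat.unpair i).2, ?_, fun i => h2 _ _, fun i => h3 _ _, ?_⟩
  · intro i j hij
    show Disjoint (f (Nat.unpair i).1 (Nat.unpair i).2) (f (Nat.unpair j).1 (Nat.unpair j).2)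
    by_cases e : (Nat.unpair i).1 = (Nat.unpair j).1
    · rw [e]
      apply h1
      intro e2
      apply hij
      rw [← Nat.pair_unpair i, ← Nat.pair_unpair j, e, e2]
    · refine (hd e).mono ?_ ?_
      · rw [h4]; exact Set.subset_iUnion (f (Nat.unpair i).1) _
      · rw [h4]; exact Set.subset_iUnion (f (Nat.unpair j).1) _
  · ext x
    constructor
    · intro hx
      obtain ⟨n, hn⟩ := Set.mem_iUnion.1 hx
      rw [h4] at hn
      obtain ⟨m, hm⟩ := Set.mem_iUnion.1 hn
      refine Set.mem_iUnion.2 ⟨Nat.pair n m, ?_⟩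
      rw [Nat.unpair_pair]
      exact hm
    · intro hx
      obtain ⟨i, hi⟩ := Set.mem_iUnion.1 hx
      refine Set.mem_iUnion.2 ⟨(Nat.unpair i).1, ?_⟩
      rw [h4]
      exact Set.mem_iUnion.2 ⟨_, hi⟩

lemma Good.empty (X : Set C) : Good X ∅ :=
  ⟨fun _ => ∅, fun i j _ => disjoint_bot_left, fun _ => ⟨∅, isClosed_empty, by simp⟩,
    fun _ => HHs.subsing Set.subsingleton_empty, by simp⟩

lemma Good.add {X E K : Set C} (h : Good X E) (hK : IsClosed K) (hh : HHs (X ∩ K)) (hd : Disjoint (X ∩ K) E) :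
    Good X ((X ∩ K) ∪ E) := by
  obtain ⟨f, h1, h2, h3, h4⟩ := h
  have hs : ∀ i, f i ⊆ E := fun i => by rw [h4]; exact Set.subset_iUnion _ _
  refine ⟨fun i => Nat.casesOn i (X ∩ K) f, ?_, ?_, ?_, ?_⟩
  · rintro (_ | i) (_ | j) hij
    · exact absurd rfl hij
    · exact hd.mono_right (hs j)
    · exact (hd.mono_right (hs i)).symm
    · exact h1 fun e => hij (by rw [e])
  · rintro (_ | i)
    · exact ⟨K, hK, rfl⟩
    · exact h2 i
  · rintro (_ | i)
    · exact hh
    · exact h3 i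
  · ext x
    constructor
    · rintro (hx | hx)
      · exact Set.mem_iUnion.2 ⟨0, hx⟩
      · rw [h4] at hx
        obtain ⟨i, hi⟩ := Set.mem_iUnion.1 hx
        exact Set.mem_iUnion.2 ⟨i + 1, hi⟩
    · intro hx
      obtain ⟨i, hi⟩ := Set.mem_iUnion.1 hx
      rcases i with _ | i
      · exact Or.inl hi
      · exact Or.inr (hs i hi)

lemma good_all {X : Set C} (hA : @MeasurableSet _ (borel C) X) : Good X X := by
  obtain ⟨L, l1, l2, l3, l4⟩ := dec fun z k => Good X (X ∩ cyl z k)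
  set O := ⋃ n, L n with hO
  have oO : IsOpen O := isOpen_iUnion fun n => (l1 n).2
  have gO : Good X (X ∩ O) := by
    rw [hO, Set.inter_iUnion]
    refine Good.iUnion (fun n => ?_) fun i j hij => (l2 hij).mono Set.inter_subset_right Set.inter_subset_right
    rcases l3 n with e | ⟨z, k, g, hs⟩
    · rw [e, Set.inter_empty]; exact Good.empty X
    · have := g.clopen (l1 n)
      rw [Set.inter_assoc, Set.inter_eq_right.2 hs] at this
      exact this
  have hin : ∀ z k, Good X (X ∩ cyl z k) → cyl z k ⊆ O := fun z k h x hx =>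
    Set.mem_iUnion.2 ((l4 x).2 ⟨z, k, h, hx⟩)
  by_cases hG : (X \ O).Nonempty
  · exfalso
    have hZ : OK (closure (X \ O)) := ⟨isClosed_closure, hG.mono subset_closure⟩
    have hZO : closure (X \ O) ⊆ Oᶜ := closure_minimal (fun x hx => hx.2) oO.isClosed_compl
    obtain ⟨z, hz, k, hh⟩ := local_claim hA hZ
    have e : X ∩ cyl z k = (X ∩ (closure (X \ O) ∩ cyl z k)) ∪ (X ∩ O ∩ cyl z k) := by
      ext x
      constructor
      · rintro ⟨h1, h2⟩
        by_cases h3 : x ∈ O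
        · exact Or.inr ⟨⟨h1, h3⟩, h2⟩
        · exact Or.inl ⟨h1, subset_closure ⟨h1, h3⟩, h2⟩
      · rintro (⟨h1, _, h2⟩ | ⟨⟨h1, _⟩, h2⟩)
        · exact ⟨h1, h2⟩
        · exact ⟨h1, h2⟩
    have g : Good X (X ∩ cyl z k) := by
      rw [e]
      refine (gO.clopen (cyl_clopen z k)).add (isClosed_closure.inter (cyl_clopen z k).1) hh ?_
      exact Set.disjoint_left.2 fun x h1 h2 => hZO h1.2.1 h2.1.2
    exact hZO hz (hin z k g (self_mem_cyl z k))
  · have : X ∩ O = X := Set.inter_eq_left.2 (Set.sdiff_eq_empty.1 (Set.not_nonempty_iff_eq_empty.1 hG))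
    rwa [this] at gO

end HH

/-- Every Borel subset `X` of the Cantor space `ℕ → Bool` can be partitioned
into countably many pairwise disjoint subspaces `f i`, each closed in `X` and
h-homogeneous in the subspace topology. -/
theorem borel_partition_hHomogeneous (X : Set (ℕ → Bool))
    (hX : @MeasurableSet (ℕ → Bool) (borel (ℕ → Bool)) X) :
    ∃ f : ℕ → Set (ℕ → Bool),
      (∀ i, f i ⊆ X) ∧
      Pairwise (Function.onFun Disjoint f) ∧
      (∀ i, IsClosed (Subtype.val ⁻¹' f i : Set ↥X)) ∧
      (∀ i, HHomogeneous ↥(f i)) ∧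
      X = ⋃ i, f i := by
  obtain ⟨f, h1, h2, h3, h4⟩ := HH.good_all (X := X) hX
  refine ⟨f, fun i => ?_, h1, fun i => ?_, fun i => (h3 i).hh, h4⟩
  · obtain ⟨K, _, e⟩ := h2 i
    rw [e]; exact Set.inter_subset_left
  · obtain ⟨K, hK, e⟩ := h2 i
    rw [e]
    have : (Subtype.val ⁻¹' (X ∩ K) : Set ↥X) = Subtype.val ⁻¹' K := by
      ext x
      exact ⟨fun h => h.2, fun h => ⟨x.2, h⟩⟩
    rw [this]
    exact hK.preimage continuous_subtype_val
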